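/- arXiv:2503.23248 — 4 statements merged into one kernel-verified Lean document; each statement's English description precedes it below -/
import Mathlib

section
/- Let G be a discrete group with finite generating set γ = (g_1,...,g_n) and λ its left regular representation on ℓ²(G). For finite disjoint subsets X_1, X_2 ⊂ G, the classical nonlinear condenser capacity cap_J(X_1, X_2) on the Cayley graph equals the noncommutative condenser quasicentral modulus k_J(λ(γ); P_{ℓ²(X_1)}, P_{ℓ²(X_2)}). -/
open Filter ContinuousLinearMap
open scoped ENNReal

variable {H : Type} [NormedAddCommGroup H] [InnerProductSpace ℂ H] [CompleteSpace H]

/-- A finite rank operator. -/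
def FinRank (A : H →L[ℂ] H) : Prop := FiniteDimensional ℂ (LinearMap.range A.toLinearMap)

/-- A normed ideal of compact operators, presented through its (possibly infinite) norm. -/
structure NormedIdeal (H : Type) [NormedAddCommGroup H] [InnerProductSpace ℂ H]
    [CompleteSpace H] where
  ν : (H →L[ℂ] H) → ℝ≥0∞
  ν_zero : ν 0 = 0
  ν_add : ∀ X Y, ν (X + Y) ≤ ν X + ν Y
  ν_smul : ∀ (c : ℂ) X, ν (c • X) = (‖c‖₊ : ℝ≥0∞) * ν X
  ν_mul : ∀ A X B, ν (A * X * B) ≤ (‖A‖₊ : ℝ≥0∞) * ν X * (‖B‖₊ : ℝ≥0∞)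
  compact : ∀ X, ν X ≠ ⊤ → IsCompactOperator X

/-- `max_j |[A, T_j]|_J`. -/
noncomputable def commSup (J : NormedIdeal H) {n : ℕ} (τ : Fin n → H →L[ℂ] H)
    (A : H →L[ℂ] H) : ℝ≥0∞ :=
  ⨆ j, J.ν (A * τ j - τ j * A)

/-- `A_m ∈ R_1^+`, `A_m ↑ I` strongly. -/
def ApproxUnit (A : ℕ → H →L[ℂ] H) : Prop :=
  (∀ m, FinRank (A m) ∧ 0 ≤ A m ∧ A m ≤ 1) ∧ Monotone A ∧
    ∀ x : H, Tendsto (fun m => A m x) atTop (nhds x)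

/-- The quasicentral modulus `k_J(τ)`. -/
noncomputable def qcMod (J : NormedIdeal H) {n : ℕ} (τ : Fin n → H →L[ℂ] H) : ℝ≥0∞ :=
  sInf {C | ∃ A, ApproxUnit A ∧ Tendsto (fun m => commSup J τ (A m)) atTop (nhds C)}

/-- An orthogonal projection. -/
def IsProj' (P : H →L[ℂ] H) : Prop := IsSelfAdjoint P ∧ P * P = P

/-- The condenser quasicentral modulus `k_J(τ; P, Q)`. -/
noncomputable def qcModCond (J : NormedIdeal H) {n : ℕ} (τ : Fin n → H →L[ℂ] H)
    (P Q : H →L[ℂ] H) : ℝ≥0∞ :=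
  sInf {c | ∃ A : H →L[ℂ] H, FinRank A ∧ 0 ≤ A ∧ A ≤ 1 ∧ A * P = P ∧ A * Q = 0 ∧
    c = commSup J τ A}

section Groups

variable (G : Type) [Group G]

/-- `ℓ²(G)`. -/
abbrev L2G (G : Type) [Group G] : Type := lp (fun _ : G => ℂ) 2

/-- The indicator function of a finite set, as a `ℂ`-valued symbol. -/
noncomputable def indC (X : Finset G) : G → ℂ := Set.indicator (↑X) fun _ => (1 : ℂ)

open Classical in
/-- The canonical basis vector of `ℓ²`. -/
noncomputable def qcE {Γ : Type} [Group Γ] (x : Γ) : L2G Γ := lp.single 2 x (1 : ℂ)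

theorem qcE_self {Γ : Type} [Group Γ] (x : Γ) : qcE x x = 1 := by
  classical
  simp [qcE, lp.single_apply]

theorem qcE_ne {Γ : Type} [Group Γ] {x y : Γ} (h : y ≠ x) : qcE x y = 0 := by
  classical
  simp [qcE, lp.single_apply, h]

theorem norm_qcE {Γ : Type} [Group Γ] (x : Γ) : ‖qcE x‖ = 1 := by
  classical
  unfold qcE
  rw [lp.norm_single (by norm_num)]
  simp

theorem inner_qcE {Γ : Type} [Group Γ] (x : Γ) (f : L2G Γ) : inner ℂ (qcE x) f = f x := by
  classical
  unfold qcE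
  rw [lp.inner_single_left]
  simp

theorem ext_qcE {Γ : Type} [Group Γ] {S T : L2G Γ →L[ℂ] L2G Γ}
    (h : ∀ a b, S (qcE b) a = T (qcE b) a) : S = T := by
  classical
  apply lp.ext_continuousLinearMap (by norm_num)
  intro b
  ext a
  simpa [lp.singleContinuousLinearMap_apply, qcE] using h a b

theorem norm_le_one_of_apply {Γ : Type} [Group Γ] (T : L2G Γ →L[ℂ] L2G Γ) (σ : Equiv.Perm Γ)
    (h : ∀ f x, ‖T f x‖ ≤ ‖f (σ x)‖) : ‖T‖ ≤ 1 := by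
  refine ContinuousLinearMap.opNorm_le_bound _ zero_le_one fun f => ?_
  rw [one_mul]
  have h2 : (0 : ℝ) < (2 : ℝ≥0∞).toReal := by norm_num
  have hf := lp.hasSum_norm h2 f
  have hf' := (σ.hasSum_iff.mpr hf)
  have := hasSum_le (fun x => ?_) (lp.hasSum_norm h2 (T f)) hf'
  · exact (Real.rpow_le_rpow_iff (norm_nonneg _) (norm_nonneg _) h2).1 this
  · exact Real.rpow_le_rpow (norm_nonneg _) (h f x) h2.le

theorem ν_mul_le {H : Type} [NormedAddCommGroup H] [InnerProductSpace ℂ H] [CompleteSpace H]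
    (J : NormedIdeal H) (A X B : H →L[ℂ] H) (hA : ‖A‖ ≤ 1) (hB : ‖B‖ ≤ 1) :
    J.ν (A * X * B) ≤ J.ν X := by
  refine (J.ν_mul A X B).trans ?_
  have h1 : (‖A‖₊ : ℝ≥0∞) ≤ 1 := by exact_mod_cast hA
  have h2 : (‖B‖₊ : ℝ≥0∞) ≤ 1 := by exact_mod_cast hB
  calc _ ≤ 1 * J.ν X * 1 := by gcongr
    _ = _ := by simp

theorem ν_mul_left_le {H : Type} [NormedAddCommGroup H] [InnerProductSpace ℂ H] [CompleteSpace H]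
    (J : NormedIdeal H) (A X : H →L[ℂ] H) (hA : ‖A‖ ≤ 1) : J.ν (A * X) ≤ J.ν X := by
  simpa using ν_mul_le J A X 1 hA (ContinuousLinearMap.norm_id_le)

theorem ν_mul_right_le {H : Type} [NormedAddCommGroup H] [InnerProductSpace ℂ H] [CompleteSpace H]
    (J : NormedIdeal H) (X B : H →L[ℂ] H) (hB : ‖B‖ ≤ 1) : J.ν (X * B) ≤ J.ν X := by
  simpa using ν_mul_le J 1 X B (ContinuousLinearMap.norm_id_le) hB

theorem ν_neg {H : Type} [NormedAddCommGroup H] [InnerProductSpace ℂ H] [CompleteSpace H]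
    (J : NormedIdeal H) (X : H →L[ℂ] H) : J.ν (-X) = J.ν X := by
  simpa using J.ν_smul (-1) X

theorem ν_sub {H : Type} [NormedAddCommGroup H] [InnerProductSpace ℂ H] [CompleteSpace H]
    (J : NormedIdeal H) (X Y : H →L[ℂ] H) : J.ν (X - Y) ≤ J.ν X + J.ν Y := by
  rw [sub_eq_add_neg, ← ν_neg J Y]
  exact J.ν_add _ _

/-- If one nonzero operator has finite norm, so do all rank one operators. -/
theorem ν_rankOne_ne_top {H : Type} [NormedAddCommGroup H] [InnerProductSpace ℂ H]
    [CompleteSpace H] (J : NormedIdeal H) {X : H →L[ℂ] H} (hX : X ≠ 0) (hν : J.ν X ≠ ⊤)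
    (x y : H) : J.ν (InnerProductSpace.rankOne ℂ x y) ≠ ⊤ := by
  obtain ⟨f, hf⟩ : ∃ f, X f ≠ 0 := by
    by_contra! h
    exact hX (ContinuousLinearMap.ext h)
  have hin : inner ℂ (X f) (X f) ≠ 0 := by simpa using hf
  have key : InnerProductSpace.rankOne ℂ x y =
      InnerProductSpace.rankOne ℂ ((inner ℂ (X f) (X f))⁻¹ • x) (X f) * X *
        InnerProductSpace.rankOne ℂ f y := by
    ext z
    change inner ℂ y z • x = inner ℂ (X f) (X (inner ℂ y z • f)) • ((inner ℂ (X f) (X f))⁻¹ • x)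
    rw [map_smul, inner_smul_right, smul_smul, mul_assoc, mul_inv_cancel₀ hin, mul_one]
  rw [key]
  refine ne_top_of_le_ne_top ?_ (J.ν_mul _ _ _)
  exact ENNReal.mul_ne_top (ENNReal.mul_ne_top ENNReal.coe_ne_top hν) ENNReal.coe_ne_top

theorem ν_sum_ne_top {H : Type} [NormedAddCommGroup H] [InnerProductSpace ℂ H]
    [CompleteSpace H] (J : NormedIdeal H) {ι : Type*} (s : Finset ι) (X : ι → H →L[ℂ] H)
    (h : ∀ i, J.ν (X i) ≠ ⊤) : J.ν (∑ i ∈ s, X i) ≠ ⊤ := by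
  classical
  induction s using Finset.induction_on with
  | empty => simp [J.ν_zero]
  | insert a s ha ih =>
    rw [Finset.sum_insert ha]
    exact ne_top_of_le_ne_top (ENNReal.add_ne_top.2 ⟨h a, ih⟩) (J.ν_add _ _)

/-- Pinching an operator to its diagonal does not increase the norm. -/
theorem pinch {Γ : Type} [Group Γ] (J : NormedIdeal (L2G Γ))
    (M : (Γ → ℂ) → (L2G Γ →L[ℂ] L2G Γ))
    (hM : ∀ u : Γ → ℂ, (Function.support u).Finite →
      ∀ (f : L2G Γ) (x : Γ), (M u f) x = u x * f x)
    (X : L2G Γ →L[ℂ] L2G Γ) (K : Finset Γ) (v : Γ → ℂ) (hv : (Function.support v).Finite)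
    (hX : ∀ a b, a ≠ b → a ∉ K → b ∉ K → X (qcE b) a = 0)
    (hd : ∀ b, X (qcE b) b = v b) : J.ν (M v) ≤ J.ν X := by
  classical
  have key : ∀ S : Finset Γ, ∃ Y : L2G Γ →L[ℂ] L2G Γ, J.ν Y ≤ J.ν X ∧
      ∀ a b, Y (qcE b) a = if a ≠ b ∧ (a ∈ S ∨ b ∈ S) then 0 else X (qcE b) a := by
    intro S
    induction S using Finset.induction_on with
    | empty => exact ⟨X, le_rfl, by simp⟩
    | insert z S hz ih =>
      obtain ⟨Y, hY, hYe⟩ := ih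
      have hfin : (Function.support (Pi.single z (2 : ℂ) : Γ → ℂ)).Finite :=
        (Set.finite_singleton z).subset (by
          intro w hw
          by_contra h
          exact hw (Pi.single_eq_of_ne (by simpa using h) _))
      set U : L2G Γ →L[ℂ] L2G Γ := 1 - M (Pi.single z 2) with hU
      let s : Γ → ℂ := fun x => if x = z then -1 else 1
      have hUa : ∀ f x, U f x = s x * f x := by
        intro f x
        have : U f x = f x - M (Pi.single z 2) f x := rfl
        rw [this, hM _ hfin]
        by_cases hx : x = z
        · subst hx; simp [s]; ring
        · simp [s, hx]
      have hUe : ∀ b, U (qcE b) = s b • qcE b := by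
        intro b
        ext a
        rw [hUa]
        change _ = s b * qcE b a
        by_cases hab : a = b
        · rw [hab]
        · rw [qcE_ne hab]; simp
      have hUn : ‖U‖ ≤ 1 := by
        apply norm_le_one_of_apply U (Equiv.refl _)
        intro f x
        rw [hUa]
        by_cases hx : x = z <;> simp [s, hx]
      refine ⟨(2⁻¹ : ℂ) • (Y + U * Y * U), ?_, ?_⟩
      · rw [J.ν_smul]
        have h1 : J.ν (Y + U * Y * U) ≤ J.ν X + J.ν X :=
          (J.ν_add _ _).trans (add_le_add hY ((ν_mul_le J U Y U hUn hUn).trans hY))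
        have h2 : ((‖(2⁻¹ : ℂ)‖₊ : NNReal) : ℝ≥0∞) = 2⁻¹ := by
          simp
        rw [h2]
        calc _ ≤ 2⁻¹ * (J.ν X + J.ν X) := by gcongr
          _ = J.ν X := by
            rw [← two_mul, ← mul_assoc, ENNReal.inv_mul_cancel (by norm_num) (by norm_num), one_mul]
      · intro a b
        have : ((2⁻¹ : ℂ) • (Y + U * Y * U)) (qcE b) a =
            2⁻¹ * (Y (qcE b) a + U (Y (U (qcE b))) a) := rfl
        rw [this, hUa, hUe, map_smul]
        have : (s b • Y (qcE b)) a = s b * Y (qcE b) a := rfl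
        rw [this, hYe]
        by_cases hab : a = b
        · subst hab
          by_cases haz : a = z <;> simp [s, haz] <;> ring
        · by_cases haz : a = z
          · have hbz : b ≠ z := fun h => hab (haz.trans h.symm)
            simp [s, haz, hbz, hbz.symm]
            split_ifs <;> simp
          · by_cases hbz : b = z
            · simp [s, haz, hbz]
              split_ifs <;> simp
            · by_cases hh : a ∈ S ∨ b ∈ S
              · simp [s, haz, hbz, hab, hh]
              · simp [s, haz, hbz, hab, hh]; ring
  obtain ⟨Y, hY, hYe⟩ := key K
  have : M v = Y := by
    apply ext_qcE
    intro a b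
    rw [hM v hv, hYe]
    by_cases hab : a = b
    · subst hab; simp [qcE_self, hd]
    · rw [qcE_ne hab]
      split_ifs with h
      · simp
      · have := hX a b hab (fun h' => h ⟨hab, Or.inl h'⟩) (fun h' => h ⟨hab, Or.inr h'⟩)
        rw [this]; simp
  rw [this]
  exact hY

theorem support_indC {Γ : Type} [Group Γ] (F : Finset Γ) :
    (Function.support (indC Γ F)).Finite := by
  refine F.finite_toSet.subset ?_
  unfold indC
  exact Set.support_indicator_subset

theorem indC_apply {Γ : Type} [Group Γ] (F : Finset Γ) (x : Γ) [Decidable (x ∈ F)] :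
    indC Γ F x = if x ∈ F then 1 else 0 := by
  simp [indC, Set.indicator_apply]

theorem M_indC {Γ : Type} [Group Γ]
    (M : (Γ → ℂ) → (L2G Γ →L[ℂ] L2G Γ))
    (hM : ∀ u : Γ → ℂ, (Function.support u).Finite →
      ∀ (f : L2G Γ) (x : Γ), (M u f) x = u x * f x) (F : Finset Γ) (f : L2G Γ) (x : Γ)
      [Decidable (x ∈ F)] :
    M (indC Γ F) f x = if x ∈ F then f x else 0 := by
  rw [hM _ (support_indC F), indC_apply]
  by_cases h : x ∈ F <;> simp [h]

/-- Finite coordinate truncations approximate a finite rank projection in norm. -/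
theorem trunc_tendsto {Γ : Type} [Group Γ]
    (M : (Γ → ℂ) → (L2G Γ →L[ℂ] L2G Γ))
    (hM : ∀ u : Γ → ℂ, (Function.support u).Finite →
      ∀ (f : L2G Γ) (x : Γ), (M u f) x = u x * f x)
    (P : L2G Γ →L[ℂ] L2G Γ) {ι : Type*} (s : Finset ι) (x y : ι → L2G Γ)
    (hP : P = ∑ i ∈ s, InnerProductSpace.rankOne ℂ (x i) (y i)) :
    Tendsto (fun F : Finset Γ => ‖(M (indC Γ F) - 1) * P‖) atTop (nhds 0) := by
  classical
  have hb : ∀ F : Finset Γ, ‖(M (indC Γ F) - 1) * P‖ ≤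
      ∑ i ∈ s, ‖M (indC Γ F) (x i) - x i‖ * ‖y i‖ := by
    intro F
    rw [hP, Finset.mul_sum]
    refine (norm_sum_le _ _).trans (Finset.sum_le_sum fun i _ => ?_)
    rw [ContinuousLinearMap.mul_def, InnerProductSpace.comp_rankOne,
      InnerProductSpace.norm_rankOne]
    exact le_rfl
  refine squeeze_zero (fun _ => norm_nonneg _) hb ?_
  rw [← Finset.sum_const_zero (s := s)]
  refine tendsto_finsetSum _ fun i _ => ?_
  have h1 : ∀ F : Finset Γ, M (indC Γ F) (x i) = ∑ j ∈ F, lp.single 2 j (x i j) := by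
    intro F
    ext a
    rw [M_indC M hM, lp.coeFn_sum, Finset.sum_apply]
    simp only [lp.coeFn_single, Finset.sum_pi_single]
  have h2 := lp.hasSum_single (by norm_num) (x i)
  have h3 : Tendsto (fun F : Finset Γ => ‖M (indC Γ F) (x i) - x i‖) atTop (nhds 0) := by
    simp_rw [h1]
    exact tendsto_iff_norm_sub_tendsto_zero.1 h2
  simpa using h3.mul_const ‖y i‖

theorem isPositive_of_diag {Γ : Type} [Group Γ] (T : L2G Γ →L[ℂ] L2G Γ) (w : Γ → ℝ)
    (hw : ∀ x, 0 ≤ w x) (hT : ∀ f x, T f x = (w x : ℂ) * f x) : T.IsPositive := by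
  refine ⟨fun f h => ?_, fun f => ?_⟩
  · change inner ℂ (T f) h = inner ℂ f (T h)
    rw [lp.inner_eq_tsum, lp.inner_eq_tsum]
    refine tsum_congr fun x => ?_
    rw [hT, hT]
    simp
    ring
  · rw [ContinuousLinearMap.reApplyInnerSelf]
    have h1 := lp.hasSum_inner (𝕜 := ℂ) (T f) f
    have h2 := h1.mapL Complex.reCLM
    refine h2.nonneg fun x => ?_
    rw [hT]
    have : inner ℂ ((w x : ℂ) * f x) (f x) = ((w x * ‖f x‖ ^ 2 : ℝ) : ℂ) := by
      rw [← smul_eq_mul, inner_smul_left, inner_self_eq_norm_sq_to_K]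
      simp
    rw [this]
    simp only [Complex.reCLM_apply, Complex.ofReal_re]
    have := hw x
    positivity

theorem finRank_proj {H : Type} [NormedAddCommGroup H] [InnerProductSpace ℂ H] [CompleteSpace H]
    (A : H →L[ℂ] H) (hA : FinRank A) : ∃ (P : H →L[ℂ] H) (m : ℕ) (b : Fin m → H),
      P = ∑ i, InnerProductSpace.rankOne ℂ (b i) (b i) ∧ P * P = P ∧ IsSelfAdjoint P ∧
      P * A = A := by
  unfold FinRank at hA
  set K := LinearMap.range A.toLinearMap
  let b := stdOrthonormalBasis ℂ K
  refine ⟨K.starProjection, _, fun i => (b i : H), b.starProjection_eq_sum_rankOne, ?_, ?_, ?_⟩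
  · exact isStarProjection_starProjection.isIdempotentElem
  · exact isStarProjection_starProjection.isSelfAdjoint
  · ext x
    exact Submodule.starProjection_eq_self_iff.2 ⟨x, rfl⟩

theorem trunc_tendsto_ν {Γ : Type} [Group Γ] (J : NormedIdeal (L2G Γ))
    (M : (Γ → ℂ) → (L2G Γ →L[ℂ] L2G Γ))
    (hM : ∀ u : Γ → ℂ, (Function.support u).Finite →
      ∀ (f : L2G Γ) (x : Γ), (M u f) x = u x * f x)
    (A : L2G Γ →L[ℂ] L2G Γ) (hA : FinRank A) (hsa : IsSelfAdjoint A)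
    (hJ : ∀ x y, J.ν (InnerProductSpace.rankOne ℂ x y) ≠ ⊤) :
    Tendsto (fun F : Finset Γ => J.ν (M (indC Γ F) * A * M (indC Γ F) - A)) atTop (nhds 0) := by
  classical
  obtain ⟨P, m, b, hP, hPP, hPsa, hPA⟩ := finRank_proj A hA
  have hAP : A * P = A := by
    have := congrArg star hPA
    rwa [star_mul, hPsa.star_eq, hsa.star_eq] at this
  have hνP : J.ν P ≠ ⊤ := by
    rw [hP]
    exact ν_sum_ne_top J _ _ fun i => hJ _ _
  have ht := trunc_tendsto M hM P _ b b hP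
  have hFsa : ∀ F : Finset Γ, IsSelfAdjoint (M (indC Γ F)) := by
    intro F
    refine (isPositive_of_diag _ (fun x => if x ∈ F then 1 else 0) ?_ ?_).isSelfAdjoint
    · intro x; split_ifs <;> simp
    · intro f x
      rw [M_indC M hM]
      split_ifs <;> simp
  have hFn : ∀ F : Finset Γ, ‖M (indC Γ F)‖ ≤ 1 := by
    intro F
    refine norm_le_one_of_apply _ (Equiv.refl _) fun f x => ?_
    rw [M_indC M hM]
    split_ifs <;> simp
  have ht2 : Tendsto (fun F : Finset Γ => (‖A‖₊ : ℝ≥0∞) * J.ν P *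
      ENNReal.ofReal ‖(M (indC Γ F) - 1) * P‖ +
      ENNReal.ofReal ‖(M (indC Γ F) - 1) * P‖ * J.ν P * (‖A‖₊ : ℝ≥0∞)) atTop (nhds 0) := by
    have h0 : Tendsto (fun F : Finset Γ => ENNReal.ofReal ‖(M (indC Γ F) - 1) * P‖) atTop
        (nhds 0) := by
      simpa using ENNReal.tendsto_ofReal ht
    have hc : (‖A‖₊ : ℝ≥0∞) * J.ν P ≠ ⊤ := ENNReal.mul_ne_top ENNReal.coe_ne_top hνP
    have hc' : J.ν P * (‖A‖₊ : ℝ≥0∞) ≠ ⊤ := ENNReal.mul_ne_top hνP ENNReal.coe_ne_top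
    have h1 := ENNReal.Tendsto.const_mul h0 (Or.inr hc)
    have h2 := ENNReal.Tendsto.mul_const h0 (Or.inr hc')
    simpa [mul_assoc] using h1.add h2
  refine tendsto_of_tendsto_of_tendsto_of_le_of_le tendsto_const_nhds ht2 (fun _ => zero_le) ?_
  intro F
  set T := M (indC Γ F)
  have e : T * A * T - A = (T * A) * P * (P * (T - 1)) + ((T - 1) * P) * P * A := by
    have e1 : (T * A) * P * (P * (T - 1)) = T * A * (T - 1) := by
      calc _ = T * (A * (P * P)) * (T - 1) := by noncomm_ring
        _ = _ := by rw [hPP, hAP]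
    have e2 : ((T - 1) * P) * P * A = (T - 1) * A := by
      calc _ = (T - 1) * (P * P * A) := by noncomm_ring
        _ = _ := by rw [hPP, hPA]
    rw [e1, e2]
    noncomm_ring
  have hn : ‖P * (T - 1)‖ = ‖(T - 1) * P‖ := by
    rw [← norm_star, star_mul, star_sub, star_one, hPsa.star_eq, (hFsa F).star_eq]
  have hTA : ‖T * A‖ ≤ ‖A‖ := by
    calc _ ≤ ‖T‖ * ‖A‖ := norm_mul_le _ _
      _ ≤ 1 * ‖A‖ := by gcongr; exact hFn F
      _ = _ := one_mul _
  have hTA' : (‖T * A‖₊ : ℝ≥0∞) ≤ ‖A‖₊ := by exact_mod_cast hTA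
  have h1 : (‖P * (T - 1)‖₊ : ℝ≥0∞) = ENNReal.ofReal ‖(T - 1) * P‖ := by
    rw [← hn, ofReal_norm]; rfl
  have h2 : (‖(T - 1) * P‖₊ : ℝ≥0∞) = ENNReal.ofReal ‖(T - 1) * P‖ := by
    rw [ofReal_norm]; rfl
  change J.ν (T * A * T - A) ≤ _
  rw [e]
  refine (J.ν_add _ _).trans (add_le_add ?_ ?_)
  · refine (J.ν_mul _ _ _).trans ?_
    rw [h1]
    gcongr
  · refine (J.ν_mul _ _ _).trans ?_
    rw [h2]

theorem diag_small {Γ : Type} [Group Γ]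
    (M : (Γ → ℂ) → (L2G Γ →L[ℂ] L2G Γ))
    (hM : ∀ u : Γ → ℂ, (Function.support u).Finite →
      ∀ (f : L2G Γ) (x : Γ), (M u f) x = u x * f x)
    (A : L2G Γ →L[ℂ] L2G Γ) (hA : FinRank A) (ε : ℝ) (hε : 0 < ε) :
    ∃ F : Finset Γ, ∀ x ∉ F, ‖A (qcE x) x‖ < ε := by
  classical
  obtain ⟨P, m, b, hP, hPP, hPsa, hPA⟩ := finRank_proj A hA
  have ht := (trunc_tendsto M hM P _ b b hP).mul_const ‖A‖
  rw [zero_mul] at ht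
  obtain ⟨F, hF⟩ := (ht.eventually (gt_mem_nhds hε)).exists
  refine ⟨F, fun x hx => ?_⟩
  refine lt_of_le_of_lt ?_ hF
  have e : ((M (indC Γ F) - 1) * P * A) (qcE x) x = - A (qcE x) x := by
    rw [mul_assoc, hPA]
    change M (indC Γ F) (A (qcE x)) x - A (qcE x) x = _
    rw [M_indC M hM, if_neg hx, zero_sub]
  rw [← norm_neg, ← e]
  refine (lp.norm_apply_le_norm (by norm_num) _ x).trans ?_
  refine (ContinuousLinearMap.le_opNorm _ _).trans ?_
  rw [norm_qcE, mul_one]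
  exact norm_mul_le _ _

theorem finRank_M {Γ : Type} [Group Γ]
    (M : (Γ → ℂ) → (L2G Γ →L[ℂ] L2G Γ))
    (hM : ∀ u : Γ → ℂ, (Function.support u).Finite →
      ∀ (f : L2G Γ) (x : Γ), (M u f) x = u x * f x)
    (u : Γ → ℂ) (hu : (Function.support u).Finite) : FinRank (M u) := by
  classical
  unfold FinRank
  have : Finite ((qcE : Γ → L2G Γ) '' Function.support u) := hu.image _
  have hfd : FiniteDimensional ℂ (Submodule.span ℂ ((qcE : Γ → L2G Γ) '' Function.support u)) :=
    FiniteDimensional.span_of_finite ℂ (hu.image _)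
  refine Submodule.finiteDimensional_of_le (S₂ := Submodule.span ℂ
    ((qcE : Γ → L2G Γ) '' Function.support u)) ?_
  rintro _ ⟨f, rfl⟩
  have : M u f = ∑ j ∈ hu.toFinset, (u j * f j) • qcE j := by
    ext a
    rw [hM u hu, lp.coeFn_sum, Finset.sum_apply]
    have : ∀ j, ((u j * f j) • qcE j : L2G Γ) a = if a = j then u j * f j else 0 := by
      intro j
      change (u j * f j) * qcE j a = _
      split_ifs with h
      · rw [h, qcE_self, mul_one]
      · rw [qcE_ne h, mul_zero]
    simp only [this, Finset.sum_ite_eq]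
    split_ifs with h
    · rfl
    · have : u a = 0 := by simpa using h
      rw [this, zero_mul]
  change M u f ∈ _
  rw [this]
  refine Submodule.sum_mem _ fun j hj => Submodule.smul_mem _ _ (Submodule.subset_span ⟨j, ?_, rfl⟩)
  simpa using hj

theorem lam_qcE {Γ : Type} [Group Γ] (lam : Γ → (L2G Γ →L[ℂ] L2G Γ))
    (hlam : ∀ (a : Γ) (f : L2G Γ) (x : Γ), (lam a f) x = f (a⁻¹ * x)) (a b : Γ) :
    lam a (qcE b) = qcE (a * b) := by
  ext x
  rw [hlam]
  by_cases h : x = a * b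
  · subst h
    rw [inv_mul_cancel_left, qcE_self, qcE_self]
  · rw [qcE_ne h, qcE_ne]
    intro h'
    exact h (by rw [← h', mul_inv_cancel_left])

theorem norm_lam {Γ : Type} [Group Γ] (lam : Γ → (L2G Γ →L[ℂ] L2G Γ))
    (hlam : ∀ (a : Γ) (f : L2G Γ) (x : Γ), (lam a f) x = f (a⁻¹ * x)) (a : Γ) :
    ‖lam a‖ ≤ 1 := by
  refine norm_le_one_of_apply _ (Equiv.mulLeft a⁻¹) fun f x => ?_
  rw [hlam]
  rfl

theorem support_diff {Γ : Type} [Group Γ] (u : Γ → ℝ) (hu : (Function.support u).Finite) (a : Γ) :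
    (Function.support fun x => ((u (a * x) - u x : ℝ) : ℂ)).Finite := by
  refine ((hu.preimage (f := fun x => a * x) (mul_right_injective a).injOn).union hu).subset ?_
  intro x hx
  by_contra h
  simp only [Set.mem_union, Set.mem_preimage, Function.mem_support, not_or, not_not] at h
  exact hx (by simp [h.1, h.2])

/-- On the Cayley graph of a finitely generated group, the classical nonlinear condenser
capacity of a pair of disjoint finite sets equals the noncommutative condenser
quasicentral modulus of the corresponding pair of projections for the left regular
representation of the generators:
`cap_J(X₁, X₂) = k_J(λ(γ); P_{ℓ²(X₁)}, P_{ℓ²(X₂)})`. -/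
theorem cap_eq_qcModCond {n : ℕ} (g : Fin n → G)
    (hgen : Subgroup.closure (Set.range g) = ⊤)
    (J : NormedIdeal (L2G G))
    (lam : G → (L2G G →L[ℂ] L2G G))
    (hlam : ∀ (a : G) (f : L2G G) (x : G), (lam a f) x = f (a⁻¹ * x))
    (M : (G → ℂ) → (L2G G →L[ℂ] L2G G))
    (hM : ∀ u : G → ℂ, (Function.support u).Finite →
      ∀ (f : L2G G) (x : G), (M u f) x = u x * f x)
    (X₁ X₂ : Finset G) (hdisj : Disjoint X₁ X₂) :
    sInf {c : ℝ≥0∞ | ∃ u : G → ℝ, (Function.support u).Finite ∧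
        (∀ x, 0 ≤ u x ∧ u x ≤ 1) ∧ (∀ x ∈ X₁, u x = 1) ∧ (∀ x ∈ X₂, u x = 0) ∧
        c = ⨆ j, J.ν (M fun x => ((u (g j * x) - u x : ℝ) : ℂ))} =
      qcModCond J (fun j => lam (g j)) (M (indC G X₁)) (M (indC G X₂)) := by
  classical
  have hMind : ∀ (X : Finset G) (b : G), M (indC G X) (qcE b) = if b ∈ X then qcE b else 0 := by
    intro X b
    ext a
    rw [M_indC M hM]
    by_cases hab : a = b
    · subst hab; split_ifs <;> rfl
    · rw [qcE_ne hab]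
      split_ifs <;> first | rfl | exact (qcE_ne hab).symm
  unfold qcModCond
  apply le_antisymm
  · refine le_sInf ?_
    rintro c ⟨A, hfr, hA0, hA1, hAP, hAQ, rfl⟩
    rw [ContinuousLinearMap.nonneg_iff_isPositive] at hA0
    rw [ContinuousLinearMap.le_def] at hA1
    have hsa := hA0.isSelfAdjoint
    set d : G → ℝ := fun x => (A (qcE x) x).re with hd
    have hdre : ∀ x, A (qcE x) x = (d x : ℂ) := by
      intro x
      have h := hA0.inner_nonneg_right (qcE x)
      rw [inner_qcE] at h
      rw [Complex.nonneg_iff] at h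
      apply Complex.ext
      · simp [hd]
      · simp [← h.2]
    have hd0 : ∀ x, 0 ≤ d x := by
      intro x
      have h := hA0.inner_nonneg_right (qcE x)
      rw [inner_qcE, Complex.nonneg_iff] at h
      exact h.1
    have hd1 : ∀ x, d x ≤ 1 := by
      intro x
      have h := hA1.inner_nonneg_right (qcE x)
      rw [inner_qcE, Complex.nonneg_iff] at h
      have e : ((1 - A) (qcE x)) x = qcE x x - A (qcE x) x := rfl
      rw [e, qcE_self, hdre] at h
      have := h.1
      simp at this
      exact this
    have hdX1 : ∀ x ∈ X₁, d x = 1 := by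
      intro x hx
      have h := DFunLike.congr_fun hAP (qcE x)
      change A (M (indC G X₁) (qcE x)) = M (indC G X₁) (qcE x) at h
      rw [hMind, if_pos hx] at h
      simp [hd, h, qcE_self]
    have hdX2 : ∀ x ∈ X₂, d x = 0 := by
      intro x hx
      have h := DFunLike.congr_fun hAQ (qcE x)
      change A (M (indC G X₂) (qcE x)) = 0 at h
      rw [hMind, if_pos hx] at h
      simp [hd, h]
    by_cases hJ : ∃ X, X ≠ 0 ∧ J.ν X ≠ ⊤
    · obtain ⟨X0, hX0, hX0'⟩ := hJ
      have ht := trunc_tendsto_ν J M hM A hfr hsa (ν_rankOne_ne_top J hX0 hX0')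
      refine ENNReal.le_of_forall_pos_le_add fun ε hε _ => ?_
      have hε2 : (0 : ℝ≥0∞) < (ε / 2 : NNReal) := by
        exact_mod_cast half_pos hε
      obtain ⟨F, hF, hXF⟩ := ((ht.eventually (gt_mem_nhds hε2)).and
        (eventually_ge_atTop (X₁ ∪ X₂))).exists
      set u : G → ℝ := fun x => if x ∈ F then d x else 0 with hu
      have hus : (Function.support u).Finite := by
        refine F.finite_toSet.subset fun x hx => ?_
        by_contra h
        exact hx (if_neg fun h' => h (Finset.mem_coe.2 h'))
      refine sInf_le_of_le ⟨u, hus, ?_, ?_, ?_, rfl⟩ ?_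
      · intro x
        simp only [hu]
        split_ifs
        · exact ⟨hd0 x, hd1 x⟩
        · simp
      · intro x hx
        simp only [hu]
        rw [if_pos (hXF (Finset.mem_union_left _ hx)), hdX1 x hx]
      · intro x hx
        simp only [hu]
        rw [if_pos (hXF (Finset.mem_union_right _ hx)), hdX2 x hx]
      · refine iSup_le fun j => ?_
        set L := lam (g j) with hL
        set T := M (indC G F) with hT
        set B := T * A * T with hB
        have hBe : ∀ a b, B (qcE b) a = if a ∈ F ∧ b ∈ F then A (qcE b) a else 0 := by
          intro a b
          change T (A (T (qcE b))) a = _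
          rw [hT, M_indC M hM, hMind]
          by_cases ha : a ∈ F <;> by_cases hb : b ∈ F <;> simp [ha, hb]
        have hLn : ‖L‖ ≤ 1 := norm_lam lam hlam _
        have hXe : ∀ a b, (lam (g j)⁻¹ * (B * L - L * B)) (qcE b) a =
            B (qcE (g j * b)) (g j * a) - B (qcE b) a := by
          intro a b
          change lam (g j)⁻¹ (B (lam (g j) (qcE b)) - lam (g j) (B (qcE b))) a = _
          rw [hlam, lam_qcE lam hlam]
          change B (qcE (g j * b)) ((g j)⁻¹⁻¹ * a) - (lam (g j) (B (qcE b))) ((g j)⁻¹⁻¹ * a) = _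
          rw [hlam, inv_inv, inv_mul_cancel_left]
        calc J.ν (M fun x => ((u (g j * x) - u x : ℝ) : ℂ))
            ≤ J.ν (lam (g j)⁻¹ * (B * L - L * B)) := by
              refine pinch J M hM _ (F ∪ F.image (fun x => (g j)⁻¹ * x)) _
                (support_diff u hus (g j)) ?_ ?_
              · intro a b _ ha hb
                rw [hXe, hBe, hBe, if_neg, if_neg, sub_zero]
                · exact fun h => ha (Finset.mem_union_left _ h.1)
                · intro h
                  exact ha (Finset.mem_union_right _
                    (Finset.mem_image.2 ⟨_, h.1, inv_mul_cancel_left _ _⟩))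
              · intro b
                rw [hXe, hBe, hBe, hdre, hdre]
                simp only [hu, and_self]
                push_cast
                split_ifs <;> simp
          _ ≤ J.ν (B * L - L * B) := ν_mul_left_le J _ _ (norm_lam lam hlam _)
          _ = J.ν ((A * L - L * A) + ((B - A) * L - L * (B - A))) := by
              congr 1; noncomm_ring
          _ ≤ J.ν (A * L - L * A) + (J.ν ((B - A) * L) + J.ν (L * (B - A))) :=
              (J.ν_add _ _).trans (add_le_add le_rfl (ν_sub J _ _))
          _ ≤ commSup J (fun j => lam (g j)) A + ((ε / 2 : NNReal) + (ε / 2 : NNReal)) := by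
              refine add_le_add ?_ (add_le_add ?_ ?_)
              · exact le_iSup (fun j => J.ν (A * lam (g j) - lam (g j) * A)) j
              · exact (ν_mul_right_le J _ _ hLn).trans hF.le
              · exact (ν_mul_left_le J _ _ hLn).trans hF.le
          _ = commSup J (fun j => lam (g j)) A + ε := by
              rw [← ENNReal.coe_add, add_halves]
    · push Not at hJ
      by_cases hc : commSup J (fun j => lam (g j)) A = ⊤
      · rw [hc]; exact le_top
      have hcomm : ∀ j, A * lam (g j) = lam (g j) * A := by
        intro j
        by_contra h
        apply hc
        have h1 := hJ _ (sub_ne_zero.2 h)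
        exact top_le_iff.1 (h1 ▸ le_iSup (fun j => J.ν (A * lam (g j) - lam (g j) * A)) j)
      have hinv : ∀ j x, d (g j * x) = d x := by
        intro j x
        have h := DFunLike.congr_fun (hcomm j) (qcE x)
        change A (lam (g j) (qcE x)) = lam (g j) (A (qcE x)) at h
        rw [lam_qcE lam hlam] at h
        simp only [hd]
        rw [h, hlam, inv_mul_cancel_left]
      have hinv' : ∀ a x, d (a * x) = d x := by
        intro a
        have ha : a ∈ Subgroup.closure (Set.range g) := by rw [hgen]; trivial
        induction ha using Subgroup.closure_induction with
        | mem a ha =>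
          obtain ⟨j, rfl⟩ := ha
          exact hinv j
        | one => simp
        | mul a b _ _ iha ihb => intro x; rw [mul_assoc, iha, ihb]
        | inv a _ iha => intro x; rw [← iha, mul_inv_cancel_left]
      have hds : (Function.support d).Finite := by
        rcases finite_or_infinite G with hG | hG
        · exact Set.toFinite _
        · have : d = 0 := by
            funext x
            by_contra hx
            have hpos : 0 < d x := lt_of_le_of_ne (hd0 x) (Ne.symm hx)
            obtain ⟨F, hF⟩ := diag_small M hM A hfr (d x) hpos
            obtain ⟨y, hy⟩ := Infinite.exists_notMem_finset F
            have h1 := hF y hy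
            rw [hdre, Complex.norm_real, Real.norm_of_nonneg (hd0 y)] at h1
            have h2 := hinv' (y * x⁻¹) x
            rw [inv_mul_cancel_right] at h2
            exact absurd h1 (by rw [h2]; exact lt_irrefl _)
          rw [this]; simp
      refine sInf_le_of_le ⟨d, hds, fun x => ⟨hd0 x, hd1 x⟩, hdX1, hdX2, rfl⟩ ?_
      refine iSup_le fun j => ?_
      have : (M fun x => ((d (g j * x) - d x : ℝ) : ℂ)) = 0 := by
        apply ext_qcE
        intro a b
        rw [hM _ (support_diff d hds (g j)), hinv, sub_self]
        simp
      rw [this, J.ν_zero]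
      exact zero_le
  · refine le_sInf ?_
    rintro c ⟨u, hus, hu01, hu1, hu2, rfl⟩
    have hus' : (Function.support fun x => (u x : ℂ)).Finite := by
      refine hus.subset fun x hx => ?_
      intro h
      exact hx (by simp [h])
    set A := M (fun x => (u x : ℂ)) with hA
    have hAa : ∀ f x, A f x = (u x : ℂ) * f x := fun f x => hM _ hus' f x
    refine sInf_le_of_le ⟨A, finRank_M M hM _ hus', ?_, ?_, ?_, ?_, rfl⟩ ?_
    · rw [ContinuousLinearMap.nonneg_iff_isPositive]
      exact isPositive_of_diag A u (fun x => (hu01 x).1) hAa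
    · rw [ContinuousLinearMap.le_def]
      refine isPositive_of_diag _ (fun x => 1 - u x) (fun x => sub_nonneg.2 (hu01 x).2) ?_
      intro f x
      change f x - A f x = _
      rw [hAa]
      push_cast
      ring
    · apply ext_qcE
      intro a b
      change A (M (indC G X₁) (qcE b)) a = _
      rw [hAa, M_indC M hM]
      split_ifs with h
      · simp [hu1 a h]
      · simp
    · apply ext_qcE
      intro a b
      change A (M (indC G X₂) (qcE b)) a = 0
      rw [hAa, M_indC M hM]
      split_ifs with h
      · simp [hu2 a h]
      · simp
    · refine iSup_mono fun j => ?_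
      have : A * lam (g j) - lam (g j) * A =
          lam (g j) * M fun x => ((u (g j * x) - u x : ℝ) : ℂ) := by
        apply ext_qcE
        intro a b
        change A (lam (g j) (qcE b)) a - lam (g j) (A (qcE b)) a =
          lam (g j) ((M fun x => ((u (g j * x) - u x : ℝ) : ℂ)) (qcE b)) a
        rw [hAa, hlam, hlam, hlam, hAa, hM _ (support_diff u hus (g j)), mul_inv_cancel_left]
        push_cast
        ring
      dsimp only
      rw [this]
      exact ν_mul_left_le J _ _ (norm_lam lam hlam _)

end Groups
end

section
/- For a discrete group G with finite generating set γ, cap_J(G) = k_J(λ(γ)), where cap_J(G) = sup over finite X ⊂ G of cap_J(X, ∅) and k_J(λ(γ)) is the quasicentral modulus of the left regular representation of the generators. -/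
open Filter ContinuousLinearMap
open scoped ENNReal

variable {H : Type} [NormedAddCommGroup H] [InnerProductSpace ℂ H] [CompleteSpace H]

section Groups

variable (G : Type) [Group G]

/-- The classical nonlinear capacity `cap_J(X)` of a finite subset of the Cayley graph. -/
noncomputable def capFin {n : ℕ} (g : Fin n → G) (J : NormedIdeal (L2G G))
    (M : (G → ℂ) → (L2G G →L[ℂ] L2G G)) (X : Finset G) : ℝ≥0∞ :=
  sInf {c : ℝ≥0∞ | ∃ u : G → ℝ, (Function.support u).Finite ∧
    (∀ x, 0 ≤ u x ∧ u x ≤ 1) ∧ (∀ x ∈ X, u x = 1) ∧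
    c = ⨆ j, J.ν (M fun x => ((u (g j * x) - u x : ℝ) : ℂ))}

section HelpersA

set_option linter.unusedSectionVars false

variable {K : Type} [NormedAddCommGroup K] [InnerProductSpace ℂ K] [CompleteSpace K]

theorem nu_mul_left (J : NormedIdeal K) (A X : K →L[ℂ] K) :
    J.ν (A * X) ≤ (‖A‖₊ : ℝ≥0∞) * J.ν X := by
  have h := J.ν_mul A X 1
  rw [mul_one] at h
  refine h.trans ?_
  have h1 : (‖(1 : K →L[ℂ] K)‖₊ : ℝ≥0∞) ≤ 1 := by
    exact_mod_cast ContinuousLinearMap.norm_id_le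
  calc _ ≤ (‖A‖₊ : ℝ≥0∞) * J.ν X * 1 := by gcongr
    _ = _ := mul_one _

theorem nu_mul_right (J : NormedIdeal K) (X A : K →L[ℂ] K) :
    J.ν (X * A) ≤ (‖A‖₊ : ℝ≥0∞) * J.ν X := by
  have h := J.ν_mul 1 X A
  rw [one_mul] at h
  refine h.trans ?_
  have h1 : (‖(1 : K →L[ℂ] K)‖₊ : ℝ≥0∞) ≤ 1 := by
    exact_mod_cast ContinuousLinearMap.norm_id_le
  calc _ ≤ 1 * J.ν X * (‖A‖₊ : ℝ≥0∞) := by gcongr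
    _ = _ := by rw [one_mul, mul_comm]

theorem nu_mul_left_le (J : NormedIdeal K) (A X : K →L[ℂ] K) (h : ‖A‖ ≤ 1) :
    J.ν (A * X) ≤ J.ν X := by
  refine (nu_mul_left J A X).trans ?_
  have h1 : (‖A‖₊ : ℝ≥0∞) ≤ 1 := by exact_mod_cast h
  calc _ ≤ 1 * J.ν X := by gcongr
    _ = _ := one_mul _

theorem nu_mul_right_le (J : NormedIdeal K) (X A : K →L[ℂ] K) (h : ‖A‖ ≤ 1) :
    J.ν (X * A) ≤ J.ν X := by
  refine (nu_mul_right J X A).trans ?_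
  have h1 : (‖A‖₊ : ℝ≥0∞) ≤ 1 := by exact_mod_cast h
  calc _ ≤ 1 * J.ν X := by gcongr
    _ = _ := one_mul _

theorem nu_neg (J : NormedIdeal K) (X : K →L[ℂ] K) : J.ν (-X) = J.ν X := by
  have := J.ν_smul (-1) X
  simpa using this

theorem nu_sub (J : NormedIdeal K) (X Y : K →L[ℂ] K) : J.ν (X - Y) ≤ J.ν X + J.ν Y := by
  rw [sub_eq_add_neg, ← nu_neg J Y]
  exact J.ν_add _ _

theorem nu_sum (J : NormedIdeal K) {ι : Type*} (s : Finset ι) (X : ι → K →L[ℂ] K) :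
    J.ν (∑ i ∈ s, X i) ≤ ∑ i ∈ s, J.ν (X i) := by
  classical
  induction s using Finset.induction_on with
  | empty => simp [J.ν_zero]
  | insert a s ha ih =>
    rw [Finset.sum_insert ha, Finset.sum_insert ha]
    exact (J.ν_add _ _).trans (by gcongr)

theorem nu_comm_le (J : NormedIdeal K) (A B T : K →L[ℂ] K) (hT : ‖T‖ ≤ 1) :
    J.ν (B * T - T * B) ≤ J.ν (A * T - T * A) + 2 * J.ν (A - B) := by
  have : B * T - T * B = (A * T - T * A) - ((A - B) * T - T * (A - B)) := by noncomm_ring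
  rw [this, two_mul]
  refine (nu_sub J _ _).trans ?_
  gcongr
  refine (nu_sub J _ _).trans ?_
  gcongr
  · exact nu_mul_right_le J _ _ hT
  · exact nu_mul_left_le J _ _ hT

theorem commSup_le (J : NormedIdeal K) {n : ℕ} (τ : Fin n → K →L[ℂ] K) (hτ : ∀ j, ‖τ j‖ ≤ 1)
    (A B : K →L[ℂ] K) : commSup J τ B ≤ commSup J τ A + 2 * J.ν (A - B) := by
  unfold commSup
  refine iSup_le fun j => ?_
  refine (nu_comm_le J A B (τ j) (hτ j)).trans ?_
  gcongr
  exact le_iSup (fun j => J.ν (A * τ j - τ j * A)) j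

/-- The projection onto the range of a finite rank operator. -/
theorem exists_rangeProj (A : K →L[ℂ] K) (hA : FinRank A) :
    ∃ (m : ℕ) (b : Fin m → K), (∑ i, InnerProductSpace.rankOne ℂ (b i) (b i)) * A = A := by
  unfold FinRank at hA
  let b := stdOrthonormalBasis ℂ (LinearMap.range A.toLinearMap)
  refine ⟨_, fun i => (b i : K), ?_⟩
  ext f
  have h := b.sum_repr ⟨A f, ⟨f, rfl⟩⟩
  have h2 := congrArg (Subtype.val) h
  simp only [b.repr_apply_apply] at h2
  simpa [_root_.sum_apply] using h2

theorem finRank_rankOne (x y : K) : FinRank (InnerProductSpace.rankOne ℂ x y) := by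
  unfold FinRank
  refine Submodule.finiteDimensional_of_le (S₂ := Submodule.span ℂ {x}) ?_
  rintro _ ⟨z, rfl⟩
  simp
  exact Submodule.smul_mem _ _ (Submodule.mem_span_singleton_self x)

theorem FinRank.add {A B : K →L[ℂ] K} (hA : FinRank A) (hB : FinRank B) : FinRank (A + B) := by
  unfold FinRank at *
  refine Submodule.finiteDimensional_of_le
    (S₂ := LinearMap.range A.toLinearMap ⊔ LinearMap.range B.toLinearMap) ?_
  rintro _ ⟨z, rfl⟩
  exact Submodule.add_mem_sup ⟨z, rfl⟩ ⟨z, rfl⟩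

theorem FinRank.mul_right {A : K →L[ℂ] K} (hA : FinRank A) (B : K →L[ℂ] K) : FinRank (A * B) := by
  unfold FinRank at *
  refine Submodule.finiteDimensional_of_le (S₂ := LinearMap.range A.toLinearMap) ?_
  rintro _ ⟨z, rfl⟩
  exact ⟨B z, rfl⟩

theorem FinRank.mul_left {A : K →L[ℂ] K} (hA : FinRank A) (B : K →L[ℂ] K) : FinRank (B * A) := by
  unfold FinRank at *
  have : FiniteDimensional ℂ ((LinearMap.range A.toLinearMap).map B.toLinearMap) := inferInstance
  refine Submodule.finiteDimensional_of_le
    (S₂ := (LinearMap.range A.toLinearMap).map B.toLinearMap) ?_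
  rintro _ ⟨z, rfl⟩
  exact ⟨A z, ⟨z, rfl⟩, rfl⟩

theorem FinRank.neg {A : K →L[ℂ] K} (hA : FinRank A) : FinRank (-A) := by
  have := hA.mul_left (-1)
  simpa using this

theorem FinRank.sub {A B : K →L[ℂ] K} (hA : FinRank A) (hB : FinRank B) : FinRank (A - B) := by
  rw [sub_eq_add_neg]; exact hA.add hB.neg

/-- If some nonzero operator has finite norm, all finite rank operators do. -/
theorem nu_ne_top (J : NormedIdeal K) (B : K →L[ℂ] K) (hB : B ≠ 0) (hν : J.ν B ≠ ⊤)
    (A : K →L[ℂ] K) (hA : FinRank A) : J.ν A ≠ ⊤ := by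
  obtain ⟨v, hv⟩ : ∃ v, B v ≠ 0 := by
    by_contra! h
    exact hB (by ext v; simp [h v])
  obtain ⟨m, b, hb⟩ := exists_rangeProj A hA
  rw [← hb]
  have h1 : ∀ x y : K, J.ν (InnerProductSpace.rankOne ℂ x y) ≠ ⊤ := by
    intro x y
    have : InnerProductSpace.rankOne ℂ x y =
        InnerProductSpace.rankOne ℂ ((inner ℂ (B v) (B v))⁻¹ • x) (B v) * B *
          InnerProductSpace.rankOne ℂ v y := by
      ext z
      have h0 : inner ℂ (B v) (B v) ≠ 0 := inner_self_ne_zero.2 hv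
      simp only [mul_apply_eq_comp, InnerProductSpace.rankOne_apply]
      rw [map_smul, inner_smul_right, smul_smul, mul_assoc, mul_inv_cancel₀ h0, mul_one]
    rw [this]
    refine ne_top_of_le_ne_top ?_ (J.ν_mul _ _ _)
    exact ENNReal.mul_ne_top (ENNReal.mul_ne_top ENNReal.coe_ne_top hν) ENNReal.coe_ne_top
  refine ne_top_of_le_ne_top ?_ (nu_mul_right J _ _)
  refine ENNReal.mul_ne_top ENNReal.coe_ne_top ?_
  refine ne_top_of_le_ne_top ?_ (nu_sum J _ _)
  exact ENNReal.sum_ne_top.2 fun i _ => h1 _ _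

theorem exists_small (C : ℝ≥0∞) (hC : C ≠ ⊤) (ε : NNReal) (hε : 0 < ε) :
    ∃ δ : ℝ, 0 < δ ∧ ∀ t : NNReal, (t : ℝ) ≤ δ → 4 * ((t : ℝ≥0∞) * C) ≤ ε := by
  lift C to NNReal using hC
  refine ⟨ε / (4 * (C + 1)), by positivity, fun t ht => ?_⟩
  rw [le_div_iff₀ (by positivity)] at ht
  have : 4 * (t * C) ≤ ε := by
    rw [← NNReal.coe_le_coe]
    push_cast
    nlinarith [t.2, C.2]
  exact_mod_cast this

end HelpersA

section HelpersB

variable {G}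

/-- Basis vectors. -/
noncomputable def bv (x : G) : L2G G := by classical exact lp.single 2 x (1 : ℂ)

open Classical in
theorem bv_apply (x y : G) : (bv x) y = if y = x then 1 else 0 := by
  unfold bv
  rw [lp.single_apply, Pi.single_apply]

theorem inner_bv (x : G) (f : L2G G) : inner ℂ (bv x) f = f x := by
  classical
  have := lp.inner_single_left (𝕜 := ℂ) x (1 : ℂ) f
  unfold bv
  convert this using 1
  simp

theorem norm_bv (x : G) : ‖bv x‖ = 1 := by
  classical
  have := lp.norm_single (E := fun _ : G => ℂ) (p := 2) (by norm_num) x (1 : ℂ)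
  unfold bv
  convert this using 1
  simp

theorem op_ext {S T : L2G G →L[ℂ] L2G G} (h : ∀ x y, (S (bv y)) x = (T (bv y)) x) : S = T := by
  classical
  refine ContinuousLinearMap.ext fun f => ?_
  have hf := lp.hasSum_single (E := fun _ : G => ℂ) (p := 2) (by norm_num) f
  have key : ∀ x, S (lp.single 2 x (f x)) = T (lp.single 2 x (f x)) := by
    intro x
    have h1 : lp.single (E := fun _ : G => ℂ) 2 x (f x) = f x • bv x := by
      apply lp.ext
      funext y
      simp [bv_apply, lp.single_apply, Pi.single_apply]
    rw [h1, map_smul, map_smul]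
    congr 1
    apply lp.ext
    funext z
    exact h z x
  have h1 := hf.mapL S
  have h2 := hf.mapL T
  simp only [key] at h1
  exact h1.unique h2

/-- `T` is the multiplication operator by `c`. -/
def IsDiag (T : L2G G →L[ℂ] L2G G) (c : G → ℂ) : Prop := ∀ (f : L2G G) x, (T f) x = c x * f x

theorem IsDiag.ext {S T : L2G G →L[ℂ] L2G G} {c : G → ℂ} (hS : IsDiag S c) (hT : IsDiag T c) :
    S = T := by
  refine ContinuousLinearMap.ext fun f => lp.ext (funext fun x => ?_)
  rw [hS, hT]

theorem IsDiag.mul {S T : L2G G →L[ℂ] L2G G} {c d : G → ℂ} (hS : IsDiag S c) (hT : IsDiag T d) :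
    IsDiag (S * T) (fun x => c x * d x) := by
  intro f x
  rw [mul_apply_eq_comp, hS, hT, mul_assoc]

theorem IsDiag.one : IsDiag (1 : L2G G →L[ℂ] L2G G) (fun _ => 1) := by
  intro f x
  simp

theorem IsDiag.sub {S T : L2G G →L[ℂ] L2G G} {c d : G → ℂ} (hS : IsDiag S c) (hT : IsDiag T d) :
    IsDiag (S - T) (fun x => c x - d x) := by
  intro f x
  have h : ((S - T) f) x = (S f) x - (T f) x := rfl
  rw [h, hS, hT, sub_mul]

theorem contr_norm_le {T : L2G G →L[ℂ] L2G G} (h : ∀ f x, ‖(T f) x‖ ≤ ‖f x‖) : ‖T‖ ≤ 1 := by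
  refine ContinuousLinearMap.opNorm_le_bound _ zero_le_one fun f => ?_
  rw [one_mul]
  exact lp.norm_mono (by norm_num) (h f)

theorem IsDiag.norm_le {T : L2G G →L[ℂ] L2G G} {c : G → ℂ} (hT : IsDiag T c)
    (h : ∀ x, ‖c x‖ ≤ 1) : ‖T‖ ≤ 1 := by
  refine contr_norm_le fun f x => ?_
  rw [hT, norm_mul]
  exact mul_le_of_le_one_left (norm_nonneg _) (h x)

theorem IsDiag.nonneg {T : L2G G →L[ℂ] L2G G} {r : G → ℝ} (hT : IsDiag T (fun x => (r x : ℂ)))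
    (h : ∀ x, 0 ≤ r x) : 0 ≤ T := by
  rw [ContinuousLinearMap.nonneg_iff_isPositive, ContinuousLinearMap.isPositive_def]
  constructor
  · intro f k
    change inner ℂ (T f) k = inner ℂ f (T k)
    rw [lp.inner_eq_tsum, lp.inner_eq_tsum]
    refine tsum_congr fun x => ?_
    rw [hT, hT]
    simp
    ring
  · intro f
    change 0 ≤ (inner ℂ (T f) f).re
    have := Complex.hasSum_re (lp.hasSum_inner (𝕜 := ℂ) (T f) f)
    refine this.nonneg fun x => ?_
    rw [hT]
    have h2 : inner ℂ ((r x : ℂ) * f x) (f x) = ((r x * ‖f x‖ ^ 2 : ℝ) : ℂ) := by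
      simp
      rw [mul_comm (f x), mul_assoc, Complex.conj_mul']
    rw [h2, Complex.ofReal_re]
    have := h x
    positivity

theorem IsDiag.finRank {T : L2G G →L[ℂ] L2G G} {c : G → ℂ} (hT : IsDiag T c)
    (h : (Function.support c).Finite) : FinRank T := by
  classical
  unfold FinRank
  have : FiniteDimensional ℂ (Submodule.span ℂ (bv '' (Function.support c))) :=
    FiniteDimensional.span_of_finite ℂ (h.image _)
  refine Submodule.finiteDimensional_of_le (S₂ := Submodule.span ℂ (bv '' (Function.support c))) ?_
  rintro _ ⟨f, rfl⟩
  have : T f = ∑ x ∈ h.toFinset, (c x * f x) • bv x := by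
    apply lp.ext
    funext y
    rw [hT]
    have : (∑ x ∈ h.toFinset, (c x * f x) • bv x : L2G G) y =
        ∑ x ∈ h.toFinset, (c x * f x) * (bv x) y := by
      rw [lp.coeFn_sum, Finset.sum_apply]
      rfl
    rw [this]
    simp only [bv_apply]
    by_cases hy : c y = 0 <;> simp [hy]
  change T f ∈ _
  rw [this]
  refine Submodule.sum_mem _ fun x hx => Submodule.smul_mem _ _ (Submodule.subset_span ⟨x, ?_, rfl⟩)
  simpa using hx

/-- Projection onto a finite set of coordinates. -/
noncomputable def Fop (Y : Finset G) : L2G G →L[ℂ] L2G G :=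
  ∑ x ∈ Y, InnerProductSpace.rankOne ℂ (bv x) (bv x)

open Classical in
theorem Fop_diag (Y : Finset G) : IsDiag (Fop Y) (fun x => ((if x ∈ Y then (1 : ℝ) else 0 : ℝ) : ℂ)) := by
  intro f y
  unfold Fop
  have : ((∑ x ∈ Y, InnerProductSpace.rankOne ℂ (bv x) (bv x)) f) =
        ∑ x ∈ Y, (f x) • bv x := by
    rw [_root_.sum_apply]
    simp [inner_bv]
  rw [this, lp.coeFn_sum, Finset.sum_apply]
  have : ∀ x, ((f x) • bv x) y = f x * (bv x) y := fun x => rfl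
  simp only [this, bv_apply]
  by_cases hy : y ∈ Y <;> simp [hy]

theorem Fop_tendsto (f : L2G G) : Tendsto (fun Y : Finset G => (1 - Fop Y) f) atTop (nhds 0) := by
  classical
  have hf := lp.hasSum_single (E := fun _ : G => ℂ) (p := 2) (by norm_num) f
  have h2 : Tendsto (fun Y : Finset G => Fop Y f) atTop (nhds f) := by
    have hf' : Tendsto (fun Y : Finset G => ∑ x ∈ Y, lp.single (E := fun _ : G => ℂ) 2 x (f x))
        atTop (nhds f) := by simpa [HasSum] using hf
    refine hf'.congr fun Y => ?_
    unfold Fop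
    rw [_root_.sum_apply]
    refine Finset.sum_congr rfl fun x _ => ?_
    rw [InnerProductSpace.rankOne_apply, inner_bv]
    apply lp.ext
    funext y
    simp [bv_apply, lp.single_apply, Pi.single_apply]
  have h3 := h2.const_sub f
  simpa using h3

theorem Fop_isSelfAdjoint (Y : Finset G) : IsSelfAdjoint (Fop Y) := by
  classical
  refine IsSelfAdjoint.of_nonneg ((Fop_diag Y).nonneg fun x => ?_)
  split_ifs <;> norm_num

theorem Fop_norm_le (Y : Finset G) : ‖Fop Y‖ ≤ 1 := by
  classical
  refine (Fop_diag Y).norm_le fun x => ?_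
  split_ifs <;> norm_num

theorem Fop_proj (Y : Finset G) : Fop Y * Fop Y = Fop Y := by
  classical
  refine IsDiag.ext (c := _) ((Fop_diag Y).mul (Fop_diag Y)) ?_
  convert Fop_diag Y using 2 with x
  split_ifs <;> simp

theorem Fop_finRank (Y : Finset G) : FinRank (Fop Y) := by
  classical
  refine (Fop_diag Y).finRank (Y.finite_toSet.subset fun x hx => ?_)
  by_contra h
  have h' : x ∉ Y := h
  simp [h'] at hx

theorem exists_Fop_small (Q : L2G G →L[ℂ] L2G G) (hQ : FinRank Q) (δ : ℝ) (hδ : 0 < δ)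
    (X : Finset G) : ∃ Y : Finset G, X ⊆ Y ∧ ‖(1 - Fop Y) * Q‖ ≤ δ := by
  obtain ⟨m, b, hb⟩ := exists_rangeProj Q hQ
  have h1 : Tendsto (fun Y : Finset G => ∑ i, ‖(1 - Fop Y) (b i)‖ * ‖b i‖ * ‖Q‖) atTop (nhds 0) := by
    have : Tendsto (fun Y : Finset G => ∑ i, ‖(1 - Fop Y) (b i)‖ * ‖b i‖ * ‖Q‖) atTop
        (nhds (∑ i : Fin m, ‖(0 : L2G G)‖ * ‖b i‖ * ‖Q‖)) := by
      refine tendsto_finsetSum _ fun i _ => ?_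
      exact ((Fop_tendsto (b i)).norm.mul_const _).mul_const _
    simpa using this
  obtain ⟨Y, hY1, hY2⟩ := ((h1.eventually (ge_mem_nhds hδ)).and (eventually_ge_atTop X)).exists
  refine ⟨Y, hY2, le_trans ?_ hY1⟩
  have : (1 - Fop Y) * Q =
      ∑ i, (InnerProductSpace.rankOne ℂ ((1 - Fop Y) (b i)) (b i)) * Q := by
    conv_lhs => rw [← hb, ← mul_assoc, Finset.mul_sum, Finset.sum_mul]
    refine Finset.sum_congr rfl fun i _ => ?_
    congr 1
    exact InnerProductSpace.comp_rankOne _ _ _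
  rw [this]
  refine (norm_sum_le _ _).trans (Finset.sum_le_sum fun i _ => ?_)
  refine (norm_mul_le _ _).trans ?_
  rw [InnerProductSpace.norm_rankOne]

end HelpersB

section HelpersC

variable {G}

theorem IsDiag.apply_bv {T : L2G G →L[ℂ] L2G G} {c : G → ℂ} (hT : IsDiag T c) (x : G) :
    T (bv x) = c x • bv x := by
  classical
  apply lp.ext
  funext y
  rw [hT]
  have : (c x • bv x : L2G G) y = c x * (bv x) y := rfl
  rw [this, bv_apply]
  split_ifs with h
  · rw [h]
  · simp

open Classical in
theorem pinch_s7 (J : NormedIdeal (L2G G)) (C : L2G G →L[ℂ] L2G G) (S : Finset G) :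
    ∃ D : L2G G →L[ℂ] L2G G, J.ν D ≤ J.ν C ∧
      ∀ x y, (D (bv y)) x = if x = y ∨ (x ∉ S ∧ y ∉ S) then (C (bv y)) x else 0 := by
  induction S using Finset.induction_on with
  | empty => exact ⟨C, le_rfl, fun x y => by simp⟩
  | insert a S ha ih =>
    obtain ⟨D, hD, hDe⟩ := ih
    let R : L2G G →L[ℂ] L2G G := 1 - (Fop {a} + Fop {a})
    have hR : IsDiag R (fun x => if x = a then -1 else 1) := by
      intro f x
      have h : (R f) x = f x - ((Fop {a} f) x + (Fop {a} f) x) := rfl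
      rw [h, Fop_diag]
      by_cases hx : x = a
      · simp [hx]
      · simp [hx]
    have hRn : ‖R‖ ≤ 1 := by
      refine hR.norm_le fun x => ?_
      split_ifs <;> simp
    refine ⟨(1 / 2 : ℂ) • (D + R * D * R), ?_, fun x y => ?_⟩
    · rw [J.ν_smul]
      have h1 : J.ν (D + R * D * R) ≤ 2 * J.ν C := by
        rw [two_mul]
        refine (J.ν_add _ _).trans (add_le_add hD ?_)
        refine (nu_mul_right_le J _ _ hRn).trans ?_
        exact (nu_mul_left_le J _ _ hRn).trans hD
      have h2 : (‖(1 / 2 : ℂ)‖₊ : ℝ≥0∞) = 2⁻¹ := by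
        have : ‖(1 / 2 : ℂ)‖₊ = 2⁻¹ := by
          simp
        rw [this]
        simp
      rw [h2]
      calc _ ≤ 2⁻¹ * (2 * J.ν C) := by gcongr
        _ = J.ν C := by
          rw [← mul_assoc, ENNReal.inv_mul_cancel (by norm_num) (by norm_num), one_mul]
    · have h1 : (((1 / 2 : ℂ) • (D + R * D * R)) (bv y)) x =
          (1 / 2 : ℂ) * ((D (bv y)) x + (R (D (R (bv y)))) x) := rfl
      rw [h1, hR.apply_bv, map_smul, hR]
      have h2 : ∀ c : ℂ, (c • D (bv y) : L2G G) x = c * (D (bv y)) x := fun c => rfl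
      rw [h2, hDe]
      by_cases hxy : x = y
      · subst hxy
        by_cases hxa : x = a <;> simp [hxa] <;> ring
      · by_cases hxa : x = a
        · have hya : y ≠ a := fun h => hxy (hxa.trans h.symm)
          have hay : ¬ a = y := fun h => hya h.symm
          by_cases hyS : y ∈ S <;> simp [hxa, hya, hay, ha, hyS]
        · by_cases hya : y = a
          · by_cases hxS : x ∈ S <;> simp [hxa, hya, hxS, ha]
          · by_cases hxS : x ∈ S <;> by_cases hyS : y ∈ S <;>
              simp [hxa, hya, hxy, hxS, hyS] <;> ring

theorem pinch_diag (J : NormedIdeal (L2G G)) (C T : L2G G →L[ℂ] L2G G) (c : G → ℂ)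
    (hT : IsDiag T c) (hc : (Function.support c).Finite)
    (h : ∀ x, c x ≠ 0 → c x = (C (bv x)) x) : J.ν T ≤ J.ν C := by
  classical
  obtain ⟨D, hD, hDe⟩ := pinch_s7 J C hc.toFinset
  have : T = Fop hc.toFinset * D * Fop hc.toFinset := by
    refine op_ext fun x y => ?_
    have h1 : ((Fop hc.toFinset * D * Fop hc.toFinset) (bv y)) x =
      (Fop hc.toFinset (D (Fop hc.toFinset (bv y)))) x := rfl
    rw [h1, (Fop_diag _).apply_bv, map_smul, Fop_diag]
    have h2 : ∀ c : ℂ, (c • D (bv y) : L2G G) x = c * (D (bv y)) x := fun c => rfl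
    rw [h2, hDe, hT, bv_apply]
    by_cases hxy : x = y
    · subst hxy
      by_cases hx : c x = 0
      · simp [hx]
      · simp [hx, ← h x hx]
    · by_cases hx : c x = 0
      · simp [hx]
      · simp [hx, hxy]
  rw [this]
  refine (nu_mul_right_le J _ _ (Fop_norm_le _)).trans ?_
  exact (nu_mul_left_le J _ _ (Fop_norm_le _)).trans hD

variable {lam : G → (L2G G →L[ℂ] L2G G)}

theorem lam_norm_le (hlam : ∀ (a : G) (f : L2G G) (x : G), (lam a f) x = f (a⁻¹ * x)) (a : G) :
    ‖lam a‖ ≤ 1 := by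
  refine ContinuousLinearMap.opNorm_le_bound _ zero_le_one fun f => ?_
  rw [one_mul, lp.norm_eq_tsum_rpow (by norm_num), lp.norm_eq_tsum_rpow (by norm_num)]
  simp only [hlam]
  rw [(Equiv.mulLeft a⁻¹).tsum_eq (fun x => ‖f x‖ ^ (2 : ℝ≥0∞).toReal) |>.symm]
  simp

theorem lam_bv (hlam : ∀ (a : G) (f : L2G G) (x : G), (lam a f) x = f (a⁻¹ * x)) (a x : G) :
    lam a (bv x) = bv (a * x) := by
  classical
  apply lp.ext
  funext y
  rw [hlam, bv_apply, bv_apply]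
  simp only [inv_mul_eq_iff_eq_mul]

theorem lam_inv (hlam : ∀ (a : G) (f : L2G G) (x : G), (lam a f) x = f (a⁻¹ * x)) (a : G) :
    lam a⁻¹ * lam a = 1 := by
  refine ContinuousLinearMap.ext fun f => lp.ext (funext fun x => ?_)
  rw [mul_apply_eq_comp, hlam, hlam]
  simp

theorem comm_diag (hlam : ∀ (a : G) (f : L2G G) (x : G), (lam a f) x = f (a⁻¹ * x))
    (J : NormedIdeal (L2G G)) (a : G) {T T' : L2G G →L[ℂ] L2G G} {c : G → ℂ} (hT : IsDiag T c)
    (hT' : IsDiag T' (fun x => c (a * x) - c x)) :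
    J.ν T' = J.ν (T * lam a - lam a * T) := by
  have h : T * lam a - lam a * T = lam a * T' := by
    refine ContinuousLinearMap.ext fun f => lp.ext (funext fun x => ?_)
    have h1 : ((T * lam a - lam a * T) f) x = (T (lam a f)) x - (lam a (T f)) x := rfl
    rw [h1, mul_apply_eq_comp, hT, hlam, hlam, hlam, hT, hT']
    simp only [mul_inv_cancel_left, sub_mul]
  rw [h]
  apply le_antisymm
  · have h2 : T' = lam a⁻¹ * (lam a * T') := by rw [← mul_assoc, lam_inv hlam, one_mul]
    conv_lhs => rw [h2]
    exact nu_mul_left_le J _ _ (lam_norm_le hlam _)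
  · exact nu_mul_left_le J _ _ (lam_norm_le hlam _)

theorem supp_diff {u : G → ℝ} (hu : (Function.support u).Finite) (a : G) :
    (Function.support (fun x => ((u (a * x) - u x : ℝ) : ℂ))).Finite := by
  have h1 : (Function.support (fun x => u (a * x))).Finite :=
    hu.preimage (f := fun x => a * x) (mul_right_injective a).injOn
  refine (h1.union hu).subset fun x hx => ?_
  by_contra h
  simp only [Set.mem_union, Function.mem_support, not_or, not_not] at h
  simp [h.1, h.2] at hx

theorem cap_term (hlam : ∀ (a : G) (f : L2G G) (x : G), (lam a f) x = f (a⁻¹ * x))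
    {M : (G → ℂ) → (L2G G →L[ℂ] L2G G)}
    (hM : ∀ u : G → ℂ, (Function.support u).Finite →
      ∀ (f : L2G G) (x : G), (M u f) x = u x * f x)
    (J : NormedIdeal (L2G G)) {n : ℕ} (g : Fin n → G) {u : G → ℝ}
    (hu : (Function.support u).Finite) {T : L2G G →L[ℂ] L2G G} (hT : IsDiag T (fun x => (u x : ℂ))) :
    (⨆ j, J.ν (M fun x => ((u (g j * x) - u x : ℝ) : ℂ))) = commSup J (fun j => lam (g j)) T := by
  unfold commSup
  congr 1
  funext j
  refine comm_diag hlam J (g j) hT ?_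
  intro f x
  rw [hM _ (supp_diff hu (g j))]
  push_cast
  rfl

theorem degenerate [Infinite G] (hlam : ∀ (a : G) (f : L2G G) (x : G), (lam a f) x = f (a⁻¹ * x))
    (J : NormedIdeal (L2G G)) {n : ℕ} (g : Fin n → G)
    (hgen : Subgroup.closure (Set.range g) = ⊤) (hJ : ∀ B : L2G G →L[ℂ] L2G G, B ≠ 0 → J.ν B = ⊤)
    (A : L2G G →L[ℂ] L2G G) (hA : FinRank A) (h1 : A (bv 1) = bv 1) :
    commSup J (fun j => lam (g j)) A = ⊤ := by
  classical
  by_contra hne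
  have hcomm : ∀ j, A * lam (g j) - lam (g j) * A = 0 := by
    intro j
    by_contra h0
    refine hne (top_le_iff.1 ?_)
    rw [← hJ _ h0]
    exact le_iSup (fun j => J.ν (A * lam (g j) - lam (g j) * A)) j
  have hc : ∀ j f, A (lam (g j) f) = lam (g j) (A f) := by
    intro j f
    have := congrArg (fun T : L2G G →L[ℂ] L2G G => T f) (hcomm j)
    simpa [sub_eq_zero] using this
  have hall : ∀ a : G, A (bv a) = bv a := by
    intro a
    have ha : a ∈ Subgroup.closure (Set.range g) := by rw [hgen]; trivial
    induction ha using Subgroup.closure_induction_left with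
    | one => exact h1
    | mul_left x hx y hy ih =>
      obtain ⟨j, rfl⟩ := hx
      rw [← lam_bv hlam, hc, ih]
    | inv_mul_cancel x hx y hy ih =>
      obtain ⟨j, rfl⟩ := hx
      have h2 := hc j (bv ((g j)⁻¹ * y))
      rw [lam_bv hlam, mul_inv_cancel_left, ih] at h2
      have h3 := congrArg (lam (g j)⁻¹) h2
      rw [← mul_apply_eq_comp, ← mul_apply_eq_comp, lam_bv hlam] at h3
      have h4 : ∀ f, (lam (g j)⁻¹ * lam (g j)) f = f := fun f => by rw [lam_inv hlam]; rfl
      have h5 : (lam (g j)⁻¹ * lam (g j)) (A (bv ((g j)⁻¹ * y))) = A (bv ((g j)⁻¹ * y)) := h4 _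
      exact (h3.trans h5).symm
  obtain ⟨Y, -, hY⟩ := exists_Fop_small A hA (1 / 2) (by norm_num) ∅
  obtain ⟨x, hx⟩ := Infinite.exists_notMem_finset Y
  have h2 : ((1 - Fop Y) * A) (bv x) = bv x := by
    rw [mul_apply_eq_comp, hall]
    have : (1 - Fop Y) (bv x) = bv x - Fop Y (bv x) := rfl
    rw [this, (Fop_diag Y).apply_bv]
    simp [hx]
  have h3 := ((1 - Fop Y) * A).le_opNorm (bv x)
  rw [h2, norm_bv] at h3
  linarith

end HelpersC

section HelpersD

variable {G}
variable {lam : G → (L2G G →L[ℂ] L2G G)}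

theorem small_adj (Q : L2G G →L[ℂ] L2G G) (hQ : IsSelfAdjoint Q) (Y : Finset G) :
    ‖Q * (1 - Fop Y)‖ = ‖(1 - Fop Y) * Q‖ := by
  have h : star ((1 - Fop Y) * Q) = Q * (1 - Fop Y) := by
    rw [star_mul, hQ.star_eq, star_sub, star_one, (Fop_isSelfAdjoint Y).star_eq]
  rw [← h, ContinuousLinearMap.star_eq_adjoint]
  exact LinearIsometryEquiv.norm_map _ _

theorem cap_le (hlam : ∀ (a : G) (f : L2G G) (x : G), (lam a f) x = f (a⁻¹ * x))
    {M : (G → ℂ) → (L2G G →L[ℂ] L2G G)}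
    (hM : ∀ u : G → ℂ, (Function.support u).Finite →
      ∀ (f : L2G G) (x : G), (M u f) x = u x * f x)
    (J : NormedIdeal (L2G G)) {n : ℕ} (g : Fin n → G)
    (hfin : ∀ A, FinRank A → J.ν A ≠ ⊤) (X : Finset G) (A : L2G G →L[ℂ] L2G G) (hA : FinRank A)
    (hA0 : 0 ≤ A) (hA1 : A ≤ 1) (hAX : A * Fop X = Fop X) :
    capFin G g J M X ≤ commSup J (fun j => lam (g j)) A := by
  classical
  refine ENNReal.le_of_forall_pos_le_add fun ε hε _ => ?_
  obtain ⟨δ, hδ, hδs⟩ := exists_small (J.ν A) (hfin A hA) ε hε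
  obtain ⟨m, b, hb⟩ := exists_rangeProj A hA
  set Q : L2G G →L[ℂ] L2G G := ∑ i, InnerProductSpace.rankOne ℂ (b i) (b i) with hQ
  have hAs : IsSelfAdjoint A := IsSelfAdjoint.of_nonneg hA0
  have hQs : IsSelfAdjoint Q := by
    rw [hQ, IsSelfAdjoint, star_sum]
    refine Finset.sum_congr rfl fun i _ => ?_
    rw [ContinuousLinearMap.star_eq_adjoint, InnerProductSpace.adjoint_rankOne]
  have hb' : A * Q = A := by
    have := congrArg star hb
    rwa [star_mul, hAs.star_eq, hQs.star_eq] at this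
  have hQf : FinRank Q := by
    have : ∀ s : Finset (Fin m),
        FinRank (∑ i ∈ s, InnerProductSpace.rankOne ℂ (b i) (b i)) := by
      intro s
      induction s using Finset.induction_on with
      | empty =>
        have := (finRank_rankOne (0 : L2G G) 0)
        simpa using this
      | insert a s ha ih =>
        rw [Finset.sum_insert ha]
        exact (finRank_rankOne _ _).add ih
    exact this _
  obtain ⟨Y, hXY, hY⟩ := exists_Fop_small Q hQf δ hδ X
  set B := Fop Y * A * Fop Y with hB
  have hAB : 2 * J.ν (A - B) ≤ ε := by
    have h1 : A - B = ((1 - Fop Y) * Q) * A + Fop Y * (A * (Q * (1 - Fop Y))) := by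
      have : ((1 - Fop Y) * Q) * A + Fop Y * (A * (Q * (1 - Fop Y))) =
        (1 - Fop Y) * (Q * A) + Fop Y * (A * Q) * (1 - Fop Y) := by noncomm_ring
      rw [this, hb, hb', hB]
      noncomm_ring
    have h2 : J.ν (A - B) ≤ 2 * (‖(1 - Fop Y) * Q‖₊ * J.ν A) := by
      rw [h1, two_mul]
      refine (J.ν_add _ _).trans (add_le_add (nu_mul_left J _ _) ?_)
      refine (nu_mul_left_le J _ _ (Fop_norm_le Y)).trans ?_
      refine (nu_mul_right J _ _).trans ?_
      have : ‖Q * (1 - Fop Y)‖₊ = ‖(1 - Fop Y) * Q‖₊ := NNReal.eq (small_adj Q hQs Y)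
      rw [this]
    calc 2 * J.ν (A - B) ≤ 2 * (2 * (‖(1 - Fop Y) * Q‖₊ * J.ν A)) := by gcongr
      _ = 4 * (‖(1 - Fop Y) * Q‖₊ * J.ν A) := by rw [← mul_assoc]; norm_num
      _ ≤ ε := hδs _ hY
  have hent : ∀ x, (A (bv x)) x = (((A (bv x)) x).re : ℂ) ∧ 0 ≤ ((A (bv x)) x).re ∧
      ((A (bv x)) x).re ≤ 1 := by
    intro x
    have h0 := ((ContinuousLinearMap.nonneg_iff_isPositive _).1 hA0).inner_nonneg_right (bv x)
    have h1 := ((ContinuousLinearMap.le_def _ _).1 hA1).inner_nonneg_right (bv x)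
    rw [inner_bv] at h0 h1
    have h2 : ((1 - A) (bv x)) x = 1 - (A (bv x)) x := by
      have : ((1 - A) (bv x)) x = (bv x) x - (A (bv x)) x := rfl
      rw [this, bv_apply]
      simp
    rw [h2] at h1
    rw [Complex.le_def] at h0 h1
    refine ⟨Complex.ext (by simp) (by simpa using h0.2.symm), by simpa using h0.1, ?_⟩
    have := h1.1
    simp at this
    linarith
  have hBe : ∀ x, (B (bv x)) x = if x ∈ Y then (A (bv x)) x else 0 := by
    intro x
    have h1 : (B (bv x)) x = (Fop Y (A (Fop Y (bv x)))) x := rfl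
    rw [h1, (Fop_diag _).apply_bv, map_smul, Fop_diag]
    have h2 : ∀ c : ℂ, (c • A (bv x) : L2G G) x = c * (A (bv x)) x := fun c => rfl
    rw [h2]
    by_cases hx : x ∈ Y <;> simp [hx]
  let u : G → ℝ := fun x => if x ∈ Y then ((A (bv x)) x).re else 0
  have hu : (Function.support u).Finite := by
    refine Y.finite_toSet.subset fun x hx => ?_
    by_contra h
    have h' : x ∉ Y := h
    simp [u, h'] at hx
  have hBu : ∀ x, (B (bv x)) x = (u x : ℂ) := by
    intro x
    rw [hBe]
    by_cases hx : x ∈ Y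
    · simp only [hx, u, if_true]
      exact (hent x).1
    · simp [hx, u]
  have hcap : capFin G g J M X ≤ ⨆ j, J.ν (M fun x => ((u (g j * x) - u x : ℝ) : ℂ)) := by
    refine sInf_le ⟨u, hu, fun x => ?_, fun x hx => ?_, rfl⟩
    · by_cases hx : x ∈ Y
      · simp only [hx, u, if_true]
        exact (hent x).2
      · simp [hx, u]
    · have hxY := hXY hx
      simp only [hxY, u, if_true]
      have h1 := congrArg (fun T : L2G G →L[ℂ] L2G G => T (bv x)) hAX
      simp only [mul_apply_eq_comp, (Fop_diag X).apply_bv, hx, if_true, Complex.ofReal_one,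
        one_smul] at h1
      rw [h1, bv_apply]
      simp
  refine hcap.trans (le_trans ?_ ((commSup_le J _ (fun j => lam_norm_le hlam (g j)) A B).trans
    (add_le_add le_rfl hAB)))
  refine iSup_mono fun j => ?_
  refine le_trans (pinch_diag J (lam (g j)⁻¹ * (B * lam (g j) - lam (g j) * B)) _ _
    (fun f x => hM _ (supp_diff hu (g j)) f x) (supp_diff hu (g j)) ?_)
    (nu_mul_left_le J _ _ (lam_norm_le hlam _))
  intro x _
  have h1 : ((lam (g j)⁻¹ * (B * lam (g j) - lam (g j) * B)) (bv x)) x =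
      (lam (g j)⁻¹ (B (lam (g j) (bv x)) - lam (g j) (B (bv x)))) x := rfl
  have h2 : ∀ p q : L2G G, ∀ y, (p - q) y = p y - q y := fun _ _ _ => rfl
  rw [h1, hlam, h2, hlam, lam_bv hlam, inv_inv, inv_mul_cancel_left, hBu, hBu]
  push_cast
  rfl

theorem qc_le (hlam : ∀ (a : G) (f : L2G G) (x : G), (lam a f) x = f (a⁻¹ * x))
    {M : (G → ℂ) → (L2G G →L[ℂ] L2G G)}
    (hM : ∀ u : G → ℂ, (Function.support u).Finite →
      ∀ (f : L2G G) (x : G), (M u f) x = u x * f x)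
    (J : NormedIdeal (L2G G)) {n : ℕ} (g : Fin n → G)
    (hfin : ∀ A, FinRank A → J.ν A ≠ ⊤) (P : L2G G →L[ℂ] L2G G) (hP : IsProj' P)
    (hPf : FinRank P) :
    qcModCond J (fun j => lam (g j)) P 0 ≤ sSup {c : ℝ≥0∞ | ∃ X : Finset G, c = capFin G g J M X} := by
  classical
  refine ENNReal.le_of_forall_pos_le_add fun ε hε _ => ?_
  obtain ⟨δ, hδ, hδs⟩ := exists_small (J.ν P) (hfin P hPf) ε hε
  obtain ⟨X, -, hX⟩ := exists_Fop_small P hPf δ hδ ∅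
  refine le_trans ?_ (add_le_add (le_sSup ⟨X, rfl⟩) le_rfl)
  rw [← tsub_le_iff_right]
  refine le_sInf ?_
  rintro c ⟨u, hu, hu01, huX, rfl⟩
  rw [tsub_le_iff_right]
  have huc : (Function.support fun x => (u x : ℂ)).Finite := by
    refine hu.subset fun x hx => ?_
    simpa using hx
  set B := M (fun x => (u x : ℂ)) with hB
  have hBd : IsDiag B (fun x => (u x : ℂ)) := fun f x => hM _ huc f x
  rw [cap_term hlam hM J g hu hBd]
  have hB0 : 0 ≤ B := hBd.nonneg fun x => (hu01 x).1
  have h1Bd : IsDiag (1 - B) (fun x => ((1 - u x : ℝ) : ℂ)) := by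
    have := IsDiag.one.sub hBd
    intro f x
    rw [this]
    push_cast
    rfl
  have h1B : 0 ≤ 1 - B := h1Bd.nonneg fun x => by linarith [(hu01 x).2]
  have h1Bn : ‖1 - B‖ ≤ 1 := by
    refine h1Bd.norm_le fun x => ?_
    rw [Complex.norm_real, Real.norm_eq_abs, abs_le]
    constructor <;> linarith [(hu01 x).1, (hu01 x).2]
  have hprod : (1 - B) * Fop X = 0 := by
    refine IsDiag.ext (c := fun x => 0) ?_ (fun f x => by simp)
    have := h1Bd.mul (Fop_diag X)
    intro f x
    rw [this]
    by_cases hx : x ∈ X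
    · simp [hx, huX x hx]
    · simp [hx]
  have hprod' : Fop X * (1 - B) = 0 := by
    refine IsDiag.ext (c := fun x => 0) ?_ (fun f x => by simp)
    have := (Fop_diag X).mul h1Bd
    intro f x
    rw [this]
    by_cases hx : x ∈ X
    · simp [hx, huX x hx]
    · simp [hx]
  obtain ⟨hPs, hPP⟩ := hP
  have hRs : IsSelfAdjoint (1 - P) := (IsSelfAdjoint.one _).sub hPs
  set A := P + (1 - P) * B * (1 - P) with hAdef
  have hconj : ∀ T : L2G G →L[ℂ] L2G G, 0 ≤ T → 0 ≤ (1 - P) * T * (1 - P) := by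
    intro T hT
    have := ((ContinuousLinearMap.nonneg_iff_isPositive _).1 hT).conj_adjoint (1 - P)
    rw [ContinuousLinearMap.nonneg_iff_isPositive]
    rw [← ContinuousLinearMap.star_eq_adjoint, hRs.star_eq] at this
    exact this
  have hP0 : 0 ≤ P := by
    have := ((ContinuousLinearMap.isPositive_one (𝕜 := ℂ) (E := L2G G))).conj_adjoint P
    rw [← ContinuousLinearMap.star_eq_adjoint, hPs.star_eq] at this
    rw [ContinuousLinearMap.nonneg_iff_isPositive]
    have h2 : P * (1 * P) = P := by rw [one_mul, hPP]
    rw [← h2]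
    exact this
  have hRR : (1 - P) * (1 - P) = 1 - P := by
    have : (1 - P) * (1 - P) = 1 - P - P + P * P := by noncomm_ring
    rw [this, hPP]; abel
  have hRP : (1 - P) * P = 0 := by rw [sub_mul, hPP, one_mul, sub_self]
  have hPR : P * (1 - P) = 0 := by rw [mul_sub, hPP, mul_one, sub_self]
  have hA0 : 0 ≤ A := add_nonneg hP0 (hconj B hB0)
  have hA1 : A ≤ 1 := by
    have h := hconj (1 - B) h1B
    have : (1 - P) * (1 - B) * (1 - P) = 1 - A := by
      have : (1 - P) * (1 - B) * (1 - P) = (1 - P) * (1 - P) - (1 - P) * B * (1 - P) := by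
        noncomm_ring
      rw [this, hRR, hAdef]; abel
    rw [this] at h
    exact sub_nonneg.1 h
  have hAf : FinRank A := hPf.add (((hBd.finRank huc).mul_left _).mul_right _)
  have hAP : A * P = P := by
    rw [hAdef, add_mul, mul_assoc, hRP, mul_zero, add_zero, hPP]
  have hle : qcModCond J (fun j => lam (g j)) P 0 ≤ commSup J (fun j => lam (g j)) A :=
    sInf_le ⟨A, hAf, hA0, hA1, hAP, mul_zero _, rfl⟩
  refine hle.trans ((commSup_le J _ (fun j => lam_norm_le hlam (g j)) B A).trans
    (add_le_add le_rfl ?_))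
  have e1 : (1 - B) * P = (1 - B) * (((1 - Fop X) * P) * P) := by
    have : (1 - B) * (((1 - Fop X) * P) * P) =
      (1 - B) * (P * P) - ((1 - B) * Fop X) * (P * P) := by noncomm_ring
    rw [this, hprod, hPP, zero_mul, sub_zero]
  have e2 : P * (1 - B) = P * (P * (1 - Fop X)) * (1 - B) := by
    have : P * (P * (1 - Fop X)) * (1 - B) =
      (P * P) * (1 - B) - (P * P) * (Fop X * (1 - B)) := by noncomm_ring
    rw [this, hprod', hPP, mul_zero, sub_zero]
  have hRn : ‖1 - P‖ ≤ 1 := by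
    have hle1 : ‖1 - P‖ * ‖1 - P‖ = ‖1 - P‖ := by
      have := CStarRing.norm_star_mul_self (x := 1 - P)
      rw [hRs.star_eq, hRR] at this
      exact this.symm
    nlinarith [norm_nonneg (1 - P)]
  have e3 : B - A = (P * (1 - B)) * (1 - P) * (-1) - (1 - B) * P := by
    have h3 : (P * (1 - B)) * (1 - P) * (-1) - (1 - B) * P =
      -(P * (1 - P)) + P * B * (1 - P) - P + B * P := by noncomm_ring
    have h4 : B - A = P * B * (1 - P) - P + B * P := by
      rw [hAdef]; noncomm_ring
    rw [h3, h4, hPR]; abel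
  have f1 : J.ν ((1 - B) * P) ≤ ‖(1 - Fop X) * P‖₊ * J.ν P := by
    rw [e1]
    exact (nu_mul_left_le J _ _ h1Bn).trans (nu_mul_left J _ _)
  have f2 : J.ν (P * (1 - B) * (1 - P) * (-1)) ≤ ‖(1 - Fop X) * P‖₊ * J.ν P := by
    rw [mul_neg_one, nu_neg, e2]
    refine (nu_mul_right_le J _ _ hRn).trans ((nu_mul_right_le J _ _ h1Bn).trans ?_)
    have : ‖P * (1 - Fop X)‖₊ = ‖(1 - Fop X) * P‖₊ := NNReal.eq (small_adj P hPs X)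
    rw [← this]
    exact nu_mul_right J _ _
  have f3 : J.ν (B - A) ≤ 2 * (‖(1 - Fop X) * P‖₊ * J.ν P) := by
    rw [e3, two_mul]
    exact (nu_sub J _ _).trans (add_le_add f2 f1)
  calc 2 * J.ν (B - A) ≤ 2 * (2 * (‖(1 - Fop X) * P‖₊ * J.ν P)) := by gcongr
    _ = 4 * (‖(1 - Fop X) * P‖₊ * J.ν P) := by rw [← mul_assoc]; norm_num
    _ ≤ ε := hδs _ hX

end HelpersD

/-- For a finitely generated group, `cap_J(G) = k_J(λ(γ))`: the supremum over finite
subsets of the classical capacities equals the quasicentral modulus (in its condenser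
form, as a sup over finite rank projections) of the left regular representation of the
generators. -/
theorem capG_eq_qcMod {n : ℕ} (g : Fin n → G)
    (hgen : Subgroup.closure (Set.range g) = ⊤)
    (J : NormedIdeal (L2G G))
    (lam : G → (L2G G →L[ℂ] L2G G))
    (hlam : ∀ (a : G) (f : L2G G) (x : G), (lam a f) x = f (a⁻¹ * x))
    (M : (G → ℂ) → (L2G G →L[ℂ] L2G G))
    (hM : ∀ u : G → ℂ, (Function.support u).Finite →
      ∀ (f : L2G G) (x : G), (M u f) x = u x * f x) :
    sSup {c : ℝ≥0∞ | ∃ X : Finset G, c = capFin G g J M X} =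
      ⨆ P : L2G G →L[ℂ] L2G G, ⨆ _ : IsProj' P ∧ FinRank P,
        qcModCond J (fun j => lam (g j)) P 0 := by
  classical
  have hproj : ∀ X : Finset G, IsProj' (Fop X) ∧ FinRank (Fop X) := fun X =>
    ⟨⟨Fop_isSelfAdjoint X, Fop_proj X⟩, Fop_finRank X⟩
  rcases finite_or_infinite G with hG | hG
  · have hL : sSup {c : ℝ≥0∞ | ∃ X : Finset G, c = capFin G g J M X} = 0 := by
      refine le_antisymm (sSup_le ?_) (zero_le)
      rintro c ⟨X, rfl⟩
      have hle : capFin G g J M X ≤ ⨆ _ : Fin n, J.ν (M fun x : G => (((1 : ℝ) - 1 : ℝ) : ℂ)) :=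
        sInf_le ⟨fun _ => 1, Set.toFinite _, fun x => by norm_num, fun x _ => rfl, rfl⟩
      refine hle.trans ?_
      refine iSup_le fun j => ?_
      have : (M fun x : G => (((1 : ℝ) - 1 : ℝ) : ℂ)) = 0 := by
        refine IsDiag.ext (c := fun x => 0) ?_ (fun f x => by simp)
        intro f x
        rw [hM _ (Set.toFinite _)]
        simp
      rw [this, J.ν_zero]
    rw [hL]
    symm
    refine le_antisymm (iSup_le fun P => iSup_le fun _ => ?_) (zero_le)
    have h01 : (0 : L2G G →L[ℂ] L2G G) ≤ 1 := by
      rw [ContinuousLinearMap.nonneg_iff_isPositive]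
      exact ContinuousLinearMap.isPositive_one
    have hle : qcModCond J (fun j => lam (g j)) P 0 ≤ commSup J (fun j => lam (g j)) 1 :=
      sInf_le ⟨1, (IsDiag.one (G := G)).finRank (Set.toFinite _), h01, le_rfl, one_mul _,
        mul_zero _, rfl⟩
    refine hle.trans (iSup_le fun j => ?_)
    rw [one_mul, mul_one, sub_self, J.ν_zero]
  by_cases hfin : ∀ A, FinRank A → J.ν A ≠ ⊤
  · apply le_antisymm
    · refine sSup_le ?_
      rintro c ⟨X, rfl⟩
      refine le_trans ?_ (le_iSup₂ (Fop X) (hproj X))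
      refine le_sInf ?_
      rintro c ⟨A, hA, hA0, hA1, hAX, -, rfl⟩
      exact cap_le hlam hM J g hfin X A hA hA0 hA1 hAX
    · refine iSup_le fun P => iSup_le fun hP => ?_
      exact qc_le hlam hM J g hfin P hP.1 hP.2
  · have hJ : ∀ B : L2G G →L[ℂ] L2G G, B ≠ 0 → J.ν B = ⊤ := by
      intro B hB
      by_contra h
      exact hfin fun A hA => nu_ne_top J B hB h A hA
    have hR : (⨆ P : L2G G →L[ℂ] L2G G, ⨆ _ : IsProj' P ∧ FinRank P,
        qcModCond J (fun j => lam (g j)) P 0) = ⊤ := by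
      refine top_le_iff.1 (le_trans ?_ (le_iSup₂ (Fop {1}) (hproj {1})))
      refine le_sInf ?_
      rintro c ⟨A, hA, hA0, hA1, hAX, -, rfl⟩
      refine (degenerate hlam J g hgen hJ A hA ?_).ge
      have h1 := congrArg (fun T : L2G G →L[ℂ] L2G G => T (bv 1)) hAX
      simpa [(Fop_diag ({1} : Finset G)).apply_bv] using h1
    rw [hR]
    refine top_le_iff.1 (le_trans ?_ (le_sSup ⟨{1}, rfl⟩))
    refine le_sInf ?_
    rintro c ⟨u, hu, hu01, huX, rfl⟩
    have huc : (Function.support fun x => (u x : ℂ)).Finite := by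
      refine hu.subset fun x hx => ?_
      simpa using hx
    have hBd : IsDiag (M (fun x => (u x : ℂ))) (fun x => (u x : ℂ)) := fun f x => hM _ huc f x
    rw [cap_term hlam hM J g hu hBd]
    refine (degenerate hlam J g hgen hJ _ (hBd.finRank huc) ?_).ge
    rw [hBd.apply_bv, huX 1 (by simp)]
    simp

end Groups
end

section
/- Let τ = (T_1,...,T_n) be bounded selfadjoint operators, 2 ≤ p < ∞, and I(A) the p-th power of the C_p-norm of the column of commutators ([T_1,A],...,[T_n,A])ᵀ. If the quasicentral modulus k_p(τ) = 0, then inf { I(A) : A ∈ C⁰_{PQ} } = inf { I(B) : B ∈ C_{PQ} }, where C⁰_{PQ} = { A finite rank : 0 ≤ A ≤ I, AP = P, AQ = 0 } and C_{PQ} = { B : 0 ≤ B ≤ I, BP = P, BQ = 0 }. -/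
open Filter ContinuousLinearMap
open scoped ENNReal

variable {H : Type} [NormedAddCommGroup H] [InnerProductSpace ℂ H] [CompleteSpace H]

/-- A finite rank operator between Hilbert spaces. -/
def FinRank' {K' : Type} [NormedAddCommGroup K'] [NormedSpace ℂ K'] (A : H →L[ℂ] K') : Prop :=
  FiniteDimensional ℂ (LinearMap.range A.toLinearMap)

/-- The `j`-th singular value (approximation number) of an operator. -/
noncomputable def sv' {K' : Type} [NormedAddCommGroup K'] [NormedSpace ℂ K']
    (T : H →L[ℂ] K') (j : ℕ) : ℝ :=
  sInf {r | ∃ F : H →L[ℂ] K', FinRank' F ∧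
    Module.finrank ℂ (LinearMap.range F.toLinearMap) ≤ j ∧ r = ‖T - F‖}

/-- The column operator `([T_1,A],…,[T_n,A])ᵀ : H → H^n` (with the `ℓ²` norm on `H^n`). -/
noncomputable def colComm {n : ℕ} (τ : Fin n → H →L[ℂ] H) (A : H →L[ℂ] H) :
    H →L[ℂ] PiLp 2 (fun _ : Fin n => H) :=
  ((PiLp.continuousLinearEquiv 2 ℂ (fun _ : Fin n => H)).symm :
      (∀ _ : Fin n, H) →L[ℂ] PiLp 2 (fun _ : Fin n => H)).comp
    (ContinuousLinearMap.pi fun j => τ j * A - A * τ j)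

/-- `I(A)`: the `p`-th power of the Schatten `p`-norm of the column of commutators. -/
noncomputable def Ifun (p : ℝ) {n : ℕ} (τ : Fin n → H →L[ℂ] H) (A : H →L[ℂ] H) : ℝ≥0∞ :=
  ∑' j : ℕ, ENNReal.ofReal (sv' (colComm τ A) j) ^ p

/-- The Schatten `p`-norm of an operator on `H`. -/
noncomputable def schattenNu (p : ℝ) (X : H →L[ℂ] H) : ℝ≥0∞ :=
  (∑' j : ℕ, ENNReal.ofReal (sv' X j) ^ p) ^ (1 / p)

/-- The quasicentral modulus `k_p(τ)` relative to the Schatten `p`-class. -/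
noncomputable def kSchatten (p : ℝ) {n : ℕ} (τ : Fin n → H →L[ℂ] H) : ℝ≥0∞ :=
  sInf {C | ∃ A : ℕ → H →L[ℂ] H,
    ((∀ m, FinRank' (A m) ∧ 0 ≤ A m ∧ A m ≤ 1) ∧ Monotone A ∧
      ∀ x : H, Tendsto (fun m => A m x) atTop (nhds x)) ∧
    Tendsto (fun m => ⨆ j, schattenNu p (A m * τ j - τ j * A m)) atTop (nhds C)}

/-- The admissible set `C_{PQ}` of the condenser variational problem. -/
def Cfull (P Q : H →L[ℂ] H) : Set (H →L[ℂ] H) :=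
  {B | 0 ≤ B ∧ B ≤ 1 ∧ B * P = P ∧ B * Q = 0}

/-- The finite rank admissible set `C⁰_{PQ}`. -/
def Czero (P Q : H →L[ℂ] H) : Set (H →L[ℂ] H) :=
  {A | FinRank' A ∧ 0 ≤ A ∧ A ≤ 1 ∧ A * P = P ∧ A * Q = 0}


set_option linter.unusedSectionVars false

section Helpers
variable {K' : Type} [NormedAddCommGroup K'] [NormedSpace ℂ K']

lemma aux_bdd (T : H →L[ℂ] K') (j : ℕ) : BddBelow {r | ∃ F : H →L[ℂ] K', FinRank' F ∧
    Module.finrank ℂ (LinearMap.range F.toLinearMap) ≤ j ∧ r = ‖T - F‖} :=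
  ⟨0, by rintro r ⟨F, _, _, rfl⟩; exact norm_nonneg _⟩

lemma aux_ne (T : H →L[ℂ] K') (j : ℕ) : Set.Nonempty {r | ∃ F : H →L[ℂ] K', FinRank' F ∧
    Module.finrank ℂ (LinearMap.range F.toLinearMap) ≤ j ∧ r = ‖T - F‖} := by
  refine ⟨‖T - 0‖, 0, ?_, ?_, rfl⟩
  · unfold FinRank'
    rw [ContinuousLinearMap.toLinearMap_zero, LinearMap.range_zero]; infer_instance
  · rw [ContinuousLinearMap.toLinearMap_zero, LinearMap.range_zero]; simp

lemma sv_nonneg (T : H →L[ℂ] K') (j : ℕ) : 0 ≤ sv' T j :=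
  Real.sInf_nonneg (by rintro r ⟨F, _, _, rfl⟩; exact norm_nonneg _)

lemma sv_le (T F : H →L[ℂ] K') (j : ℕ) (hF : FinRank' F)
    (hj : Module.finrank ℂ (LinearMap.range F.toLinearMap) ≤ j) : sv' T j ≤ ‖T - F‖ :=
  csInf_le (aux_bdd T j) ⟨F, hF, hj, rfl⟩

lemma sv_exists (T : H →L[ℂ] K') (j : ℕ) {ε : ℝ} (hε : 0 < ε) :
    ∃ F : H →L[ℂ] K', FinRank' F ∧ Module.finrank ℂ (LinearMap.range F.toLinearMap) ≤ j ∧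
      ‖T - F‖ < sv' T j + ε := by
  obtain ⟨r, ⟨F, h1, h2, rfl⟩, h⟩ := Real.lt_sInf_add_pos (aux_ne T j) hε
  exact ⟨F, h1, h2, h⟩

lemma sv_anti (T : H →L[ℂ] K') : Antitone (sv' T) := by
  intro i j hij
  refine le_of_forall_pos_le_add fun ε hε => ?_
  obtain ⟨F, h1, h2, h⟩ := sv_exists T i hε
  exact (sv_le T F j h1 (h2.trans hij)).trans h.le

lemma sv_add (S T : H →L[ℂ] K') (i j : ℕ) : sv' (S + T) (i + j) ≤ sv' S i + sv' T j := by
  refine le_of_forall_pos_le_add fun ε hε => ?_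
  obtain ⟨F, h1, h2, h⟩ := sv_exists S i (half_pos hε)
  obtain ⟨G, g1, g2, g⟩ := sv_exists T j (half_pos hε)
  have hle : LinearMap.range (F + G).toLinearMap ≤
      LinearMap.range F.toLinearMap ⊔ LinearMap.range G.toLinearMap := by
    rintro _ ⟨x, rfl⟩
    exact Submodule.add_mem_sup ⟨x, rfl⟩ ⟨x, rfl⟩
  unfold FinRank' at h1 g1
  have hfd : FiniteDimensional ℂ
    ↥(LinearMap.range F.toLinearMap ⊔ LinearMap.range G.toLinearMap) := inferInstance
  have := sv_le (S + T) (F + G) (i + j) (Submodule.finiteDimensional_of_le hle)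
    ((Submodule.finrank_mono hle).trans
      ((Submodule.finrank_add_le_finrank_add_finrank _ _).trans (add_le_add h2 g2)))
  have e : S + T - (F + G) = (S - F) + (T - G) := by abel
  rw [e] at this
  linarith [norm_add_le (S - F) (T - G)]

lemma sv_of_rank (T : H →L[ℂ] K') (j : ℕ) (hF : FinRank' T)
    (hj : Module.finrank ℂ (LinearMap.range T.toLinearMap) ≤ j) : sv' T j = 0 := by
  have := sv_le T T j hF hj
  simp at this
  exact le_antisymm this (sv_nonneg _ _)

lemma sv_le_norm (T : H →L[ℂ] K') (j : ℕ) : sv' T j ≤ ‖T‖ := by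
  obtain ⟨r, F, h⟩ := aux_ne (0 : H →L[ℂ] K') 0
  have := sv_le T 0 j (by
    unfold FinRank'
    rw [ContinuousLinearMap.toLinearMap_zero, LinearMap.range_zero]; infer_instance) (by
    rw [ContinuousLinearMap.toLinearMap_zero, LinearMap.range_zero]; simp)
  simpa using this

lemma finrank_comp {L' : Type} [NormedAddCommGroup L'] [NormedSpace ℂ L']
    (F : H →L[ℂ] K') (X : K' →L[ℂ] L') (Y : H →L[ℂ] H) (hF : FinRank' F) :
    FinRank' (X.comp (F.comp Y)) ∧
    Module.finrank ℂ (LinearMap.range (X.comp (F.comp Y)).toLinearMap) ≤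
      Module.finrank ℂ (LinearMap.range F.toLinearMap) := by
  have hle : LinearMap.range (X.comp (F.comp Y)).toLinearMap ≤
      (LinearMap.range F.toLinearMap).map X.toLinearMap := by
    rintro _ ⟨x, rfl⟩
    exact ⟨F (Y x), ⟨Y x, rfl⟩, rfl⟩
  unfold FinRank' at *
  exact ⟨Submodule.finiteDimensional_of_le hle, (Submodule.finrank_mono hle).trans
    (Submodule.finrank_map_le _ _)⟩

lemma sv_comp {L' : Type} [NormedAddCommGroup L'] [NormedSpace ℂ L']
    (T : H →L[ℂ] K') (X : K' →L[ℂ] L') (Y : H →L[ℂ] H) (j : ℕ) {c : ℝ}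
    (hc : ‖X‖ * ‖Y‖ ≤ c) : sv' (X.comp (T.comp Y)) j ≤ c * sv' T j := by
  have hc0 : 0 ≤ c := le_trans (by positivity) hc
  refine le_of_forall_pos_le_add fun ε hε => ?_
  obtain ⟨F, h1, h2, h⟩ := sv_exists T j (ε := ε / (c + 1)) (by positivity)
  obtain ⟨g1, g2⟩ := finrank_comp F X Y h1
  refine (sv_le _ _ j g1 (g2.trans h2)).trans ?_
  have e : X.comp (T.comp Y) - X.comp (F.comp Y) = X.comp ((T - F).comp Y) := by
    ext x; simp
  rw [e]
  calc ‖X.comp ((T - F).comp Y)‖ ≤ ‖X‖ * (‖T - F‖ * ‖Y‖) :=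
        (opNorm_comp_le _ _).trans (by gcongr; exact opNorm_comp_le _ _)
    _ = (‖X‖ * ‖Y‖) * ‖T - F‖ := by ring
    _ ≤ c * (sv' T j + ε / (c + 1)) := by gcongr
    _ = c * sv' T j + ε * (c / (c + 1)) := by ring
    _ ≤ c * sv' T j + ε := by
        have : c / (c + 1) ≤ 1 := by rw [div_le_one (by positivity)]; linarith
        nlinarith

/-- Sum of the p-th powers of singular values. -/
noncomputable def Ssum (p : ℝ) (T : H →L[ℂ] K') : ℝ≥0∞ :=
  ∑' j : ℕ, ENNReal.ofReal (sv' T j) ^ p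

lemma Ssum_rank {p : ℝ} (hp : 2 ≤ p) (T : H →L[ℂ] K') (r : ℕ) (hF : FinRank' T)
    (hr : Module.finrank ℂ (LinearMap.range T.toLinearMap) ≤ r) :
    Ssum p T ≤ r * ENNReal.ofReal ‖T‖ ^ p := by
  unfold Ssum
  rw [tsum_eq_sum (s := Finset.range r)]
  · calc _ ≤ ∑ j ∈ Finset.range r, ENNReal.ofReal ‖T‖ ^ p := by
          gcongr
          exact sv_le_norm _ _
      _ = _ := by simp
  · intro j hj
    rw [sv_of_rank T j hF (hr.trans (by simpa using hj))]
    simp; linarith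

lemma Ssum_comp {p : ℝ} (hp : 2 ≤ p) {L' : Type} [NormedAddCommGroup L'] [NormedSpace ℂ L']
    (T : H →L[ℂ] K') (X : K' →L[ℂ] L') (Y : H →L[ℂ] H) {c : ℝ}
    (hc : ‖X‖ * ‖Y‖ ≤ c) : Ssum p (X.comp (T.comp Y)) ≤ ENNReal.ofReal c ^ p * Ssum p T := by
  have hc0 : 0 ≤ c := le_trans (by positivity) hc
  unfold Ssum
  rw [← ENNReal.tsum_mul_left]
  refine ENNReal.tsum_le_tsum fun j => ?_
  rw [← ENNReal.mul_rpow_of_nonneg _ _ (by linarith), ← ENNReal.ofReal_mul hc0]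
  gcongr
  exact sv_comp T X Y j hc

lemma tsum_pair (f : ℕ → ℝ≥0∞) : ∑' j, f j = ∑' k, (f (2 * k) + f (2 * k + 1)) := by
  rw [ENNReal.tsum_add]
  exact (tsum_even_add_odd ENNReal.summable ENNReal.summable).symm

lemma seq_tail {p : ℝ} (hp : 2 ≤ p) (a e c : ℕ → ℝ≥0∞) (hc : Antitone c)
    (h : ∀ i j, c (i + j) ≤ a i + e j) (N : ℕ) :
    ∑' j, c (j + 2 * N) ^ p ≤ 2 * 2 ^ p * (∑' j, a (j + N) ^ p + ∑' j, e j ^ p) := by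
  rw [tsum_pair]
  have key : ∀ k, c (2 * k + 2 * N) ^ p + c (2 * k + 1 + 2 * N) ^ p ≤
      2 * 2 ^ p * (a (k + N) ^ p + e (k + N) ^ p) := by
    intro k
    have h1 : c (2 * k + 2 * N) ≤ a (k + N) + e (k + N) := by
      have := h (k + N) (k + N)
      rwa [show k + N + (k + N) = 2 * k + 2 * N by ring] at this
    have h2 : c (2 * k + 1 + 2 * N) ≤ a (k + N) + e (k + N) := (hc (by omega)).trans h1
    have h3 : (a (k + N) + e (k + N)) ^ p ≤ 2 ^ p * (a (k + N) ^ p + e (k + N) ^ p) := by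
      refine (ENNReal.rpow_add_le_mul_rpow_add_rpow _ _ (by linarith)).trans ?_
      gcongr
      · norm_num
      · linarith
    have hp0 : 0 ≤ p := by linarith
    calc _ ≤ (a (k + N) + e (k + N)) ^ p + (a (k + N) + e (k + N)) ^ p := by gcongr
      _ = 2 * (a (k + N) + e (k + N)) ^ p := by ring
      _ ≤ 2 * (2 ^ p * (a (k + N) ^ p + e (k + N) ^ p)) := by gcongr
      _ = _ := by ring
  refine (ENNReal.tsum_le_tsum key).trans ?_
  rw [ENNReal.tsum_mul_left, ENNReal.tsum_add]
  refine mul_le_mul_right (add_le_add le_rfl ?_) _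
  exact ENNReal.tsum_comp_le_tsum_of_injective (add_left_injective N) (fun j => e j ^ p)

lemma ofReal_sv_anti (T : H →L[ℂ] K') : Antitone (fun j => ENNReal.ofReal (sv' T j)) :=
  fun _ _ h => ENNReal.ofReal_le_ofReal (sv_anti T h)

lemma ofReal_sv_add (S T : H →L[ℂ] K') (i j : ℕ) : ENNReal.ofReal (sv' (S + T) (i + j)) ≤
    ENNReal.ofReal (sv' S i) + ENNReal.ofReal (sv' T j) := by
  rw [← ENNReal.ofReal_add (sv_nonneg _ _) (sv_nonneg _ _)]
  exact ENNReal.ofReal_le_ofReal (sv_add S T i j)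

lemma Ssum_add {p : ℝ} (hp : 2 ≤ p) (S T : H →L[ℂ] K') :
    Ssum p (S + T) ≤ 2 * 2 ^ p * (Ssum p S + Ssum p T) := by
  simpa [Ssum] using seq_tail hp _ _ _ (ofReal_sv_anti (S + T)) (ofReal_sv_add S T) 0

/-- Convergence to zero in Schatten class. -/
def SmallSeq (p : ℝ) (X : ℕ → H →L[ℂ] K') : Prop := Tendsto (fun m => Ssum p (X m)) atTop (nhds 0)

lemma const_ne_top (p : ℝ) : (2 * 2 ^ p : ℝ≥0∞) ≠ ⊤ :=
  ENNReal.mul_ne_top (by simp) (ENNReal.rpow_ne_top_of_ne_zero (by simp) (by simp))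

lemma SmallSeq.add {p : ℝ} (hp : 2 ≤ p) {X Y : ℕ → H →L[ℂ] K'} (hX : SmallSeq p X) (hY : SmallSeq p Y) :
    SmallSeq p (fun m => X m + Y m) := by
  have h := ENNReal.Tendsto.const_mul (a := (2 * 2 ^ p : ℝ≥0∞)) (Tendsto.add hX hY)
    (Or.inr (const_ne_top p))
  simp only [add_zero, mul_zero] at h
  exact tendsto_of_tendsto_of_tendsto_of_le_of_le tendsto_const_nhds h (fun _ => zero_le)
    (fun m => Ssum_add hp _ _)

lemma SmallSeq.comp {p : ℝ} (hp : 2 ≤ p) {L' : Type} [NormedAddCommGroup L'] [NormedSpace ℂ L']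
    {T : ℕ → H →L[ℂ] K'} (hT : SmallSeq p T) (X : ℕ → K' →L[ℂ] L') (Y : ℕ → H →L[ℂ] H) (c : ℝ)
    (hc : ∀ m, ‖X m‖ * ‖Y m‖ ≤ c) : SmallSeq p (fun m => (X m).comp ((T m).comp (Y m))) := by
  have h := ENNReal.Tendsto.const_mul (a := (ENNReal.ofReal c ^ p : ℝ≥0∞)) hT
    (Or.inr (ENNReal.rpow_ne_top_of_nonneg (by linarith) (by simp)))
  simp only [mul_zero] at h
  exact tendsto_of_tendsto_of_tendsto_of_le_of_le tendsto_const_nhds h (fun _ => zero_le)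
    (fun m => Ssum_comp hp _ _ _ (hc m))

lemma SmallSeq.rank {p : ℝ} (hp : 2 ≤ p) {T : ℕ → H →L[ℂ] K'} (r : ℕ) (hF : ∀ m, FinRank' (T m))
    (hr : ∀ m, Module.finrank ℂ (LinearMap.range (T m).toLinearMap) ≤ r)
    (hT : Tendsto (fun m => ‖T m‖) atTop (nhds 0)) : SmallSeq p T := by
  have h1 : Tendsto (fun m => ENNReal.ofReal ‖T m‖ ^ p) atTop (nhds 0) := by
    have := ((ENNReal.continuous_rpow_const (y := p)).tendsto _).comp
      (ENNReal.tendsto_ofReal hT)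
    simpa [ENNReal.zero_rpow_of_pos (show 0 < p by linarith), Function.comp_def] using this
  have h := ENNReal.Tendsto.const_mul (a := (r : ℝ≥0∞)) h1 (Or.inr (by simp))
  simp only [mul_zero] at h
  exact tendsto_of_tendsto_of_tendsto_of_le_of_le tendsto_const_nhds h (fun _ => zero_le)
    (fun m => Ssum_rank hp _ r (hF m) (hr m))

lemma SmallSeq.zero {p : ℝ} (hp : 2 ≤ p) : SmallSeq p (fun _ => (0 : H →L[ℂ] K')) := by
  have : LinearMap.range (0 : H →L[ℂ] K').toLinearMap = ⊥ := by
    rw [ContinuousLinearMap.toLinearMap_zero, LinearMap.range_zero]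
  refine SmallSeq.rank hp 0 (fun m => ?_) (fun m => ?_) (by simp)
  · unfold FinRank'
    rw [this]; infer_instance
  · rw [this]; simp

lemma SmallSeq.sum {p : ℝ} (hp : 2 ≤ p) {ι : Type} (s : Finset ι) {X : ι → ℕ → H →L[ℂ] K'}
    (hX : ∀ i, SmallSeq p (X i)) : SmallSeq p (fun m => ∑ i ∈ s, X i m) := by
  classical
  induction s using Finset.induction_on with
  | empty => simpa using SmallSeq.zero hp
  | insert i s hi ih =>
    simp only [Finset.sum_insert hi]
    exact SmallSeq.add hp (hX i) ih

lemma perturb {p : ℝ} (hp : 2 ≤ p) (T : H →L[ℂ] K') (hT : Ssum p T ≠ ⊤)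
    (E T' : ℕ → H →L[ℂ] K') (hE : SmallSeq p E) (hT' : ∀ m j, sv' (T' m) j ≤ sv' T j)
    {ε : ℝ≥0∞} (hε : ε ≠ 0) : ∀ᶠ m in atTop, Ssum p (T' m + E m) ≤ Ssum p T + ε := by
  have hp0 : 0 < p := by linarith
  set a : ℕ → ℝ≥0∞ := fun j => ENNReal.ofReal (sv' T j) with ha
  have hS : Ssum p T = ∑' j, a j ^ p := rfl
  have hε2 : 0 < ε / 2 := ENNReal.half_pos hε
  -- tail
  have ht1 : Tendsto (fun N => 2 * 2 ^ p * (∑' j, a (j + N) ^ p)) atTop (nhds 0) := by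
    have := ENNReal.Tendsto.const_mul (a := (2 * 2 ^ p : ℝ≥0∞))
      (ENNReal.tendsto_sum_nat_add (fun j => a j ^ p) hT) (Or.inr (const_ne_top p))
    simpa using this
  obtain ⟨N, hN⟩ := (ht1.eventually (gt_mem_nhds hε2)).exists
  have ht2 : Tendsto (fun m => 2 * 2 ^ p * (∑' j, a (j + N) ^ p + Ssum p (E m))) atTop
      (nhds (2 * 2 ^ p * (∑' j, a (j + N) ^ p))) := by
    have := ENNReal.Tendsto.const_mul (a := (2 * 2 ^ p : ℝ≥0∞))
      (Tendsto.add (tendsto_const_nhds (x := ∑' j, a (j + N) ^ p)) hE) (Or.inr (const_ne_top p))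
    simpa using this
  have he0 : Tendsto (fun m => ENNReal.ofReal (sv' (E m) 0)) atTop (nhds 0) := by
    have h1 : Tendsto (fun m => Ssum p (E m) ^ (1 / p)) atTop (nhds 0) := by
      have := ((ENNReal.continuous_rpow_const (y := 1 / p)).tendsto _).comp hE
      simpa [ENNReal.zero_rpow_of_pos (show 0 < p⁻¹ by positivity), Function.comp_def] using this
    refine tendsto_of_tendsto_of_tendsto_of_le_of_le tendsto_const_nhds h1 (fun _ => zero_le)
      (fun m => ?_)
    show _ ≤ Ssum p (E m) ^ (1 / p)
    rw [one_div, ENNReal.le_rpow_inv_iff hp0]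
    exact ENNReal.le_tsum (f := fun j => ENNReal.ofReal (sv' (E m) j) ^ p) 0
  have hh : Tendsto (fun m => ∑ j ∈ Finset.range (2 * N),
      (a j + ENNReal.ofReal (sv' (E m) 0)) ^ p) atTop
      (nhds (∑ j ∈ Finset.range (2 * N), a j ^ p)) := by
    refine tendsto_finsetSum _ fun j _ => ?_
    have := ((ENNReal.continuous_rpow_const (y := p)).tendsto _).comp
      (Tendsto.add (tendsto_const_nhds (x := a j)) he0)
    simpa [Function.comp_def] using this
  have hle : ∑ j ∈ Finset.range (2 * N), a j ^ p ≤ Ssum p T := ENNReal.sum_le_tsum _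
  have hlt : ∑ j ∈ Finset.range (2 * N), a j ^ p < Ssum p T + ε / 2 :=
    lt_of_le_of_lt hle (ENNReal.lt_add_right hT hε2.ne')
  filter_upwards [hh.eventually (gt_mem_nhds hlt), ht2.eventually (gt_mem_nhds hN)] with m h1 h2
  have hadd : ∀ i j, ENNReal.ofReal (sv' (T' m + E m) (i + j)) ≤
      a i + ENNReal.ofReal (sv' (E m) j) := fun i j =>
    (ofReal_sv_add _ _ i j).trans (by gcongr; exact ENNReal.ofReal_le_ofReal (hT' m i))
  have htail := seq_tail hp a _ _ (ofReal_sv_anti (T' m + E m)) hadd N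
  have hsplit : Ssum p (T' m + E m) =
      ∑ j ∈ Finset.range (2 * N), ENNReal.ofReal (sv' (T' m + E m) j) ^ p +
      ∑' j, ENNReal.ofReal (sv' (T' m + E m) (j + 2 * N)) ^ p :=
    (ENNReal.summable.sum_add_tsum_nat_add' (f := fun j =>
      ENNReal.ofReal (sv' (T' m + E m) j) ^ p)).symm
  rw [hsplit]
  calc _ ≤ ∑ j ∈ Finset.range (2 * N), (a j + ENNReal.ofReal (sv' (E m) 0)) ^ p +
        2 * 2 ^ p * (∑' j, a (j + N) ^ p + Ssum p (E m)) := by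
        gcongr with j _
        · exact hadd j 0
        · exact htail
    _ ≤ (Ssum p T + ε / 2) + ε / 2 := by gcongr
    _ = _ := by rw [add_assoc, ENNReal.add_halves]

end Helpers

/-- Diagonal amplification. -/
noncomputable def ampl (n : ℕ) (X : H →L[ℂ] H) :
    PiLp 2 (fun _ : Fin n => H) →L[ℂ] PiLp 2 (fun _ : Fin n => H) :=
  ((PiLp.continuousLinearEquiv 2 ℂ (fun _ : Fin n => H)).symm :
      (∀ _ : Fin n, H) →L[ℂ] PiLp 2 (fun _ : Fin n => H)).comp
    (ContinuousLinearMap.pi fun j => X.comp (PiLp.proj 2 (fun _ : Fin n => H) j))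

lemma ampl_apply (n : ℕ) (X : H →L[ℂ] H) (v : PiLp 2 (fun _ : Fin n => H)) (j : Fin n) :
    ampl n X v j = X (v j) := rfl

lemma ampl_norm (n : ℕ) (X : H →L[ℂ] H) : ‖ampl n X‖ ≤ ‖X‖ := by
  refine opNorm_le_bound _ (norm_nonneg _) fun v => ?_
  rw [← sq_le_sq₀ (norm_nonneg _) (by positivity), mul_pow, PiLp.norm_sq_eq_of_L2,
    PiLp.norm_sq_eq_of_L2, Finset.mul_sum]
  gcongr with j _
  rw [ampl_apply, ← mul_pow]
  gcongr
  exact X.le_opNorm _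

lemma colComm_apply {n : ℕ} (τ : Fin n → H →L[ℂ] H) (A : H →L[ℂ] H) (x : H) (j : Fin n) :
    colComm τ A x j = τ j (A x) - A (τ j x) := rfl

lemma colComm_sandwich {n : ℕ} (τ : Fin n → H →L[ℂ] H) (A B : H →L[ℂ] H) :
    colComm τ (A * B * A) = (ampl n A).comp ((colComm τ B).comp A) +
      ((ampl n 1).comp ((colComm τ A).comp (B * A)) +
        (ampl n (A * B)).comp ((colComm τ A).comp (1 : H →L[ℂ] H))) := by
  ext x j
  simp [colComm_apply, ampl_apply]
  abel

/-- Coordinate embedding. -/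
noncomputable def emb (n : ℕ) (j : Fin n) : H →L[ℂ] PiLp 2 (fun _ : Fin n => H) :=
  ((PiLp.continuousLinearEquiv 2 ℂ (fun _ : Fin n => H)).symm :
      (∀ _ : Fin n, H) →L[ℂ] PiLp 2 (fun _ : Fin n => H)).comp
    (ContinuousLinearMap.single ℂ (fun _ : Fin n => H) j)

lemma emb_apply (n : ℕ) (j i : Fin n) (x : H) :
    emb n j x i = (Pi.single j x : Fin n → H) i := rfl

lemma colComm_sum {n : ℕ} (τ : Fin n → H →L[ℂ] H) (A : H →L[ℂ] H) :
    colComm τ A = ∑ j, (emb n j).comp ((τ j * A - A * τ j).comp (1 : H →L[ℂ] H)) := by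
  ext x i
  simp [colComm_apply, emb_apply, Finset.sum_apply, Pi.single_apply]

lemma tendsto_norm_mul {R : H →L[ℂ] H} (hR : FinRank' R) (A : ℕ → H →L[ℂ] H)
    (hA : ∀ x, Tendsto (fun m => A m x) atTop (nhds x)) :
    Tendsto (fun m => ‖(1 - A m) * R‖) atTop (nhds 0) := by
  unfold FinRank' at hR
  set V := LinearMap.range R.toLinearMap
  let b := Module.finBasis ℂ V
  obtain ⟨C, hC, h⟩ := b.exists_opNorm_le (F := H)
  have h1 : Tendsto (fun m => C * (∑ i, ‖((1 - A m) : H →L[ℂ] H) (b i : H)‖) * ‖R‖)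
      atTop (nhds 0) := by
    have h2 : Tendsto (fun m => ∑ i, ‖((1 - A m) : H →L[ℂ] H) (b i : H)‖) atTop
        (nhds (∑ i : Fin (Module.finrank ℂ V), (0 : ℝ))) := by
      refine tendsto_finsetSum _ fun i _ => ?_
      have := (tendsto_const_nhds (x := (b i : H))).sub (hA (b i))
      simpa using this.norm
    simpa using (h2.const_mul C).mul_const ‖R‖
  refine squeeze_zero (fun _ => norm_nonneg _) (fun m => ?_) h1
  have h3 := @h ((1 - A m).comp V.subtypeL) (∑ i, ‖((1 - A m) : H →L[ℂ] H) (b i : H)‖)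
    (Finset.sum_nonneg fun _ _ => norm_nonneg _) (fun i =>
      Finset.single_le_sum (f := fun i => ‖((1 - A m) : H →L[ℂ] H) (b i : H)‖)
        (fun _ _ => norm_nonneg _) (Finset.mem_univ i))
  refine opNorm_le_bound _ (mul_nonneg (mul_nonneg hC.le
    (Finset.sum_nonneg fun _ _ => norm_nonneg _)) (norm_nonneg _)) fun x => ?_
  have h4 := ((1 - A m).comp V.subtypeL).le_opNorm ⟨R x, ⟨x, rfl⟩⟩
  calc ‖((1 - A m) * R) x‖ ≤ ‖(1 - A m).comp V.subtypeL‖ * ‖R x‖ := h4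
    _ ≤ (C * ∑ i, ‖((1 - A m) : H →L[ℂ] H) (b i : H)‖) * (‖R‖ * ‖x‖) := by
        gcongr
        exact R.le_opNorm x
    _ = _ := by ring

lemma extract (p : ℝ) (hp : 2 ≤ p) {n : ℕ} (τ : Fin n → H →L[ℂ] H) {R : H →L[ℂ] H}
    (hR : FinRank' R) (hk : kSchatten p τ = 0) :
    ∃ A : ℕ → H →L[ℂ] H, (∀ m, FinRank' (A m) ∧ 0 ≤ A m ∧ A m ≤ 1) ∧
      Tendsto (fun m => ‖(1 - A m) * R‖) atTop (nhds 0) ∧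
      ∀ j, SmallSeq p (fun m => τ j * A m - A m * τ j) := by
  have hp0 : 0 < p := by linarith
  have key : ∀ m : ℕ, ∃ A : H →L[ℂ] H, (FinRank' A ∧ 0 ≤ A ∧ A ≤ 1) ∧
      ‖(1 - A) * R‖ < 1 / ((m : ℝ) + 1) ∧
      ∀ j, schattenNu p (A * τ j - τ j * A) ≤ ENNReal.ofReal (1 / ((m : ℝ) + 1)) := by
    intro m
    have hpos : 0 < 1 / ((m : ℝ) + 1) := by positivity
    have : kSchatten p τ < ENNReal.ofReal (1 / ((m : ℝ) + 1)) := by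
      rw [hk]; exact ENNReal.ofReal_pos.2 hpos
    obtain ⟨C, ⟨A, ⟨hA, _, hA1⟩, hA2⟩, hC⟩ := sInf_lt_iff.1 this
    obtain ⟨k, h1, h2⟩ := ((hA2.eventually (gt_mem_nhds hC)).and
      ((tendsto_norm_mul hR A hA1).eventually (gt_mem_nhds hpos))).exists
    exact ⟨A k, hA k, h2, fun j => (le_iSup (fun j => schattenNu p (A k * τ j - τ j * A k)) j).trans
      h1.le⟩
  choose A h1 h2 h3 using key
  refine ⟨A, h1, squeeze_zero (fun _ => norm_nonneg _) (fun m => (h2 m).le)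
    tendsto_one_div_add_atTop_nhds_zero_nat, fun j => ?_⟩
  have hs : SmallSeq p (fun m => A m * τ j - τ j * A m) := by
    have hq : Tendsto (fun m : ℕ => ENNReal.ofReal (1 / ((m : ℝ) + 1)) ^ p) atTop (nhds 0) := by
      have := ((ENNReal.continuous_rpow_const (y := p)).tendsto _).comp
        (ENNReal.tendsto_ofReal (tendsto_one_div_add_atTop_nhds_zero_nat (𝕜 := ℝ)))
      rw [ENNReal.ofReal_zero, ENNReal.zero_rpow_of_pos hp0] at this
      exact this
    refine tendsto_of_tendsto_of_tendsto_of_le_of_le tendsto_const_nhds hq (fun _ => zero_le)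
      (fun m => ?_)
    have := h3 m j
    unfold schattenNu at this
    rw [one_div, ENNReal.rpow_inv_le_iff hp0] at this
    exact this
  have := SmallSeq.comp hp hs (fun _ => (-1 : H →L[ℂ] H)) (fun _ => 1)
    (‖(-1 : H →L[ℂ] H)‖ * ‖(1 : H →L[ℂ] H)‖) (fun _ => le_rfl)
  convert this using 2 with m
  ext x
  simp
  abel

lemma comp_one_left (F Y : H →L[ℂ] H) :
    (1 : H →L[ℂ] H).comp (F.comp Y) = F * Y := by ext; rfl

lemma comp_one_right (X F : H →L[ℂ] H) :
    X.comp (F.comp (1 : H →L[ℂ] H)) = X * F := by ext; rfl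

lemma comp_three (X F Y : H →L[ℂ] H) : X.comp (F.comp Y) = X * F * Y := by ext; rfl

lemma finrank_mul_right (F Y : H →L[ℂ] H) (hF : FinRank' F) : FinRank' (F * Y) ∧
    Module.finrank ℂ (LinearMap.range (F * Y).toLinearMap) ≤
      Module.finrank ℂ (LinearMap.range F.toLinearMap) := by
  have := finrank_comp F (1 : H →L[ℂ] H) Y hF
  rwa [comp_one_left] at this

lemma finrank_mul_left (X F : H →L[ℂ] H) (hF : FinRank' F) : FinRank' (X * F) ∧
    Module.finrank ℂ (LinearMap.range (X * F).toLinearMap) ≤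
      Module.finrank ℂ (LinearMap.range F.toLinearMap) := by
  have := finrank_comp F X (1 : H →L[ℂ] H) hF
  rwa [comp_one_right] at this

lemma SmallSeq.mul_right {p : ℝ} (hp : 2 ≤ p) {T : ℕ → H →L[ℂ] H} (hT : SmallSeq p T)
    (Y : H →L[ℂ] H) : SmallSeq p (fun m => T m * Y) := by
  have := SmallSeq.comp hp hT (fun _ => (1 : H →L[ℂ] H)) (fun _ => Y) _ (fun _ => le_rfl)
  simpa only [comp_one_left] using this

lemma SmallSeq.mul_left {p : ℝ} (hp : 2 ≤ p) {T : ℕ → H →L[ℂ] H} (hT : SmallSeq p T)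
    (X : H →L[ℂ] H) : SmallSeq p (fun m => X * T m) := by
  have := SmallSeq.comp hp hT (fun _ => X) (fun _ => (1 : H →L[ℂ] H)) _ (fun _ => le_rfl)
  simpa only [comp_one_right] using this

lemma extract' (p : ℝ) (hp : 2 ≤ p) {n : ℕ} (τ : Fin n → H →L[ℂ] H) {R : H →L[ℂ] H}
    (hR : FinRank' R) (hsa : IsSelfAdjoint R) (hRR : R * R = R) (hk : kSchatten p τ = 0) :
    ∃ A : ℕ → H →L[ℂ] H, (∀ m, FinRank' (A m) ∧ 0 ≤ A m ∧ A m ≤ 1 ∧ A m * R = R) ∧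
      ∀ j, SmallSeq p (fun m => τ j * A m - A m * τ j) := by
  obtain ⟨A, hA, hAR, hS⟩ := extract p hp τ hR hk
  set r := Module.finrank ℂ (LinearMap.range R.toLinearMap)
  have hsa1 : IsSelfAdjoint (1 - R) := (IsSelfAdjoint.one _).sub hsa
  have hR0 : 0 ≤ R := by
    have := star_mul_self_nonneg R
    rwa [hsa.star_eq, hRR] at this
  have hU : SmallSeq p (fun m => (1 - A m) * R) := by
    refine SmallSeq.rank hp r (fun m => ?_) (fun m => ?_) hAR
    · exact (finrank_mul_left (1 - A m) R hR).1
    · exact (finrank_mul_left (1 - A m) R hR).2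
  have hV : SmallSeq p (fun m => R * (1 - A m)) := by
    refine SmallSeq.rank hp r (fun m => ?_) (fun m => ?_) ?_
    · exact (finrank_mul_right R (1 - A m) hR).1
    · exact (finrank_mul_right R (1 - A m) hR).2
    · convert hAR using 2 with m
      have hAm : IsSelfAdjoint (1 - A m) :=
        (IsSelfAdjoint.one _).sub (IsSelfAdjoint.of_nonneg (hA m).2.1)
      rw [← norm_star, star_mul, hAm.star_eq, hsa.star_eq]
  have hD : SmallSeq p (fun m => (1 - A m) * R + R * (1 - A m) * (1 - R)) := by
    refine SmallSeq.add hp hU ?_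
    exact SmallSeq.mul_right hp hV (1 - R)
  refine ⟨fun m => R + (1 - R) * A m * (1 - R), fun m => ⟨?_, ?_, ?_, ?_⟩, fun j => ?_⟩
  · have h1 : FinRank' ((1 - R) * A m * (1 - R)) :=
      by
      rw [← comp_three]
      exact (finrank_comp (A m) (1 - R) (1 - R) (hA m).1).1
    unfold FinRank' at h1 hR ⊢
    have hle : LinearMap.range (R + (1 - R) * A m * (1 - R)).toLinearMap ≤
      LinearMap.range R.toLinearMap ⊔
        LinearMap.range ((1 - R) * A m * (1 - R)).toLinearMap := by
      rintro _ ⟨x, rfl⟩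
      exact Submodule.add_mem_sup ⟨x, rfl⟩ ⟨x, rfl⟩
    exact Submodule.finiteDimensional_of_le hle
  · exact add_nonneg hR0 (hsa1.conjugate_nonneg (hA m).2.1)
  · have h := hsa1.conjugate_nonneg (sub_nonneg.2 (hA m).2.2)
    rw [← sub_nonneg]
    convert h using 1
    have : (1 - R) * (1 - A m) * (1 - R) = 1 - R - R + R * R - (1 - R) * A m * (1 - R) := by
      noncomm_ring
    rw [this, hRR]
    beta_reduce
    abel
  · have : (1 - R) * R = 0 := by rw [sub_mul, hRR]; simp
    rw [add_mul, mul_assoc, this, hRR]; simp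
  · have h1 : SmallSeq p (fun m => τ j * ((1 - A m) * R + R * (1 - A m) * (1 - R))) :=
      SmallSeq.mul_left hp hD (τ j)
    have h2 : SmallSeq p (fun m => ((1 - A m) * R + R * (1 - A m) * (1 - R)) * (- τ j)) :=
      SmallSeq.mul_right hp hD (- τ j)
    have h3 := SmallSeq.add hp (hS j) (SmallSeq.add hp h1 h2)
    convert h3 using 2 with m
    have e : R + (1 - R) * A m * (1 - R) =
        A m + ((1 - A m) * R + R * (1 - A m) * (1 - R)) + (R * R - R) := by noncomm_ring
    beta_reduce
    rw [e, hRR]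
    generalize (1 - A m) * R + R * (1 - A m) * (1 - R) = D
    rw [sub_self]
    noncomm_ring

theorem inf_energy_finiteRank_eq (p : ℝ) (hp : 2 ≤ p) {n : ℕ}
    (τ : Fin n → H →L[ℂ] H) (hsa : ∀ j, IsSelfAdjoint (τ j))
    (P Q : H →L[ℂ] H) (hP : IsProj' P) (hQ : IsProj' Q)
    (hPfin : FinRank' P) (hQfin : FinRank' Q) (hPQ : P * Q = 0)
    (hk : kSchatten p τ = 0) :
    sInf {c | ∃ A ∈ Czero P Q, c = Ifun p τ A} =
      sInf {c | ∃ B ∈ Cfull P Q, c = Ifun p τ B} := by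
  apply le_antisymm
  swap
  · apply sInf_le_sInf
    rintro c ⟨A, hA, rfl⟩
    exact ⟨A, hA.2, rfl⟩
  have hQP : Q * P = 0 := by
    have := congrArg star hPQ
    rwa [star_mul, hP.1.star_eq, hQ.1.star_eq, star_zero] at this
  have hR : FinRank' (P + Q) := by
    unfold FinRank' at hPfin hQfin ⊢
    have hle : LinearMap.range (P + Q).toLinearMap ≤
        LinearMap.range P.toLinearMap ⊔ LinearMap.range Q.toLinearMap := by
      rintro _ ⟨x, rfl⟩
      exact Submodule.add_mem_sup ⟨x, rfl⟩ ⟨x, rfl⟩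
    exact Submodule.finiteDimensional_of_le hle
  obtain ⟨A, hA, hS⟩ := extract' p hp τ hR (hP.1.add hQ.1)
    (by simp [add_mul, mul_add, hPQ, hQP, hP.2, hQ.2]) hk
  have hAP : ∀ m, A m * P = P := fun m => by
    have h := congrArg (· * P) (hA m).2.2.2
    simpa [mul_assoc, add_mul, hQP, hP.2] using h
  have hAQ : ∀ m, A m * Q = Q := fun m => by
    have h := congrArg (· * Q) (hA m).2.2.2
    simpa [mul_assoc, add_mul, hPQ, hQ.2] using h
  have hAn : ∀ m, ‖A m‖ ≤ 1 := fun m =>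
    (CStarAlgebra.norm_le_one_iff_of_nonneg (A m) (hA m).2.1).2 (hA m).2.2.1
  have hcol : SmallSeq p (fun m => colComm τ (A m)) := by
    simp only [colComm_sum]
    exact SmallSeq.sum hp Finset.univ fun j =>
      SmallSeq.comp hp (hS j) (fun _ => emb n j) (fun _ => 1) _ (fun _ => le_rfl)
  refine le_sInf ?_
  rintro c ⟨B, ⟨hB0, hB1, hBP, hBQ⟩, rfl⟩
  have hBn : ‖B‖ ≤ 1 := (CStarAlgebra.norm_le_one_iff_of_nonneg B hB0).2 hB1
  by_cases hfin : Ifun p τ B = ⊤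
  · rw [hfin]; exact le_top
  have h1 : ∀ X Y : H →L[ℂ] H, ‖X‖ ≤ 1 → ‖Y‖ ≤ 1 → ‖X * Y‖ ≤ 1 := fun X Y hX hY =>
    (norm_mul_le X Y).trans (mul_le_one₀ hX (norm_nonneg _) hY)
  have hone : ‖(1 : H →L[ℂ] H)‖ ≤ 1 := ContinuousLinearMap.norm_id_le
  have hb : ∀ X Y : H →L[ℂ] H, ‖X‖ ≤ 1 → ‖Y‖ ≤ 1 → ‖ampl n X‖ * ‖Y‖ ≤ 1 := fun X Y hX hY =>
    mul_le_one₀ ((ampl_norm n X).trans hX) (norm_nonneg _) hY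
  have hE : SmallSeq p (fun m => (ampl n 1).comp ((colComm τ (A m)).comp (B * A m)) +
        (ampl n (A m * B)).comp ((colComm τ (A m)).comp (1 : H →L[ℂ] H))) := by
    refine SmallSeq.add hp ?_ ?_
    · exact SmallSeq.comp hp hcol (fun _ => ampl n 1) (fun m => B * A m) 1
        (fun m => hb _ _ hone (h1 _ _ hBn (hAn m)))
    · exact SmallSeq.comp hp hcol (fun m => ampl n (A m * B)) (fun m => 1) 1
        (fun m => hb _ _ (h1 _ _ (hAn m) hBn) hone)
  refine ENNReal.le_of_forall_pos_le_add fun ε hε _ => ?_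
  obtain ⟨m, hm⟩ := (perturb hp (colComm τ B) hfin _
    (fun m => (ampl n (A m)).comp ((colComm τ B).comp (A m))) hE (fun m j => by
      simpa using sv_comp (colComm τ B) (ampl n (A m)) (A m) j (hb _ _ (hAn m) (hAn m)))
    (ε := (ε : ℝ≥0∞)) (by simpa using hε.ne')).exists
  rw [← colComm_sandwich] at hm
  refine le_trans (sInf_le ⟨A m * B * A m, ⟨?_, ?_, ?_, ?_, ?_⟩, rfl⟩) hm
  · rw [mul_assoc]
    exact (finrank_mul_right (A m) (B * A m) (hA m).1).1
  · exact (IsSelfAdjoint.of_nonneg (hA m).2.1).conjugate_nonneg hB0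
  · exact (CStarAlgebra.norm_le_one_iff_of_nonneg _
      ((IsSelfAdjoint.of_nonneg (hA m).2.1).conjugate_nonneg hB0)).1
      (h1 _ _ (h1 _ _ (hAn m) hBn) (hAn m))
  · rw [mul_assoc, hAP, mul_assoc, hBP, hAP]
  · rw [mul_assoc, hAQ, mul_assoc, hBQ, mul_zero]
end

section
/- With the hypotheses of the quasicentral condenser variational problem (τ an n-tuple of bounded selfadjoint operators, 2 ≤ p < ∞, P,Q finite rank projections with PQ = 0), there exists X ∈ C_{PQ} achieving I(X) = inf { I(A) : A ∈ C⁰_{PQ} }, and X is unique modulo the commutant N of τ: any two minimizers differ by an element commuting with all T_j. -/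
open Filter ContinuousLinearMap
open scoped ENNReal

variable {H : Type} [NormedAddCommGroup H] [InnerProductSpace ℂ H] [CompleteSpace H]

set_option linter.unusedSectionVars false
set_option linter.unusedSimpArgs false

namespace EM
open MeasureTheory

section basic
variable {K : Type} [NormedAddCommGroup K] [InnerProductSpace ℂ K] [CompleteSpace K]
variable {K₂ : Type} [NormedAddCommGroup K₂] [InnerProductSpace ℂ K₂] [CompleteSpace K₂]
variable {H₂ : Type} [NormedAddCommGroup H₂] [InnerProductSpace ℂ H₂] [CompleteSpace H₂]

noncomputable def Sp (p : ℝ) (T : H →L[ℂ] K) : ℝ≥0∞ := ∑' j : ℕ, ENNReal.ofReal (sv' T j) ^ p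

noncomputable def nu (p : ℝ) (T : H →L[ℂ] K) : ℝ≥0∞ := (Sp p T) ^ (1 / p)

lemma finRank_zero : FinRank' (0 : H →L[ℂ] K) := by
  unfold FinRank'
  have : LinearMap.range ((0 : H →L[ℂ] K).toLinearMap) = ⊥ := by ext; simp [eq_comm]
  rw [this]; infer_instance

lemma sv_bdd (T : H →L[ℂ] K) (j : ℕ) : BddBelow {r | ∃ F : H →L[ℂ] K, FinRank' F ∧
    Module.finrank ℂ (LinearMap.range F.toLinearMap) ≤ j ∧ r = ‖T - F‖} :=
  ⟨0, by rintro r ⟨F, _, _, rfl⟩; positivity⟩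

lemma sv_nonempty (T : H →L[ℂ] K) (j : ℕ) : {r | ∃ F : H →L[ℂ] K, FinRank' F ∧
    Module.finrank ℂ (LinearMap.range F.toLinearMap) ≤ j ∧ r = ‖T - F‖}.Nonempty := by
  refine ⟨_, 0, finRank_zero, ?_, rfl⟩
  have : LinearMap.range ((0 : H →L[ℂ] K).toLinearMap) = ⊥ := by ext; simp [eq_comm]
  rw [this]; simp

lemma sv_nonneg (T : H →L[ℂ] K) (j : ℕ) : 0 ≤ sv' T j := by
  refine le_csInf (sv_nonempty T j) ?_
  rintro r ⟨F, _, _, rfl⟩; positivity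

lemma sv_le (T F : H →L[ℂ] K) (j : ℕ) (hF : FinRank' F)
    (h : Module.finrank ℂ (LinearMap.range F.toLinearMap) ≤ j) : sv' T j ≤ ‖T - F‖ :=
  csInf_le (sv_bdd T j) ⟨F, hF, h, rfl⟩

lemma sv_anti (T : H →L[ℂ] K) : Antitone (sv' T) := by
  intro i j hij
  refine le_csInf (sv_nonempty T i) ?_
  rintro r ⟨F, hF, h, rfl⟩
  exact sv_le T F j hF (h.trans hij)

lemma finRank_comp (A : K →L[ℂ] K₂) (F : H →L[ℂ] K) (B : H₂ →L[ℂ] H) (hF : FinRank' F) :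
    FinRank' (A ∘L F ∘L B) ∧ Module.finrank ℂ (LinearMap.range (A ∘L F ∘L B).toLinearMap) ≤
      Module.finrank ℂ (LinearMap.range F.toLinearMap) := by
  unfold FinRank' at *
  have hle : LinearMap.range (A ∘L F ∘L B).toLinearMap ≤
      (LinearMap.range F.toLinearMap).map A.toLinearMap := by
    rintro _ ⟨x, rfl⟩
    exact ⟨F (B x), ⟨B x, rfl⟩, rfl⟩
  exact ⟨Submodule.finiteDimensional_of_le hle,
    (Submodule.finrank_mono hle).trans (Submodule.finrank_map_le _ _)⟩

lemma sv_comp (A : K →L[ℂ] K₂) (T : H →L[ℂ] K) (B : H₂ →L[ℂ] H) (j : ℕ) :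
    sv' (A ∘L T ∘L B) j ≤ ‖A‖ * sv' T j * ‖B‖ := by
  have key : ∀ F : H →L[ℂ] K, FinRank' F →
      Module.finrank ℂ (LinearMap.range F.toLinearMap) ≤ j →
      sv' (A ∘L T ∘L B) j ≤ (‖A‖ * ‖B‖) * ‖T - F‖ := by
    intro F hF h
    obtain ⟨h1, h2⟩ := finRank_comp A F B hF
    refine (sv_le _ _ j h1 (h2.trans h)).trans ?_
    have : A ∘L T ∘L B - A ∘L F ∘L B = A ∘L (T - F) ∘L B := by ext; simp
    rw [this]
    calc _ ≤ ‖A‖ * ‖(T - F) ∘L B‖ := opNorm_comp_le _ _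
      _ ≤ ‖A‖ * (‖T - F‖ * ‖B‖) := by gcongr; exact opNorm_comp_le _ _
      _ = _ := by ring
  rcases (by positivity : 0 ≤ ‖A‖ * ‖B‖).eq_or_lt with h0 | h0
  · obtain ⟨_, F, hF, h, _⟩ := sv_nonempty T j
    have := key F hF h
    rw [← h0, zero_mul] at this
    exact this.trans (mul_nonneg (mul_nonneg (norm_nonneg _) (sv_nonneg _ _)) (norm_nonneg _))
  · have : sv' (A ∘L T ∘L B) j / (‖A‖ * ‖B‖) ≤ sv' T j := by
      refine le_csInf (sv_nonempty T j) ?_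
      rintro r ⟨F, hF, h, rfl⟩
      rw [div_le_iff₀' h0]
      exact key F hF h
    rw [div_le_iff₀' h0] at this
    linarith

lemma nu_comp (p : ℝ) (hp : 2 ≤ p) (A : K →L[ℂ] K₂) (T : H →L[ℂ] K) (B : H₂ →L[ℂ] H) :
    nu p (A ∘L T ∘L B) ≤ ‖A‖ₑ * nu p T * ‖B‖ₑ := by
  have hp0 : 0 < p := by linarith
  have h : Sp p (A ∘L T ∘L B) ≤ (‖A‖ₑ * ‖B‖ₑ) ^ p * Sp p T := by
    unfold Sp
    rw [← ENNReal.tsum_mul_left]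
    refine ENNReal.tsum_le_tsum fun j => ?_
    rw [← ENNReal.mul_rpow_of_nonneg _ _ hp0.le]
    refine ENNReal.rpow_le_rpow ?_ hp0.le
    refine (ENNReal.ofReal_le_ofReal (sv_comp A T B j)).trans ?_
    rw [ENNReal.ofReal_mul (mul_nonneg (norm_nonneg _) (sv_nonneg _ _)),
      ENNReal.ofReal_mul (norm_nonneg _), ofReal_norm, ofReal_norm]
    apply le_of_eq; ring
  unfold nu
  calc _ ≤ ((‖A‖ₑ * ‖B‖ₑ) ^ p * Sp p T) ^ (1 / p) := ENNReal.rpow_le_rpow h (by positivity)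
    _ = _ := by
      rw [ENNReal.mul_rpow_of_nonneg _ _ (by positivity), ← ENNReal.rpow_mul,
        mul_one_div_cancel hp0.ne', ENNReal.rpow_one]; ring

lemma nu_finRank (p : ℝ) (hp : 2 ≤ p) (T : H →L[ℂ] K) (hT : FinRank' T) : nu p T ≠ ⊤ := by
  have hp0 : 0 < p := by linarith
  have : Sp p T ≠ ⊤ := by
    unfold Sp
    rw [tsum_eq_sum (s := Finset.range (Module.finrank ℂ (LinearMap.range T.toLinearMap)))]
    · exact ENNReal.sum_ne_top.2 fun j _ => by finiteness
    · intro j hj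
      have := sv_le T T j hT (by simpa using hj)
      rw [ENNReal.ofReal_eq_zero.2 (by simpa using this), ENNReal.zero_rpow_of_pos hp0]
  unfold nu
  finiteness

lemma compact_finRank (F : H →L[ℂ] K) (hF : FinRank' F) : IsCompactOperator F := by
  unfold FinRank' at hF
  have : LocallyCompactSpace (LinearMap.range F.toLinearMap) := by
    have := FiniteDimensional.proper ℂ (LinearMap.range F.toLinearMap)
    infer_instance
  let G : H →L[ℂ] (LinearMap.range F.toLinearMap) := F.codRestrict _ (fun x => ⟨x, rfl⟩)
  have hG : IsCompactOperator G := isCompactOperator_of_locallyCompactSpace_dom G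
  exact hG.clm_comp (LinearMap.range F.toLinearMap).subtypeL

lemma compact_of_Sp (p : ℝ) (hp : 2 ≤ p) (T : H →L[ℂ] K) (hT : Sp p T ≠ ⊤) :
    IsCompactOperator T := by
  have hp0 : 0 < p := by linarith
  have h1 := ENNReal.tendsto_atTop_zero_of_tsum_ne_top hT
  have h2 : IsClosed {f : H →L[ℂ] K | IsCompactOperator f} := isClosed_setOfPred_isCompactOperator
  suffices h : T ∈ closure {f : H →L[ℂ] K | IsCompactOperator f} by
    rwa [h2.closure_eq] at h
  rw [Metric.mem_closure_iff]
  intro ε hε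
  have h3 : ∀ᶠ j in atTop, ENNReal.ofReal (sv' T j) ^ p < ENNReal.ofReal ε ^ p :=
    h1.eventually_lt_const (ENNReal.rpow_pos (by simpa using hε) (by simp))
  obtain ⟨j, hj⟩ := h3.exists
  rw [ENNReal.rpow_lt_rpow_iff hp0, ENNReal.ofReal_lt_ofReal_iff hε] at hj
  obtain ⟨r, ⟨F, hF, _, rfl⟩, hr⟩ := exists_lt_of_csInf_lt (sv_nonempty T j) hj
  exact ⟨F, compact_finRank F hF, by rwa [dist_eq_norm]⟩

lemma exists_diag (T : H →L[ℂ] K) (hT : IsCompactOperator T) :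
    ∃ (ι : Type) (f : HilbertBasis ι ℂ H), ∀ i x,
      inner ℂ (T (f i)) (T x) = ((‖T (f i)‖ ^ 2 : ℝ) : ℂ) * inner ℂ (f i) x := by
  let S : H →L[ℂ] H := (adjoint T) ∘L T
  have hS : IsCompactOperator S := hT.clm_comp (adjoint T)
  have hsym : S.toLinearMap.IsSymmetric := by
    intro x y
    simp [S, adjoint_inner_left, adjoint_inner_right]
  have hbot := orthogonalComplement_iSup_eigenspaces_eq_bot (T := S) hS hsym
  have hfam := hsym.orthogonalFamily_eigenspaces
  have hcl : ∀ μ, IsClosed (Module.End.eigenspace S.toLinearMap μ : Set H) := by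
    intro μ
    have : (Module.End.eigenspace S.toLinearMap μ : Set H) = {x | S x = μ • x} := by
      ext x; simp [Module.End.mem_eigenspace_iff]
    rw [this]
    exact isClosed_eq (by fun_prop) (by fun_prop)
  have hc : ∀ μ, CompleteSpace (Module.End.eigenspace S.toLinearMap μ) :=
    fun μ => (hcl μ).completeSpace_coe
  choose w b hb using fun μ => exists_hilbertBasis ℂ (Module.End.eigenspace S.toLinearMap μ)
  let v : (Σ μ : ℂ, w μ) → H := fun a => (b a.1 a.2 : H)
  have hv : Orthonormal ℂ v := hfam.orthonormal_sigma_orthonormal (v_family := fun μ i => b μ i)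
    (fun μ => (b μ).orthonormal)
  have hsp : (Submodule.span ℂ (Set.range v))ᗮ = ⊥ := by
    rw [eq_bot_iff, ← hbot]
    intro x hx
    rw [Submodule.mem_orthogonal] at hx
    rw [← Submodule.iInf_orthogonal, Submodule.mem_iInf]
    intro μ
    rw [Submodule.mem_orthogonal]
    intro u hu
    have hd := (b μ).dense_span
    have : (⟨u, hu⟩ : Module.End.eigenspace S.toLinearMap μ) ∈
        (Submodule.span ℂ (Set.range (b μ))).topologicalClosure := by rw [hd]; trivial
    have hcl2 : IsClosed {u : Module.End.eigenspace S.toLinearMap μ | inner ℂ (u : H) x = 0} :=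
      isClosed_eq (by fun_prop) (by fun_prop)
    refine closure_minimal ?_ hcl2 this
    intro u hu
    induction hu using Submodule.span_induction with
    | mem u hu =>
      obtain ⟨i, rfl⟩ := hu
      exact hx _ (Submodule.subset_span ⟨⟨μ, i⟩, rfl⟩)
    | zero => simp
    | add u v _ _ hu hv => simp at hu hv ⊢; simp [inner_add_left, hu, hv]
    | smul c u _ hu => simp at hu ⊢; simp [inner_smul_left, hu]
  refine ⟨_, HilbertBasis.mkOfOrthogonalEqBot hv hsp, ?_⟩
  rintro ⟨μ, i⟩ x
  rw [HilbertBasis.coe_mkOfOrthogonalEqBot]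
  have he : S (v ⟨μ, i⟩) = μ • v ⟨μ, i⟩ := Module.End.mem_eigenspace_iff.1 (b μ i).2
  have h1 : ∀ y, inner ℂ (T (v ⟨μ, i⟩)) (T y) = (starRingEnd ℂ) μ * inner ℂ (v ⟨μ, i⟩) y := by
    intro y
    rw [← adjoint_inner_left, ← inner_smul_left, ← he]; rfl
  have h2 := h1 (v ⟨μ, i⟩)
  rw [inner_self_eq_norm_sq_to_K, inner_self_eq_norm_sq_to_K, hv.1] at h2
  rw [h1]
  congr 1
  simp at h2
  rw [← h2]; simp




lemma lint_layer {α : Type} (p : ℝ) (hp : 0 < p) (a : α → ℝ) (ha : ∀ i, 0 ≤ a i) :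
    ∑' i, ENNReal.ofReal (a i) ^ p = ENNReal.ofReal p * ∫⁻ t in Set.Ioi (0 : ℝ),
      (({i | t < a i}.encard : ℕ∞) : ℝ≥0∞) * ENNReal.ofReal (t ^ (p - 1)) := by
  let _ : MeasurableSpace α := ⊤
  have h := lintegral_rpow_eq_lintegral_meas_lt_mul (μ := Measure.count) (f := a)
    (Eventually.of_forall ha) (measurable_from_top.aemeasurable) hp
  rw [lintegral_count] at h
  simp_rw [Measure.count_apply (MeasurableSpace.measurableSet_top)] at h
  rw [← h]
  refine tsum_congr fun i => ?_
  rw [ENNReal.ofReal_rpow_of_nonneg (ha i) hp.le]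

lemma tsum_le_of_encard {α β : Type} (p : ℝ) (hp : 0 < p) (a : α → ℝ) (ha : ∀ i, 0 ≤ a i)
    (b : β → ℝ) (hb : ∀ i, 0 ≤ b i)
    (h : ∀ t, 0 < t → {i | t < a i}.encard ≤ {i | t < b i}.encard) :
    ∑' i, ENNReal.ofReal (a i) ^ p ≤ ∑' i, ENNReal.ofReal (b i) ^ p := by
  rw [lint_layer p hp a ha, lint_layer p hp b hb]
  gcongr 1
  refine setLIntegral_mono' measurableSet_Ioi ?_
  intro t ht
  gcongr
  exact_mod_cast h t ht

def Diag {ι : Type} (T : H →L[ℂ] K) (f : HilbertBasis ι ℂ H) : Prop := ∀ i x,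
      inner ℂ (T (f i)) (T x) = ((‖T (f i)‖ ^ 2 : ℝ) : ℂ) * inner ℂ (f i) x

lemma diag_hasSum {ι : Type} (T : H →L[ℂ] K) (f : HilbertBasis ι ℂ H) (hf : Diag T f) (x : H) :
    HasSum (fun l => ‖T (f l)‖ ^ 2 * ‖inner ℂ (f l) x‖ ^ 2) (‖T x‖ ^ 2) := by
  have h := f.hasSum_inner_mul_inner (adjoint T (T x)) x
  rw [adjoint_inner_left, inner_self_eq_norm_sq_to_K] at h
  have h2 : (fun i => inner ℂ (adjoint T (T x)) (f i) * inner ℂ (f i) x) =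
      fun l => ((‖T (f l)‖ ^ 2 * ‖inner ℂ (f l) x‖ ^ 2 : ℝ) : ℂ) := by
    funext l
    rw [adjoint_inner_left, ← inner_conj_symm, hf l x, map_mul, Complex.conj_ofReal, mul_assoc,
      Complex.conj_mul']
    push_cast; rfl
  rw [h2] at h
  have h3 : ((‖T x‖ : ℂ) ^ 2) = ((‖T x‖ ^ 2 : ℝ) : ℂ) := by push_cast; rfl
  change HasSum _ ((‖T x‖ : ℂ) ^ 2) at h
  rw [h3] at h
  exact Complex.hasSum_ofReal.1 h

lemma diag_enorm {ι : Type} (T : H →L[ℂ] K) (f : HilbertBasis ι ℂ H) (hf : Diag T f) (x : H) :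
    ‖T x‖ₑ ^ 2 = ∑' l, ‖inner ℂ (f l) x‖ₑ ^ 2 * ‖T (f l)‖ₑ ^ 2 := by
  have h := diag_hasSum T f hf x
  rw [← ofReal_norm, ← ENNReal.ofReal_pow (norm_nonneg _), ← h.tsum_eq,
    ENNReal.ofReal_tsum_of_nonneg (fun _ => by positivity) h.summable]
  refine tsum_congr fun l => ?_
  rw [ENNReal.ofReal_mul (by positivity), ENNReal.ofReal_pow (norm_nonneg _),
    ENNReal.ofReal_pow (norm_nonneg _), ofReal_norm, ofReal_norm, mul_comm]

lemma diag_id {ι : Type} (f : HilbertBasis ι ℂ H) : Diag (ContinuousLinearMap.id ℂ H) f := by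
  intro i x
  simp [f.orthonormal.1 i]

lemma parseval {ι : Type} (f : HilbertBasis ι ℂ H) (x : H) :
    ‖x‖ₑ ^ 2 = ∑' l, ‖inner ℂ (f l) x‖ₑ ^ 2 := by
  have := diag_enorm _ f (diag_id f) x
  simpa [← ofReal_norm, f.orthonormal.1] using this

lemma bessel {ι : Type} (e : ι → H) (he : Orthonormal ℂ e) (x : H) :
    ∑' i, ‖inner ℂ (e i) x‖ₑ ^ 2 ≤ ‖x‖ₑ ^ 2 := by
  rw [ENNReal.tsum_eq_iSup_sum]
  refine iSup_le fun s => ?_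
  have := he.sum_inner_products_le x (s := s)
  rw [← ofReal_norm, ← ENNReal.ofReal_pow (norm_nonneg _)]
  refine le_trans ?_ (ENNReal.ofReal_le_ofReal this)
  rw [ENNReal.ofReal_sum_of_nonneg (fun _ _ => by positivity)]
  refine Finset.sum_le_sum fun i _ => ?_
  rw [ENNReal.ofReal_pow (norm_nonneg _), ofReal_norm]

lemma jensen {ι : Type} (q : ℝ) (hq : 1 ≤ q) (w z : ι → ℝ≥0∞) (hw : ∑' l, w l ≤ 1) :
    (∑' l, w l * z l) ^ q ≤ ∑' l, w l * z l ^ q := by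
  have hq0 : 0 < q := by linarith
  rw [← ENNReal.le_rpow_inv_iff hq0, ENNReal.tsum_eq_iSup_sum]
  refine iSup_le fun s => ?_
  refine (ENNReal.inner_le_weight_mul_Lp_of_nonneg s hq w z).trans ?_
  have h1 : (∑ i ∈ s, w i) ^ (1 - q⁻¹) ≤ 1 := by
    apply ENNReal.rpow_le_one ((ENNReal.sum_le_tsum s).trans hw)
    have := inv_le_one_of_one_le₀ hq
    linarith
  calc _ ≤ 1 * (∑ i ∈ s, w i * z i ^ q) ^ q⁻¹ := by gcongr
    _ ≤ _ := by
      rw [one_mul]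
      exact ENNReal.rpow_le_rpow (ENNReal.sum_le_tsum s) (by positivity)

lemma sum_le_diag {ι ι' : Type} (p : ℝ) (hp : 2 ≤ p) (T : H →L[ℂ] K) (f : HilbertBasis ι ℂ H)
    (hf : Diag T f) (e : ι' → H) (he : Orthonormal ℂ e) :
    ∑' i, ‖T (e i)‖ₑ ^ p ≤ ∑' l, ‖T (f l)‖ₑ ^ p := by
  have hpow : ∀ a : ℝ≥0∞, a ^ p = (a ^ 2) ^ (p / 2) := by
    intro a
    rw [← ENNReal.rpow_natCast, ← ENNReal.rpow_mul]; congr 1; push_cast; ring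
  have h1 : ∀ i, ‖T (e i)‖ₑ ^ p ≤ ∑' l, ‖inner ℂ (f l) (e i)‖ₑ ^ 2 * ‖T (f l)‖ₑ ^ p := by
    intro i
    rw [hpow, diag_enorm T f hf]
    simp_rw [hpow ‖T (f _)‖ₑ]
    apply jensen _ (by linarith)
    rw [← parseval, ← ofReal_norm, he.1]; simp
  refine (ENNReal.tsum_le_tsum h1).trans ?_
  rw [ENNReal.tsum_comm]
  refine ENNReal.tsum_le_tsum fun l => ?_
  rw [ENNReal.tsum_mul_right]
  refine mul_le_of_le_one_left zero_le ?_
  have := bessel e he (f l)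
  rw [← ofReal_norm (f l), f.orthonormal.1] at this
  simp only [ENNReal.ofReal_one, one_pow] at this
  refine le_trans (le_of_eq (tsum_congr fun i => ?_)) this
  rw [← ofReal_norm, ← ofReal_norm, norm_inner_symm]

lemma norm_le_of_orth {ι : Type} (T : H →L[ℂ] K) (f : HilbertBasis ι ℂ H) (hf : Diag T f) (t : ℝ)
    (ht : 0 ≤ t) (y : H) (hy : ∀ l, t < ‖T (f l)‖ → inner ℂ (f l) y = 0) : ‖T y‖ ≤ t * ‖y‖ := by
  have h1 := diag_hasSum T f hf y
  have h2 := (diag_hasSum _ f (diag_id f) y).mul_left (t ^ 2)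
  have : ‖T y‖ ^ 2 ≤ t ^ 2 * ‖y‖ ^ 2 := by
    refine hasSum_le (fun l => ?_) h1 h2
    by_cases hl : t < ‖T (f l)‖
    · simp [hy l hl]
    · simp only [not_lt] at hl
      simp [f.orthonormal.1 l]
      gcongr
  rw [← mul_pow] at this
  exact (sq_le_sq₀ (norm_nonneg _) (by positivity)).1 this




lemma sv_upper {ι : Type} (T : H →L[ℂ] K) (f : HilbertBasis ι ℂ H) (hf : Diag T f) (t : ℝ)
    (ht : 0 ≤ t) : {j : ℕ | t < sv' T j}.encard ≤ {l | t < ‖T (f l)‖}.encard := by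
  by_cases hfin : {l | t < ‖T (f l)‖}.Finite
  swap
  · rw [Set.encard_eq_top_iff.2 hfin]; exact le_top
  set J := hfin.toFinset with hJ
  have hcard : {l | t < ‖T (f l)‖}.encard = (J.card : ℕ∞) := hfin.encard_eq_coe_toFinset_card
  let V : Submodule ℂ H := Submodule.span ℂ (Set.range fun l : J => f l)
  have hV : FiniteDimensional ℂ V := FiniteDimensional.span_of_finite ℂ (Set.finite_range _)
  have hVr : Module.finrank ℂ V ≤ J.card := by
    have := finrank_range_le_card (R := ℂ) (fun l : J => f l)
    simpa [Set.finrank] using this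
  let F : H →L[ℂ] K := T ∘L V.starProjection
  have hle : LinearMap.range F.toLinearMap ≤ V.map T.toLinearMap := by
    rintro _ ⟨x, rfl⟩
    exact ⟨V.starProjection x, Submodule.starProjection_apply_mem V x, rfl⟩
  have hF : FinRank' F := Submodule.finiteDimensional_of_le hle
  have hFr : Module.finrank ℂ (LinearMap.range F.toLinearMap) ≤ J.card :=
    ((Submodule.finrank_mono hle).trans (Submodule.finrank_map_le _ _)).trans hVr
  have hn : ‖T - F‖ ≤ t := by
    refine opNorm_le_bound _ ht fun x => ?_
    have h1 : (T - F) x = T (x - V.starProjection x) := by simp [F]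
    rw [h1]
    have hm : x - V.starProjection x ∈ Vᗮ := Submodule.sub_starProjection_mem_orthogonal x
    refine (norm_le_of_orth T f hf t ht _ fun l hl => ?_).trans ?_
    · exact (Submodule.mem_orthogonal _ _).1 hm _
        (Submodule.subset_span ⟨⟨l, by simpa [hJ] using hl⟩, rfl⟩)
    · gcongr
      have : x - V.starProjection x = Vᗮ.starProjection x := by
        rw [Submodule.starProjection_orthogonal']; simp
      rw [this]
      exact Submodule.norm_starProjection_apply_le _ _
  have hsub : {j : ℕ | t < sv' T j} ⊆ ((Finset.range J.card : Finset ℕ) : Set ℕ) := by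
    intro j hj
    simp only [Finset.coe_range, Set.mem_Iio]
    by_contra hlt
    have := (sv_le T F j hF (hFr.trans (not_lt.1 hlt))).trans hn
    exact absurd hj (not_lt.2 this)
  rw [hcard]
  refine (Set.encard_le_encard hsub).trans ?_
  rw [Set.encard_coe_eq_coe_finsetCard]; simp

lemma sv_lower_aux {ι : Type} (T : H →L[ℂ] K) (f : HilbertBasis ι ℂ H) (hf : Diag T f) (t : ℝ)
    (ht : 0 ≤ t) (J : Finset ι) (hJ : ∀ l ∈ J, t ≤ ‖T (f l)‖) (j : ℕ) (hj : j < J.card) :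
    t ≤ sv' T j := by
  refine le_csInf (sv_nonempty T j) ?_
  rintro r ⟨F, hF, hr, rfl⟩
  unfold FinRank' at hF
  let V : Submodule ℂ H := Submodule.span ℂ (Set.range fun l : J => f l)
  have hV : FiniteDimensional ℂ V := FiniteDimensional.span_of_finite ℂ (Set.finite_range _)
  have hVr : Module.finrank ℂ V = J.card := by
    have := finrank_span_eq_card (R := ℂ) (b := fun l : J => f l)
      (f.orthonormal.comp _ Subtype.val_injective).linearIndependent
    simpa using this
  let G : V →ₗ[ℂ] LinearMap.range F.toLinearMap := F.toLinearMap.rangeRestrict ∘ₗ V.subtype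
  have hker : LinearMap.ker G ≠ ⊥ := LinearMap.ker_ne_bot_of_finrank_lt (by omega)
  obtain ⟨x, hx, hx0⟩ := Submodule.exists_mem_ne_zero_of_ne_bot hker
  have hFx : F (x : H) = 0 := by
    have := congrArg Subtype.val (LinearMap.mem_ker.1 hx)
    simpa [G] using this
  have hxn : 0 < ‖(x : H)‖ := by simpa using hx0
  have horth : ∀ l, l ∉ J → inner ℂ (f l) (x : H) = 0 := by
    intro l hl
    have : V ≤ (ℂ ∙ (f l))ᗮ := by
      refine Submodule.span_le.2 ?_
      rintro _ ⟨m, rfl⟩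
      rw [SetLike.mem_coe, Submodule.mem_orthogonal_singleton_iff_inner_right]
      exact f.orthonormal.2 (fun h => hl (h ▸ m.2))
    exact Submodule.mem_orthogonal_singleton_iff_inner_right.1 (this x.2)
  have h1 := diag_hasSum T f hf x
  have h2 := (diag_hasSum _ f (diag_id f) x).mul_left (t ^ 2)
  have h3 : t ^ 2 * ‖(x : H)‖ ^ 2 ≤ ‖T x‖ ^ 2 := by
    refine hasSum_le (fun l => ?_) h2 h1
    by_cases hl : l ∈ J
    · simp [f.orthonormal.1 l]
      have := hJ l hl
      gcongr
    · simp [horth l hl]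
  rw [← mul_pow, sq_le_sq₀ (by positivity) (norm_nonneg _)] at h3
  have h4 : ‖T x‖ ≤ ‖T - F‖ * ‖(x : H)‖ := by
    have := (T - F).le_opNorm x
    simpa [hFx] using this
  exact le_of_mul_le_mul_right (h3.trans h4) hxn

lemma sv_lower {ι : Type} (T : H →L[ℂ] K) (f : HilbertBasis ι ℂ H) (hf : Diag T f) (t : ℝ)
    (ht : 0 ≤ t) : {l | t < ‖T (f l)‖}.encard ≤ {j : ℕ | t < sv' T j}.encard := by
  have key : ∀ J : Finset ι, (∀ l ∈ J, t < ‖T (f l)‖) →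
      (J.card : ℕ∞) ≤ {j : ℕ | t < sv' T j}.encard := by
    intro J hJ
    have : ((Finset.range J.card : Finset ℕ) : Set ℕ) ⊆ {j : ℕ | t < sv' T j} := by
      intro j hj
      simp only [Finset.coe_range, Set.mem_Iio] at hj
      have hne : J.Nonempty := Finset.card_pos.1 (by omega)
      obtain ⟨l₀, hl₀, hmin⟩ := J.exists_min_image (fun l => ‖T (f l)‖) hne
      exact (hJ l₀ hl₀).trans_le
        (sv_lower_aux T f hf _ (norm_nonneg _) J hmin j hj)
    have h := Set.encard_le_encard this
    rw [Set.encard_coe_eq_coe_finsetCard] at h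
    simpa using h
  by_cases hfin : {l | t < ‖T (f l)‖}.Finite
  · rw [hfin.encard_eq_coe_toFinset_card]
    exact key _ (by simp)
  · have : {j : ℕ | t < sv' T j}.encard = ⊤ := by
      rw [ENat.eq_top_iff_forall_ge]
      intro m
      obtain ⟨J, hJ, hc⟩ := Set.Infinite.exists_subset_card_eq hfin m
      rw [← hc]
      exact key J (fun l hl => hJ hl)
    rw [this]; exact le_top

lemma Sp_diag {ι : Type} (p : ℝ) (hp : 2 ≤ p) (T : H →L[ℂ] K) (f : HilbertBasis ι ℂ H)
    (hf : Diag T f) : Sp p T = ∑' l, ‖T (f l)‖ₑ ^ p := by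
  simp_rw [← ofReal_norm]
  have hp0 : 0 < p := by linarith
  exact le_antisymm
    (tsum_le_of_encard p hp0 _ (sv_nonneg T) _ (fun _ => norm_nonneg _)
      (fun t ht => sv_upper T f hf t ht.le))
    (tsum_le_of_encard p hp0 _ (fun _ => norm_nonneg _) _ (sv_nonneg T)
      (fun t ht => sv_lower T f hf t ht.le))

/-- upper bound over orthonormal systems -/
lemma sum_le_Sp {ι : Type} (p : ℝ) (hp : 2 ≤ p) (T : H →L[ℂ] K) (e : ι → H)
    (he : Orthonormal ℂ e) : ∑' i, ‖T (e i)‖ₑ ^ p ≤ Sp p T := by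
  by_cases hT : Sp p T = ⊤
  · rw [hT]; exact le_top
  obtain ⟨κ, f, hf⟩ := exists_diag T (compact_of_Sp p hp T hT)
  rw [Sp_diag p hp T f hf]
  exact sum_le_diag p hp T f hf e he

lemma exists_orth_of_not_compact (T : H →L[ℂ] K) (hT : ¬ IsCompactOperator T) :
    ∃ t : ℝ, 0 < t ∧ ∀ N : ℕ, ∃ e : Fin N → H, Orthonormal ℂ e ∧ ∀ i, t ≤ ‖T (e i)‖ := by
  have h2 : IsClosed {f : H →L[ℂ] K | IsCompactOperator f} := isClosed_setOfPred_isCompactOperator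
  have h3 : T ∈ {f : H →L[ℂ] K | IsCompactOperator f}ᶜ := hT
  obtain ⟨t, ht, hball⟩ := Metric.isOpen_iff.1 h2.isOpen_compl T h3
  refine ⟨t / 2, by positivity, fun N => ?_⟩
  induction N with
  | zero => exact ⟨fun i => i.elim0, ⟨fun i => i.elim0, fun i => i.elim0⟩, fun i => i.elim0⟩
  | succ N ih =>
    obtain ⟨e, he, hTe⟩ := ih
    let V : Submodule ℂ H := Submodule.span ℂ (Set.range e)
    have hV : FiniteDimensional ℂ V := FiniteDimensional.span_of_finite ℂ (Set.finite_range _)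
    let F : H →L[ℂ] K := T ∘L V.starProjection
    have hle : LinearMap.range F.toLinearMap ≤ V.map T.toLinearMap := by
      rintro _ ⟨x, rfl⟩
      exact ⟨V.starProjection x, Submodule.starProjection_apply_mem V x, rfl⟩
    have hF : FinRank' F := Submodule.finiteDimensional_of_le hle
    have hFT : t ≤ ‖T - F‖ := by
      by_contra hlt
      have : F ∈ Metric.ball T t := by
        rw [Metric.mem_ball, dist_comm, dist_eq_norm]; exact not_le.1 hlt
      exact hball this (compact_finRank F hF)
    have hex : ∃ x, t / 2 * ‖x‖ < ‖(T - F) x‖ := by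
      by_contra hno
      push Not at hno
      have := opNorm_le_bound (T - F) (by positivity) hno
      linarith
    obtain ⟨x, hx⟩ := hex
    have h1 : (T - F) x = T (x - V.starProjection x) := by simp [F]
    rw [h1] at hx
    have hm : x - V.starProjection x ∈ Vᗮ := Submodule.sub_starProjection_mem_orthogonal x
    have hny : ‖x - V.starProjection x‖ ≤ ‖x‖ := by
      have : x - V.starProjection x = Vᗮ.starProjection x := by
        rw [Submodule.starProjection_orthogonal']; simp
      rw [this]
      exact Submodule.norm_starProjection_apply_le _ _
    set y := x - V.starProjection x with hy
    have hTy : t / 2 * ‖y‖ < ‖T y‖ := lt_of_le_of_lt (by gcongr) hx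
    have hy0 : y ≠ 0 := by rintro h0; simp [h0] at hTy
    have hyn : 0 < ‖y‖ := norm_pos_iff.2 hy0
    let z : H := ((‖y‖⁻¹ : ℝ) : ℂ) • y
    have hz1 : ‖z‖ = 1 := by
      simp only [z, norm_smul, Complex.norm_real, norm_inv, norm_norm]
      field_simp
    have hez : ∀ i, inner ℂ (e i) z = 0 := by
      intro i
      simp only [z, inner_smul_right]
      rw [(Submodule.mem_orthogonal _ _).1 hm _ (Submodule.subset_span ⟨i, rfl⟩), mul_zero]
    have hze : ∀ i, inner ℂ z (e i) = 0 := fun i => by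
      rw [← inner_conj_symm, hez, map_zero]
    refine ⟨Fin.cons z e, ⟨?_, ?_⟩, ?_⟩
    · intro i
      refine Fin.cases ?_ (fun i => ?_) i
      · simpa using hz1
      · simpa using he.1 i
    · intro i j
      refine Fin.cases ?_ (fun i => ?_) i <;> refine Fin.cases ?_ (fun j => ?_) j
      · simp
      · intro _; simpa using hze j
      · intro _; simpa using hez i
      · intro h; simpa using he.2 (fun h' => h (by rw [h']))
    · intro i
      refine Fin.cases ?_ (fun i => ?_) i
      · simp only [Fin.cons_zero, z, map_smul, norm_smul, Complex.norm_real, norm_inv, norm_norm]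
        rw [inv_mul_eq_div, le_div_iff₀ hyn]
        exact hTy.le
      · simpa using hTe i

lemma compact_of_bdd (p : ℝ) (hp : 2 ≤ p) (T : H →L[ℂ] K) (M : ℝ≥0∞) (hM : M ≠ ⊤)
    (h : ∀ (N : ℕ) (e : Fin N → H), Orthonormal ℂ e → ∑ i, ‖T (e i)‖ₑ ^ p ≤ M) :
    IsCompactOperator T := by
  by_contra hT
  obtain ⟨t, ht, hN⟩ := exists_orth_of_not_compact T hT
  have hp0 : 0 < p := by linarith
  have h1 : ∀ N : ℕ, (N : ℝ≥0∞) * ENNReal.ofReal t ^ p ≤ M := by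
    intro N
    obtain ⟨e, he, hTe⟩ := hN N
    refine le_trans ?_ (h N e he)
    have : ∑ i : Fin N, ENNReal.ofReal t ^ p = (N : ℝ≥0∞) * ENNReal.ofReal t ^ p := by simp
    rw [← this]
    refine Finset.sum_le_sum fun i _ => ?_
    refine ENNReal.rpow_le_rpow ?_ hp0.le
    rw [← ofReal_norm]
    exact ENNReal.ofReal_le_ofReal (hTe i)
  have hc : ENNReal.ofReal t ^ p ≠ 0 := (ENNReal.rpow_pos (by simpa using ht) (by simp)).ne'
  have hd : M / ENNReal.ofReal t ^ p ≠ ⊤ := ENNReal.div_ne_top hM hc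
  obtain ⟨N, hlt⟩ := ENNReal.exists_nat_gt hd
  have := (ENNReal.le_div_iff_mul_le (Or.inl hc) (Or.inl (by finiteness))).2 (h1 N)
  exact absurd this (not_le.2 hlt)

/-- attainment -/
lemma exists_attain (p : ℝ) (hp : 2 ≤ p) (T : H →L[ℂ] K) (M : ℝ≥0∞) (hM : M ≠ ⊤)
    (h : ∀ (N : ℕ) (e : Fin N → H), Orthonormal ℂ e → ∑ i, ‖T (e i)‖ₑ ^ p ≤ M) :
    ∃ (ι : Type) (f : HilbertBasis ι ℂ H), Sp p T = ∑' l, ‖T (f l)‖ₑ ^ p := by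
  obtain ⟨κ, f, hf⟩ := exists_diag T (compact_of_bdd p hp T M hM h)
  exact ⟨κ, f, Sp_diag p hp T f hf⟩

lemma Sp_le_of_bdd (p : ℝ) (hp : 2 ≤ p) (T : H →L[ℂ] K) (M : ℝ≥0∞)
    (h : ∀ (N : ℕ) (e : Fin N → H), Orthonormal ℂ e → ∑ i, ‖T (e i)‖ₑ ^ p ≤ M) :
    Sp p T ≤ M := by
  by_cases hM : M = ⊤
  · rw [hM]; exact le_top
  obtain ⟨κ, f, hf⟩ := exists_attain p hp T M hM h
  rw [hf, ENNReal.tsum_eq_iSup_sum]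
  refine iSup_le fun s => ?_
  have h1 := h _ (fun i => f (s.equivFin.symm i)) (f.orthonormal.comp _
    (Subtype.val_injective.comp s.equivFin.symm.injective))
  refine le_trans (le_of_eq ?_) h1
  rw [← Finset.sum_coe_sort]
  exact (Equiv.sum_comp s.equivFin.symm (fun i : s => ‖T (f i)‖ₑ ^ p)).symm

lemma fin_sum_le (p : ℝ) (hp : 2 ≤ p) (T : H →L[ℂ] K) (N : ℕ) (e : Fin N → H)
    (he : Orthonormal ℂ e) : ∑ i, ‖T (e i)‖ₑ ^ p ≤ Sp p T := by
  have := sum_le_Sp p hp T e he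
  rwa [tsum_fintype] at this

lemma nu_add (p : ℝ) (hp : 2 ≤ p) (A B : H →L[ℂ] K) : nu p (A + B) ≤ nu p A + nu p B := by
  have hp0 : 0 < p := by linarith
  unfold nu
  rw [one_div, ENNReal.rpow_inv_le_iff hp0, ← one_div]
  refine Sp_le_of_bdd p hp _ _ fun N e he => ?_
  rw [← ENNReal.rpow_inv_le_iff hp0, ← one_div]
  calc _ ≤ (∑ i, (‖A (e i)‖ₑ + ‖B (e i)‖ₑ) ^ p) ^ (1 / p) := by
        refine ENNReal.rpow_le_rpow (Finset.sum_le_sum fun i _ => ?_) (by positivity)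
        refine ENNReal.rpow_le_rpow ?_ hp0.le
        exact enorm_add_le _ _
    _ ≤ _ := ENNReal.Lp_add_le _ _ _ (by linarith)
    _ ≤ _ := by
        refine add_le_add ?_ ?_ <;>
        exact ENNReal.rpow_le_rpow (fin_sum_le p hp _ N e he) (by positivity)




lemma clarkson (p : ℝ) (hp : 2 ≤ p) (c d : K) :
    2 * (‖c‖ₑ ^ p + ‖d‖ₑ ^ p) ≤ ‖c + d‖ₑ ^ p + ‖c - d‖ₑ ^ p := by
  have hpow : ∀ a : ℝ≥0∞, a ^ p = (a ^ 2) ^ (p / 2) := by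
    intro a
    rw [← ENNReal.rpow_natCast, ← ENNReal.rpow_mul]; congr 1; push_cast; ring
  have hq : 1 ≤ p / 2 := by linarith
  have hpar : ‖c‖ₑ ^ 2 + ‖d‖ₑ ^ 2 = 2⁻¹ * ‖c + d‖ₑ ^ 2 + 2⁻¹ * ‖c - d‖ₑ ^ 2 := by
    have h := parallelogram_law_with_norm ℂ c d
    have h2 : ‖c‖ ^ 2 + ‖d‖ ^ 2 = 2⁻¹ * ‖c + d‖ ^ 2 + 2⁻¹ * ‖c - d‖ ^ 2 := by nlinarith
    have h3 := congrArg ENNReal.ofReal h2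
    have h4 : ENNReal.ofReal (2⁻¹) = 2⁻¹ := by
      rw [ENNReal.ofReal_inv_of_pos (by norm_num)]; simp
    rw [ENNReal.ofReal_add (by positivity) (by positivity),
      ENNReal.ofReal_add (by positivity) (by positivity), ENNReal.ofReal_mul (by positivity),
      ENNReal.ofReal_mul (by positivity), h4] at h3
    simpa only [ENNReal.ofReal_pow (norm_nonneg _), ofReal_norm] using h3
  have h1 : ‖c‖ₑ ^ p + ‖d‖ₑ ^ p ≤ 2⁻¹ * ‖c + d‖ₑ ^ p + 2⁻¹ * ‖c - d‖ₑ ^ p := by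
    simp_rw [hpow]
    refine (ENNReal.add_rpow_le_rpow_add _ _ hq).trans ?_
    rw [hpar]
    exact ENNReal.rpow_arith_mean_le_arith_mean2_rpow _ _ _ _ ENNReal.inv_two_add_inv_two hq
  calc _ ≤ 2 * (2⁻¹ * ‖c + d‖ₑ ^ p + 2⁻¹ * ‖c - d‖ₑ ^ p) := by gcongr
    _ = _ := by
      rw [← mul_add, ← mul_assoc, ENNReal.mul_inv_cancel (by simp) (by simp), one_mul]

lemma strict (p : ℝ) (hp : 2 ≤ p) (c d : H →L[ℂ] K) (M : ℝ≥0∞) (hM : M ≠ ⊤)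
    (h1 : Sp p (c + d) ≤ M) (h2 : Sp p (c - d) ≤ M) (h3 : M ≤ Sp p c) : d = 0 := by
  have hp0 : 0 < p := by linarith
  have key : ∀ {ι : Type} (e : ι → H), Orthonormal ℂ e →
      ∑' i, ‖c (e i)‖ₑ ^ p + ∑' i, ‖d (e i)‖ₑ ^ p ≤ M := by
    intro ι e he
    have h : 2 * (∑' i, ‖c (e i)‖ₑ ^ p + ∑' i, ‖d (e i)‖ₑ ^ p) ≤ 2 * M := by
      rw [← ENNReal.tsum_add, ← ENNReal.tsum_mul_left]
      calc _ ≤ ∑' i, (‖(c + d) (e i)‖ₑ ^ p + ‖(c - d) (e i)‖ₑ ^ p) :=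
            ENNReal.tsum_le_tsum fun i => clarkson p hp _ _
        _ ≤ _ := by
          rw [ENNReal.tsum_add, two_mul]
          exact add_le_add ((sum_le_Sp p hp _ e he).trans h1) ((sum_le_Sp p hp _ e he).trans h2)
    exact (ENNReal.mul_le_mul_iff_right (by simp) (by simp)).1 h
  obtain ⟨ι, f, hf⟩ := exists_attain p hp c M hM (fun N e he => by
    have := le_self_add.trans (key e he)
    rwa [tsum_fintype] at this)
  have h4 := key f f.orthonormal
  rw [← hf] at h4
  have h5 : Sp p c ≠ ⊤ := ne_top_of_le_ne_top hM (le_self_add.trans h4)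
  have h6 : ∑' i, ‖d (f i)‖ₑ ^ p = 0 := by
    have : Sp p c + ∑' i, ‖d (f i)‖ₑ ^ p ≤ Sp p c + 0 := by rw [add_zero]; exact h4.trans h3
    exact le_zero_iff.1 ((ENNReal.add_le_add_iff_left h5).1 this)
  rw [ENNReal.tsum_eq_zero] at h6
  refine ContinuousLinearMap.ext_on (s := Set.range f) ?_ ?_
  · have := f.dense_span
    rw [← Submodule.dense_iff_topologicalClosure_eq_top] at this
    exact this
  · rintro _ ⟨i, rfl⟩
    have := h6 i
    rw [ENNReal.rpow_eq_zero_iff_of_pos hp0] at this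
    simpa using this

lemma lsc (p : ℝ) (hp : 2 ≤ p) (U : Ultrafilter ℕ) (cm : ℕ → H →L[ℂ] K) (c : H →L[ℂ] K)
    (hw : ∀ x y, Tendsto (fun m => inner ℂ (cm m x) y) U (nhds (inner ℂ (c x) y)))
    (M : ℝ≥0∞) (hM : Tendsto (fun m => Sp p (cm m)) U (nhds M)) : Sp p c ≤ M := by
  have hp0 : 0 < p := by linarith
  refine Sp_le_of_bdd p hp c M fun N e he => ?_
  have hlim : ∀ x, ∃ l : ℝ≥0∞, Tendsto (fun m => ‖cm m x‖ₑ) U (nhds l) ∧ ‖c x‖ₑ ≤ l := by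
    intro x
    obtain ⟨l, -, hl⟩ := isCompact_univ.ultrafilter_le_nhds (U.map fun m => ‖cm m x‖ₑ) (by simp)
    have hl' : Tendsto (fun m => ‖cm m x‖ₑ) U (nhds l) := hl
    refine ⟨l, hl', ?_⟩
    by_cases h0 : c x = 0
    · simp [h0]
    have h1 : Tendsto (fun m => ‖inner ℂ (cm m x) (c x)‖ₑ) U (nhds ‖inner ℂ (c x) (c x)‖ₑ) :=
      (hw x (c x)).enorm
    have h2 : Tendsto (fun m => ‖cm m x‖ₑ * ‖c x‖ₑ) U (nhds (l * ‖c x‖ₑ)) :=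
      ENNReal.Tendsto.mul_const hl' (Or.inr (by simp))
    have h3 : ‖inner ℂ (c x) (c x)‖ₑ ≤ l * ‖c x‖ₑ := by
      refine le_of_tendsto_of_tendsto' h1 h2 fun m => ?_
      rw [← ofReal_norm, ← ofReal_norm, ← ofReal_norm, ← ENNReal.ofReal_mul (norm_nonneg _)]
      exact ENNReal.ofReal_le_ofReal (norm_inner_le_norm _ _)
    have h4 : ‖inner ℂ (c x) (c x)‖ₑ = ‖c x‖ₑ * ‖c x‖ₑ := by
      rw [← ofReal_norm, ← ofReal_norm, ← ENNReal.ofReal_mul (norm_nonneg _),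
        inner_self_eq_norm_sq_to_K]
      congr 1
      simp [sq]
    rw [h4] at h3
    exact (ENNReal.mul_le_mul_iff_left (by simpa using h0) (by simp)).1 h3
  choose l hl hcl using hlim
  have h5 : Tendsto (fun m => ∑ i, ‖cm m (e i)‖ₑ ^ p) U (nhds (∑ i, (l (e i)) ^ p)) :=
    tendsto_finsetSum _ fun i _ => (ENNReal.continuous_rpow_const.tendsto _).comp (hl (e i))
  calc _ ≤ ∑ i, (l (e i)) ^ p := Finset.sum_le_sum fun i _ => ENNReal.rpow_le_rpow (hcl _) hp0.le
    _ ≤ M := le_of_tendsto_of_tendsto' h5 hM fun m => fin_sum_le p hp _ N e he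

lemma weak_limit (U : Ultrafilter ℕ) (A : ℕ → H →L[ℂ] H) (hA : ∀ m, ‖A m‖ ≤ 1) :
    ∃ X : H →L[ℂ] H, ∀ x y,
      Tendsto (fun m => inner ℂ (A m x) y) U (nhds (inner ℂ (X x) y)) := by
  have hb : ∀ m x y, ‖inner ℂ (A m x) y‖ ≤ 1 * ‖x‖ * ‖y‖ := fun m x y =>
    (norm_inner_le_norm _ _).trans (by gcongr; exact (A m).le_of_opNorm_le (hA m) x)
  have hex : ∀ x y, ∃ l : ℂ, Tendsto (fun m => inner ℂ (A m x) y) U (nhds l) ∧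
      ‖l‖ ≤ 1 * ‖x‖ * ‖y‖ := by
    intro x y
    obtain ⟨l, hl, hl'⟩ := (isCompact_closedBall (0 : ℂ) (1 * ‖x‖ * ‖y‖)).ultrafilter_le_nhds
      (U.map fun m => inner ℂ (A m x) y) (by
        rw [le_principal_iff]
        rw [Ultrafilter.coe_map]
        exact Filter.mem_map.2 (Filter.univ_mem' fun m => by simpa using hb m x y))
    exact ⟨l, hl', by simpa using hl⟩
  choose L hL hLb using hex
  let B := LinearMap.mk₂'ₛₗ (starRingEnd ℂ) (RingHom.id ℂ) L
    (fun x x' y => tendsto_nhds_unique (hL _ _) (by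
      simpa [inner_add_left] using (hL x y).add (hL x' y)))
    (fun c x y => tendsto_nhds_unique (hL _ _) (by
      simpa [inner_smul_left, mul_comm] using (hL x y).const_mul ((starRingEnd ℂ) c)))
    (fun x y y' => tendsto_nhds_unique (hL _ _) (by
      simpa [inner_add_right] using (hL x y).add (hL x y')))
    (fun c x y => tendsto_nhds_unique (hL _ _) (by
      simpa [inner_smul_right] using (hL x y).const_mul c))
  refine ⟨InnerProductSpace.continuousLinearMapOfBilin (B.mkContinuous₂ 1 hLb), fun x y => ?_⟩
  rw [InnerProductSpace.continuousLinearMapOfBilin_apply]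
  exact hL x y

lemma pos_limit (U : Ultrafilter ℕ) (A : ℕ → H →L[ℂ] H) (hA : ∀ m, 0 ≤ A m) (X : H →L[ℂ] H)
    (hw : ∀ x y, Tendsto (fun m => inner ℂ (A m x) y) U (nhds (inner ℂ (X x) y))) : 0 ≤ X := by
  rw [ContinuousLinearMap.nonneg_iff_isPositive, ContinuousLinearMap.isPositive_iff_complex]
  intro x
  have hcl : IsClosed {z : ℂ | ((z.re : ℂ)) = z ∧ 0 ≤ z.re} := by
    have h1 : IsClosed {z : ℂ | ((z.re : ℂ)) = z} := isClosed_eq (by fun_prop) (by fun_prop)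
    have h2 : IsClosed {z : ℂ | 0 ≤ z.re} := isClosed_le (by fun_prop) (by fun_prop)
    exact h1.inter h2
  refine hcl.mem_of_tendsto (hw x x) (Eventually.of_forall fun m => ?_)
  have := hA m
  rw [ContinuousLinearMap.nonneg_iff_isPositive, ContinuousLinearMap.isPositive_iff_complex] at this
  exact this x

lemma nu_mul_left (p : ℝ) (hp : 2 ≤ p) (A T : H →L[ℂ] H) : nu p (A * T) ≤ ‖A‖ₑ * nu p T := by
  have h := nu_comp p hp A T (ContinuousLinearMap.id ℂ H)
  refine h.trans (mul_le_of_le_one_right zero_le ?_)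
  rw [← ofReal_norm]
  exact ENNReal.ofReal_le_one.2 ContinuousLinearMap.norm_id_le

lemma nu_mul_right (p : ℝ) (hp : 2 ≤ p) (T B : H →L[ℂ] H) : nu p (T * B) ≤ nu p T * ‖B‖ₑ := by
  have h := nu_comp p hp (ContinuousLinearMap.id ℂ H) T B
  refine h.trans ?_
  gcongr
  refine mul_le_of_le_one_left zero_le ?_
  rw [← ofReal_norm]
  exact ENNReal.ofReal_le_one.2 ContinuousLinearMap.norm_id_le

lemma nu_neg (p : ℝ) (hp : 2 ≤ p) (T : H →L[ℂ] H) : nu p (-T) ≤ nu p T := by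
  have h := nu_mul_left p hp (-1) T
  rw [neg_one_mul] at h
  refine h.trans (mul_le_of_le_one_left zero_le ?_)
  rw [enorm_neg, ← ofReal_norm]
  exact ENNReal.ofReal_le_one.2 ContinuousLinearMap.norm_id_le

lemma nu_sub (p : ℝ) (hp : 2 ≤ p) (A B : H →L[ℂ] H) : nu p (A - B) ≤ nu p A + nu p B := by
  rw [sub_eq_add_neg]
  exact (nu_add p hp _ _).trans (by gcongr; exact nu_neg p hp B)

lemma tendsto_mul_finRank (S : ℕ → H →L[ℂ] H) (hS : ∀ x, Tendsto (fun m => S m x) atTop (nhds 0))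
    (E : H →L[ℂ] H) (hE : FinRank' E) : Tendsto (fun m => ‖S m * E‖ₑ) atTop (nhds 0) := by
  unfold FinRank' at hE
  let b := stdOrthonormalBasis ℂ (LinearMap.range E.toLinearMap)
  have hbound : ∀ m, ‖S m * E‖ ≤ ∑ k, ‖E‖ * ‖S m (b k)‖ := by
    intro m
    refine opNorm_le_bound _ (Finset.sum_nonneg fun _ _ => by positivity) fun x => ?_
    let y : LinearMap.range E.toLinearMap := ⟨E x, ⟨x, rfl⟩⟩
    have h1 : E x = ∑ k, b.repr y k • (b k : H) := by
      have := congrArg Subtype.val (b.sum_repr y)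
      simpa [y] using this.symm
    have h2 : (S m * E) x = ∑ k, b.repr y k • S m (b k) := by
      change S m (E x) = _
      rw [h1]; simp
    rw [h2, Finset.sum_mul]
    refine (norm_sum_le _ _).trans (Finset.sum_le_sum fun k _ => ?_)
    rw [norm_smul]
    have h3 : ‖b.repr y k‖ ≤ ‖E‖ * ‖x‖ := by
      rw [b.repr_apply_apply]
      refine (norm_inner_le_norm _ _).trans ?_
      rw [b.orthonormal.1, one_mul]
      exact E.le_opNorm x
    calc _ ≤ (‖E‖ * ‖x‖) * ‖S m (b k)‖ := by gcongr
      _ = _ := by ring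
  have hlim : Tendsto (fun m => ∑ k, ‖E‖ * ‖S m (b k)‖) atTop (nhds 0) := by
    have : Tendsto (fun m => ∑ k, ‖E‖ * ‖S m (b k)‖) atTop (nhds (∑ k, ‖E‖ * 0)) :=
      tendsto_finsetSum _ fun k _ => ((tendsto_zero_iff_norm_tendsto_zero.1 (hS (b k)))).const_mul _
    simpa using this
  have := squeeze_zero (fun m => norm_nonneg _) hbound hlim
  have h := ENNReal.tendsto_ofReal this
  simpa [ofReal_norm] using h


lemma finRank_add {A B : H →L[ℂ] H} (hA : FinRank' A) (hB : FinRank' B) : FinRank' (A + B) := by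
  unfold FinRank' at *
  refine Submodule.finiteDimensional_of_le
    (S₂ := LinearMap.range A.toLinearMap ⊔ LinearMap.range B.toLinearMap) ?_
  rintro _ ⟨x, rfl⟩
  exact Submodule.add_mem_sup ⟨x, rfl⟩ ⟨x, rfl⟩

lemma finRank_mul_mul (A F B : H →L[ℂ] H) (hF : FinRank' F) : FinRank' (A * F * B) :=
  (finRank_comp A F B hF).1

lemma norm_le_one_of {A : H →L[ℂ] H} (h0 : 0 ≤ A) (h1 : A ≤ 1) : ‖A‖ ≤ 1 :=
  (CStarAlgebra.norm_le_one_iff_of_nonneg A h0).2 h1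

lemma enorm_le_one {A : H →L[ℂ] H} (h : ‖A‖ ≤ 1) : ‖A‖ₑ ≤ 1 := by
  rw [← ofReal_norm]
  exact ENNReal.ofReal_le_one.2 h

lemma conj_nonneg {A B : H →L[ℂ] H} (hA : 0 ≤ A) (hB : IsSelfAdjoint B) : 0 ≤ B * A * B := by
  have := star_left_conjugate_nonneg hA B
  rwa [hB.star_eq] at this

lemma quasi (p : ℝ) (hp : 2 ≤ p) {n : ℕ} (τ : Fin n → H →L[ℂ] H) (hk : kSchatten p τ = 0)
    (E : H →L[ℂ] H) (hE : FinRank' E) (hEs : IsSelfAdjoint E) (hEE : E * E = E)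
    (ε : ℝ≥0∞) (hε : 0 < ε) :
    ∃ B : H →L[ℂ] H, FinRank' B ∧ 0 ≤ B ∧ B ≤ 1 ∧ B * E = E ∧
      ∀ j, nu p (τ j * B - B * τ j) ≤ ε := by
  have hε2 : 0 < ε / 2 := ENNReal.div_pos hε.ne' (by simp)
  have hlt : kSchatten p τ < ε / 2 := by rw [hk]; exact hε2
  obtain ⟨C, ⟨A, ⟨hA, -, hA1⟩, hAC⟩, hC⟩ := sInf_lt_iff.1 hlt
  have h1E : IsSelfAdjoint (1 - E) := (IsSelfAdjoint.one _).sub hEs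
  have h1EE : (1 - E) * (1 - E) = 1 - E := by
    rw [mul_sub, sub_mul, sub_mul, hEE]; simp
  have hAs : ∀ m, IsSelfAdjoint (A m) := fun m => IsSelfAdjoint.of_nonneg (hA m).2.1
  have hS := tendsto_mul_finRank (fun m => 1 - A m) (fun x => by
    have := (tendsto_const_nhds (x := x)).sub (hA1 x)
    simpa using this) E hE
  have hnE : nu p E ≠ ⊤ := nu_finRank p hp E hE
  -- the bound
  have hD : ∀ m, nu p ((E + (1 - E) * A m * (1 - E)) - A m) ≤
      (nu p E * (1 + ‖1 - E‖ₑ)) * ‖(1 - A m) * E‖ₑ := by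
    intro m
    set G := (1 - A m) * E with hG
    have hsG : star G = E * (1 - A m) := by
      rw [hG, star_mul, hEs.star_eq, star_sub, star_one, (hAs m).star_eq]
    have e1 : (E + (1 - E) * A m * (1 - E)) - A m = G * E + E * star G * (1 - E) := by
      have hx : E * (E * (1 - A m)) = E * (1 - A m) := by rw [← mul_assoc, hEE]
      have hy : (1 - A m) * E * E = (1 - A m) * E := by rw [mul_assoc, hEE]
      rw [hsG, hx, hG, hy]
      have h3 : E * E = E := hEE
      simp only [mul_sub, sub_mul, mul_one, one_mul, hEE]
      abel
    have hsn : ‖star G‖ₑ = ‖G‖ₑ := by rw [← ofReal_norm, ← ofReal_norm, norm_star]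
    rw [e1]
    calc nu p (G * E + E * star G * (1 - E)) ≤ nu p (G * E) + nu p (E * star G * (1 - E)) :=
          nu_add p hp _ _
      _ ≤ ‖G‖ₑ * nu p E + nu p E * ‖G‖ₑ * ‖1 - E‖ₑ := by
          gcongr
          · exact nu_mul_left p hp _ _
          · refine (nu_mul_right p hp _ _).trans ?_
            gcongr
            rw [← hsn]
            exact nu_mul_right p hp _ _
      _ = _ := by ring
  have hDlim : Tendsto (fun m => nu p ((E + (1 - E) * A m * (1 - E)) - A m)) atTop (nhds 0) := by
    have h2 := ENNReal.Tendsto.const_mul (a := nu p E * (1 + ‖1 - E‖ₑ)) hS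
      (Or.inr (ENNReal.mul_ne_top hnE (by finiteness)))
    rw [mul_zero] at h2
    exact tendsto_of_tendsto_of_tendsto_of_le_of_le tendsto_const_nhds h2 (fun _ => zero_le) hD
  have hev : ∀ j, ∀ᶠ m in atTop,
      2 * ‖τ j‖ₑ * nu p ((E + (1 - E) * A m * (1 - E)) - A m) < ε / 2 := by
    intro j
    have h2 := ENNReal.Tendsto.const_mul (a := 2 * ‖τ j‖ₑ) hDlim (Or.inr (by finiteness))
    rw [mul_zero] at h2
    exact h2.eventually_lt_const hε2
  obtain ⟨m, hm1, hm2⟩ := ((hAC.eventually_lt_const hC).and (eventually_all.2 hev)).exists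
  refine ⟨E + (1 - E) * A m * (1 - E), finRank_add hE (finRank_mul_mul _ _ _ (hA m).1), ?_, ?_, ?_,
    fun j => ?_⟩
  · refine add_nonneg ?_ (conj_nonneg (hA m).2.1 h1E)
    have := star_mul_self_nonneg E
    rwa [hEs.star_eq, hEE] at this
  · have h3 : 0 ≤ (1 - E) * (1 - A m) * (1 - E) :=
      conj_nonneg (sub_nonneg.2 (hA m).2.2) h1E
    rw [← sub_nonneg]
    convert h3 using 1
    rw [mul_sub (1 - E) 1, sub_mul _ _ (1 - E), mul_one, h1EE]
    abel
  · rw [add_mul, hEE, mul_assoc, sub_mul 1 E E, hEE]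
    simp
  · set B := E + (1 - E) * A m * (1 - E) with hB
    have e2 : τ j * B - B * τ j = (τ j * (B - A m) - (B - A m) * τ j) + -(A m * τ j - τ j * A m) := by
      rw [mul_sub, sub_mul]; abel
    have h5 : nu p (A m * τ j - τ j * A m) ≤ ε / 2 :=
      (le_iSup (fun j => schattenNu p (A m * τ j - τ j * A m)) j).trans hm1.le
    rw [e2]
    calc _ ≤ (nu p (τ j * (B - A m)) + nu p ((B - A m) * τ j)) + nu p (A m * τ j - τ j * A m) :=
          (nu_add p hp _ _).trans (add_le_add (nu_sub p hp _ _) (nu_neg p hp _))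
      _ ≤ (‖τ j‖ₑ * nu p (B - A m) + nu p (B - A m) * ‖τ j‖ₑ) + ε / 2 := by
          gcongr
          · exact nu_mul_left p hp _ _
          · exact nu_mul_right p hp _ _
      _ = 2 * ‖τ j‖ₑ * nu p (B - A m) + ε / 2 := by ring
      _ ≤ ε / 2 + ε / 2 := by gcongr; exact (hm2 j).le
      _ = ε := ENNReal.add_halves ε

lemma colComm_apply {n : ℕ} (τ : Fin n → H →L[ℂ] H) (A : H →L[ℂ] H) (x : H) (j : Fin n) :
    colComm τ A x j = τ j (A x) - A (τ j x) := rfl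

lemma colComm_weak {n : ℕ} (τ : Fin n → H →L[ℂ] H) (hsa : ∀ j, IsSelfAdjoint (τ j))
    (U : Ultrafilter ℕ) (A : ℕ → H →L[ℂ] H) (X : H →L[ℂ] H)
    (hw : ∀ x y, Tendsto (fun m => inner ℂ (A m x) y) U (nhds (inner ℂ (X x) y))) (x : H)
    (y : PiLp 2 (fun _ : Fin n => H)) :
    Tendsto (fun m => inner ℂ (colComm τ (A m) x) y) U (nhds (inner ℂ (colComm τ X x) y)) := by
  simp only [PiLp.inner_apply, colComm_apply, inner_sub_left]
  refine tendsto_finsetSum _ fun j _ => ?_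
  have hs : ∀ u v, inner ℂ (τ j u) v = inner ℂ u (τ j v) := by
    intro u v
    rw [← ContinuousLinearMap.adjoint_inner_right, ← ContinuousLinearMap.star_eq_adjoint,
      (hsa j).star_eq]
  simp only [hs (_ : H) (y j)]
  exact (hw x _).sub (hw _ _)

/-- coordinate injection -/
noncomputable def inj (n : ℕ) (j : Fin n) : H →L[ℂ] PiLp 2 (fun _ : Fin n => H) :=
  LinearMap.mkContinuous
    { toFun := fun x => PiLp.single 2 j x
      map_add' := fun x y => by ext k; by_cases h : k = j <;> simp [h, Pi.single_apply]
      map_smul' := fun c x => by ext k; by_cases h : k = j <;> simp [h, Pi.single_apply] } 1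
    (fun x => by simp)

/-- diagonal ampliation -/
noncomputable def dg (n : ℕ) (B : H →L[ℂ] H) (hB : ‖B‖ ≤ 1) :
    PiLp 2 (fun _ : Fin n => H) →L[ℂ] PiLp 2 (fun _ : Fin n => H) :=
  LinearMap.mkContinuous
    { toFun := fun x => WithLp.toLp 2 fun k => B (x k)
      map_add' := fun x y => by ext k; simp
      map_smul' := fun c x => by ext k; simp } 1
    (fun x => by
      rw [one_mul]
      simp only [LinearMap.coe_mk, AddHom.coe_mk, PiLp.norm_eq_of_L2]
      gcongr with k
      simpa using B.le_of_opNorm_le hB (x k))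

lemma inj_apply (n : ℕ) (j k : Fin n) (x : H) : inj n j x k = if k = j then x else 0 := by
  simp [inj, Pi.single_apply]

lemma nu_sum (p : ℝ) (hp : 2 ≤ p) {n : ℕ} {K' : Type} [NormedAddCommGroup K'] [InnerProductSpace ℂ K']
    [CompleteSpace K'] (s : Finset (Fin n)) (f : Fin n → H →L[ℂ] K') (ε : ℝ≥0∞)
    (h : ∀ j, nu p (f j) ≤ ε) : nu p (∑ j ∈ s, f j) ≤ s.card * ε := by
  classical
  induction s using Finset.induction_on with
  | empty =>
    have h1 := nu_comp p hp (0 : K' →L[ℂ] K') (0 : H →L[ℂ] K') (ContinuousLinearMap.id ℂ H)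
    simpa using h1
  | insert a s ha ih =>
    rw [Finset.sum_insert ha, Finset.card_insert_of_notMem ha]
    refine (nu_add p hp _ _).trans ((add_le_add (h a) ih).trans (le_of_eq ?_))
    push_cast; ring

lemma ge_lemma (p : ℝ) (hp : 2 ≤ p) {n : ℕ}
    (τ : Fin n → H →L[ℂ] H)
    (P Q : H →L[ℂ] H) (hP : IsProj' P) (hQ : IsProj' Q)
    (hPfin : FinRank' P) (hQfin : FinRank' Q) (hPQ : P * Q = 0)
    (hk : kSchatten p τ = 0) (X : H →L[ℂ] H) (hX : X ∈ Cfull P Q) :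
    sInf {c | ∃ A ∈ Czero P Q, c = Ifun p τ A} ≤ Ifun p τ X := by
  have hp0 : 0 < p := by linarith
  have hQP : Q * P = 0 := by
    have := congrArg star hPQ
    rwa [star_mul, hP.1.star_eq, hQ.1.star_eq, star_zero] at this
  obtain ⟨hX0, hX1, hXP, hXQ⟩ := hX
  have hXn : ‖X‖ₑ ≤ 1 := enorm_le_one (norm_le_one_of hX0 hX1)
  set m := sInf {c | ∃ A ∈ Czero P Q, c = Ifun p τ A} with hm
  have key : ∀ ε : ℝ≥0∞, 0 < ε → m ^ (1 / p) ≤ nu p (colComm τ X) + n * (2 * ε) := by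
    intro ε hε
    obtain ⟨B, hBf, hB0, hB1, hBE, hBc⟩ := quasi p hp τ hk (P + Q) (finRank_add hPfin hQfin)
      (hP.1.add hQ.1) (by rw [add_mul, mul_add, mul_add, hP.2, hQ.2, hPQ, hQP]; simp) ε hε
    have hBP : B * P = P := by
      have := congrArg (· * P) hBE
      simpa [mul_assoc, add_mul, mul_add, hP.2, hQP] using this
    have hBQ : B * Q = Q := by
      have := congrArg (· * Q) hBE
      simpa [mul_assoc, add_mul, mul_add, hQ.2, hPQ] using this
    have hBs : IsSelfAdjoint B := IsSelfAdjoint.of_nonneg hB0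
    have hBn : ‖B‖ ≤ 1 := norm_le_one_of hB0 hB1
    have hBe : ‖B‖ₑ ≤ 1 := enorm_le_one hBn
    have hY0 : 0 ≤ B * X * B := conj_nonneg hX0 hBs
    have hYn : ‖B * X * B‖ ≤ 1 := by
      have hXn' := norm_le_one_of hX0 hX1
      calc _ ≤ ‖B‖ * ‖X‖ * ‖B‖ := (norm_mul_le _ _).trans (by gcongr; exact norm_mul_le _ _)
        _ ≤ 1 * 1 * 1 := by gcongr
        _ = 1 := by norm_num
    have hY : B * X * B ∈ Czero P Q := by
      refine ⟨?_, hY0, (CStarAlgebra.norm_le_one_iff_of_nonneg _ hY0).1 hYn, ?_, ?_⟩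
      · have := finRank_mul_mul 1 B (X * B) hBf
        simpa [mul_assoc] using this
      · rw [mul_assoc, hBP, mul_assoc, hXP, hBP]
      · rw [mul_assoc, hBQ, mul_assoc, hXQ, mul_zero]
    have e : colComm τ (B * X * B) = dg n B hBn ∘L colComm τ X ∘L B +
        ∑ j, inj n j ∘L ((τ j * B - B * τ j) * (X * B) + (B * X) * (τ j * B - B * τ j)) ∘L
          (ContinuousLinearMap.id ℂ H) := by
      ext x k
      rw [ContinuousLinearMap.add_apply, ContinuousLinearMap.sum_apply, PiLp.add_apply]
      have h1 : ∀ g : Fin n → PiLp 2 (fun _ : Fin n => H), (∑ j, g j) k = ∑ j, g j k := by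
        intro g; simp
      rw [h1]
      simp only [ContinuousLinearMap.comp_apply, inj_apply, Finset.sum_ite_eq, Finset.mem_univ,
        if_true]
      change τ k (B (X (B x))) - B (X (B (τ k x))) = B (τ k (X (B x)) - X (τ k (B x))) +
        ((τ k (B (X (B x))) - B (τ k (X (B x)))) + B (X (τ k (B x) - B (τ k x))))
      simp only [map_sub]
      abel
    have hdg : ‖dg n B hBn‖ₑ ≤ 1 := by
      rw [← ofReal_norm]
      exact ENNReal.ofReal_le_one.2 (LinearMap.mkContinuous_norm_le _ zero_le_one _)
    have hinj : ∀ j, ‖(inj n j : H →L[ℂ] _)‖ₑ ≤ 1 := by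
      intro j
      rw [← ofReal_norm]
      exact ENNReal.ofReal_le_one.2 (LinearMap.mkContinuous_norm_le _ zero_le_one _)
    have hid : ‖ContinuousLinearMap.id ℂ H‖ₑ ≤ 1 := enorm_le_one ContinuousLinearMap.norm_id_le
    have hmem : m ≤ Ifun p τ (B * X * B) := sInf_le ⟨_, hY, rfl⟩
    have h3 : nu p (colComm τ (B * X * B)) ≤ nu p (colComm τ X) + n * (2 * ε) := by
      rw [e]
      refine (nu_add p hp _ _).trans (add_le_add ?_ ?_)
      · refine (nu_comp p hp _ _ _).trans ?_
        calc _ ≤ 1 * nu p (colComm τ X) * 1 := by gcongr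
          _ = _ := by simp
      · refine (nu_sum p hp Finset.univ _ (2 * ε) fun j => ?_).trans (by simp)
        refine (nu_comp p hp _ _ _).trans ?_
        have h4 : nu p ((τ j * B - B * τ j) * (X * B) + (B * X) * (τ j * B - B * τ j)) ≤ 2 * ε := by
          refine (nu_add p hp _ _).trans ?_
          have hXB : ‖X * B‖ₑ ≤ 1 := enorm_le_one ((norm_mul_le _ _).trans
            (mul_le_one₀ (norm_le_one_of hX0 hX1) (norm_nonneg _) hBn))
          have hBX : ‖B * X‖ₑ ≤ 1 := enorm_le_one ((norm_mul_le _ _).trans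
            (mul_le_one₀ hBn (norm_nonneg _) (norm_le_one_of hX0 hX1)))
          rw [two_mul]
          refine add_le_add ((nu_mul_right p hp _ _).trans ?_) ((nu_mul_left p hp _ _).trans ?_)
          · exact (mul_le_mul' (hBc j) hXB).trans (by simp)
          · exact (mul_le_mul' hBX (hBc j)).trans (by simp)
        calc _ ≤ 1 * (2 * ε) * 1 := by gcongr; exact hinj j
          _ = _ := by simp
    refine le_trans ?_ h3
    exact ENNReal.rpow_le_rpow hmem (by positivity)
  have h6 : m ^ (1 / p) ≤ nu p (colComm τ X) := by
    refine ENNReal.le_of_forall_pos_le_add fun ε hε _ => ?_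
    refine (key (ε / (2 * n + 1 : ℝ≥0∞)) (ENNReal.div_pos (by simpa using hε.ne') (by finiteness))).trans ?_
    gcongr
    calc (n : ℝ≥0∞) * (2 * (ε / (2 * n + 1))) ≤ (2 * n + 1) * (ε / (2 * n + 1)) := by
          rw [← mul_assoc, mul_comm (n : ℝ≥0∞) 2]; gcongr; exact le_self_add
      _ ≤ ε := ENNReal.mul_div_le
  exact (ENNReal.rpow_le_rpow_iff (by positivity : 0 < 1 / p)).1 h6

lemma nu_sum_ne_top (p : ℝ) (hp : 2 ≤ p) {n : ℕ} {K' : Type} [NormedAddCommGroup K']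
    [InnerProductSpace ℂ K'] [CompleteSpace K'] (s : Finset (Fin n)) (f : Fin n → H →L[ℂ] K')
    (h : ∀ j, nu p (f j) ≠ ⊤) : nu p (∑ j ∈ s, f j) ≠ ⊤ := by
  classical
  induction s using Finset.induction_on with
  | empty =>
    have h1 := nu_comp p hp (0 : K' →L[ℂ] K') (0 : H →L[ℂ] K') (ContinuousLinearMap.id ℂ H)
    refine ne_top_of_le_ne_top ?_ h1
    simp
  | insert a s ha ih =>
    rw [Finset.sum_insert ha]
    exact ne_top_of_le_ne_top (ENNReal.add_ne_top.2 ⟨h a, ih⟩) (nu_add p hp _ _)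

lemma Ifun_ne_top (p : ℝ) (hp : 2 ≤ p) {n : ℕ} (τ : Fin n → H →L[ℂ] H) (P : H →L[ℂ] H)
    (hPfin : FinRank' P) : Ifun p τ P ≠ ⊤ := by
  have hp0 : 0 < p := by linarith
  have h2 : nu p (colComm τ P) ≠ ⊤ := by
    have e : colComm τ P = ∑ j, inj n j ∘L (τ j * P - P * τ j) ∘L
        (ContinuousLinearMap.id ℂ H) := by
      ext x k
      rw [ContinuousLinearMap.sum_apply]
      have h1 : ∀ g : Fin n → PiLp 2 (fun _ : Fin n => H), (∑ j, g j) k = ∑ j, g j k := by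
        intro g; simp
      rw [h1]
      simp only [ContinuousLinearMap.comp_apply, inj_apply, Finset.sum_ite_eq,
        Finset.mem_univ, if_true]
      rfl
    rw [e]
    refine nu_sum_ne_top p hp Finset.univ _ fun j => ?_
    have hf : nu p (τ j * P - P * τ j) ≠ ⊤ := by
      refine ne_top_of_le_ne_top ?_ (nu_sub p hp _ _)
      have hPn := nu_finRank p hp P hPfin
      refine ENNReal.add_ne_top.2 ⟨ne_top_of_le_ne_top ?_ (nu_mul_left p hp _ _),
        ne_top_of_le_ne_top ?_ (nu_mul_right p hp _ _)⟩
      · exact ENNReal.mul_ne_top enorm_ne_top hPn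
      · exact ENNReal.mul_ne_top hPn enorm_ne_top
    refine ne_top_of_le_ne_top ?_ (nu_comp p hp _ _ _)
    exact ENNReal.mul_ne_top (ENNReal.mul_ne_top enorm_ne_top hf) enorm_ne_top
  intro h3
  apply h2
  change (Ifun p τ P) ^ (1 / p) = ⊤
  rw [h3, ENNReal.top_rpow_of_pos (by positivity)]

end basic
end EM

/-- Existence and uniqueness (mod the commutant of `τ`) of a minimizer of the condenser
variational problem: there is `X ∈ C_{PQ}` with
`I(X) = inf { I(A) : A ∈ C⁰_{PQ} }`, and any two such minimizers differ by an operator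
commuting with every `T_j`. -/
theorem energy_minimizer_exists_unique (p : ℝ) (hp : 2 ≤ p) {n : ℕ}
    (τ : Fin n → H →L[ℂ] H) (hsa : ∀ j, IsSelfAdjoint (τ j))
    (P Q : H →L[ℂ] H) (hP : IsProj' P) (hQ : IsProj' Q)
    (hPfin : FinRank' P) (hQfin : FinRank' Q) (hPQ : P * Q = 0)
    (hk : kSchatten p τ = 0) :
    ∃ X ∈ Cfull P Q,
      Ifun p τ X = sInf {c | ∃ A ∈ Czero P Q, c = Ifun p τ A} ∧
      ∀ X' ∈ Cfull P Q,
        Ifun p τ X' = sInf {c | ∃ A ∈ Czero P Q, c = Ifun p τ A} →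
        ∀ j, τ j * (X - X') = (X - X') * τ j := by

  have hp0 : 0 < p := by linarith
  have hge := EM.ge_lemma p hp τ P Q hP hQ hPfin hQfin hPQ hk
  set M := sInf {c | ∃ A ∈ Czero P Q, c = Ifun p τ A} with hM
  have hQP : Q * P = 0 := by
    have := congrArg star hPQ
    rwa [star_mul, hP.1.star_eq, hQ.1.star_eq, star_zero] at this
  have hproj : ∀ R : H →L[ℂ] H, IsProj' R → 0 ≤ R := fun R hR => by
    have := star_mul_self_nonneg R
    rwa [hR.1.star_eq, hR.2] at this
  have hP1 : P ≤ 1 := by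
    rw [← sub_nonneg]
    refine hproj _ ⟨(IsSelfAdjoint.one _).sub hP.1, ?_⟩
    rw [mul_sub, sub_mul, sub_mul, hP.2]; simp
  have hPC : P ∈ Czero P Q := ⟨hPfin, hproj P hP, hP1, hP.2, hPQ⟩
  have hMtop : M ≠ ⊤ := by
    have h1 : M ≤ Ifun p τ P := sInf_le ⟨P, hPC, rfl⟩
    exact ne_top_of_le_ne_top (EM.Ifun_ne_top p hp τ P hPfin) h1
  obtain ⟨u, -, hu, humem⟩ := exists_seq_tendsto_sInf
    (S := {c | ∃ A ∈ Czero P Q, c = Ifun p τ A}) ⟨_, P, hPC, rfl⟩ (OrderBot.bddBelow _)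
  choose A hA huA using humem
  let U : Ultrafilter ℕ := hyperfilter ℕ
  have hU : (U : Filter ℕ) ≤ atTop := Nat.hyperfilter_le_atTop
  obtain ⟨X, hX⟩ := EM.weak_limit U A fun m => EM.norm_le_one_of (hA m).2.1 (hA m).2.2.1
  have hXC : X ∈ Cfull P Q := by
    refine ⟨EM.pos_limit U A (fun m => (hA m).2.1) X hX, ?_, ?_, ?_⟩
    · rw [← sub_nonneg]
      refine EM.pos_limit U (fun m => 1 - A m) (fun m => sub_nonneg.2 (hA m).2.2.1) _ fun x y => ?_
      have := (tendsto_const_nhds (x := inner ℂ x y) (f := (U : Filter ℕ))).sub (hX x y)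
      simpa [inner_sub_left] using this
    · ext x
      refine ext_inner_right ℂ fun y => tendsto_nhds_unique (hX (P x) y) ?_
      have h : ∀ m, A m (P x) = P x := fun m => congrArg (fun T : H →L[ℂ] H => T x) (hA m).2.2.2.1
      simp only [h]
      exact tendsto_const_nhds
    · ext x
      refine ext_inner_right ℂ fun y => tendsto_nhds_unique (hX (Q x) y) ?_
      have h : ∀ m, A m (Q x) = 0 := fun m => congrArg (fun T : H →L[ℂ] H => T x) (hA m).2.2.2.2
      simp only [h]
      exact tendsto_const_nhds
  have hXM : Ifun p τ X = M := by
    refine le_antisymm ?_ (hge X hXC)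
    refine EM.lsc p hp U (fun m => colComm τ (A m)) (colComm τ X)
      (EM.colComm_weak τ hsa U A X hX) M ?_
    exact (hu.mono_left hU).congr fun m => huA m
  refine ⟨X, hXC, hXM, fun X' hX' hXM' j => ?_⟩
  have hlin : ∀ (a b : ℂ) (S T : H →L[ℂ] H),
      colComm τ (a • S + b • T) = a • colComm τ S + b • colComm τ T := by
    intro a b S T
    ext x k
    simp only [ContinuousLinearMap.add_apply, ContinuousLinearMap.smul_apply, PiLp.add_apply,
      PiLp.smul_apply, EM.colComm_apply, map_add, map_smul]
    module
  have hmid : ((1 / 2 : ℝ) • X + (1 / 2 : ℝ) • X') ∈ Cfull P Q := by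
    obtain ⟨a1, a2, a3, a4⟩ := hXC
    obtain ⟨b1, b2, b3, b4⟩ := hX'
    have half : (0 : ℝ) ≤ 1 / 2 := by norm_num
    refine ⟨add_nonneg (smul_nonneg half a1) (smul_nonneg half b1), ?_, ?_, ?_⟩
    · calc _ ≤ (1 / 2 : ℝ) • (1 : H →L[ℂ] H) + (1 / 2 : ℝ) • (1 : H →L[ℂ] H) :=
            add_le_add (smul_le_smul_of_nonneg_left a2 half) (smul_le_smul_of_nonneg_left b2 half)
        _ = 1 := by module
    · rw [add_mul, smul_mul_assoc, smul_mul_assoc, a3, b3]; module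
    · rw [add_mul, smul_mul_assoc, smul_mul_assoc, a4, b4]; simp
  have hmid' : (1 / 2 : ℝ) • X + (1 / 2 : ℝ) • X' = (1 / 2 : ℂ) • X + (1 / 2 : ℂ) • X' := by
    ext x
    simp only [ContinuousLinearMap.add_apply, ContinuousLinearMap.smul_apply]
    rw [← Complex.coe_smul, ← Complex.coe_smul]
    norm_num
  have hge' := hge _ hmid
  rw [hmid'] at hge'
  have hd := EM.strict p hp (colComm τ ((1 / 2 : ℂ) • X + (1 / 2 : ℂ) • X'))
    (colComm τ ((1 / 2 : ℂ) • X + (-(1 / 2) : ℂ) • X')) M hMtop (by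
      rw [hlin, hlin]
      have : (1 / 2 : ℂ) • colComm τ X + (1 / 2 : ℂ) • colComm τ X' +
        ((1 / 2 : ℂ) • colComm τ X + (-(1 / 2) : ℂ) • colComm τ X') = colComm τ X := by module
      rw [this]
      exact hXM.le) (by
      rw [hlin, hlin]
      have : (1 / 2 : ℂ) • colComm τ X + (1 / 2 : ℂ) • colComm τ X' -
        ((1 / 2 : ℂ) • colComm τ X + (-(1 / 2) : ℂ) • colComm τ X') = colComm τ X' := by module
      rw [this]
      exact hXM'.le) hge'
  ext x
  have h1 := congrArg (fun T : H →L[ℂ] PiLp 2 (fun _ : Fin n => H) => T x j) hd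
  rw [hlin] at h1
  have h2 : (1 / 2 : ℂ) • (τ j (X x) - X (τ j x)) + (-(1 / 2) : ℂ) • (τ j (X' x) - X' (τ j x)) = 0 := h1
  change τ j (X x - X' x) = X (τ j x) - X' (τ j x)
  rw [map_sub, ← sub_eq_zero]
  have h3 := congrArg (fun v => (2 : ℂ) • v) h2
  rw [smul_zero] at h3
  rw [← h3]
  module
end
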